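/- For every λ > 1 there exists a family {Y_ξ : ξ < ω₁} of separable Banach spaces with the following properties: (i) for every ξ < ω₁ the space Y_ξ is non-universal and is an 𝓛_{∞,λ+}-space; (ii) if ξ < ζ < ω₁, then Y_ξ embeds isomorphically into Y_ζ; (iii) every separable Banach space X with φ_NU(X) ≤ ξ embeds isomorphically into Y_ξ. -/

import Mathlib

open Filter Topology MeasureTheory

noncomputable section

/-! ### The Cantor set and the space `C(2^ℕ)` -/

/-- The Cantor set `2^ℕ`. -/
abbrev CantorSet : Type := ℕ → Bool

/-- The Banach space `C(2^ℕ)` of continuous real-valued functions on the Cantor set. -/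
abbrev CantorC : Type := C(CantorSet, ℝ)

/-! ### The standard Borel space `SB` of separable Banach spaces -/

/-- `SB`: the set of closed linear subspaces of `C(2^ℕ)`. -/
def SB : Type := {Y : Submodule ℝ CantorC // IsClosed (Y : Set CantorC)}

/-- The Effros-Borel σ-algebra on `SB`, generated by the sets
`{Y : Y ∩ U ≠ ∅}` for `U` open in `C(2^ℕ)`. -/
instance : MeasurableSpace SB :=
  MeasurableSpace.generateFrom
    {A : Set SB | ∃ U : Set CantorC, IsOpen U ∧ A = {Y : SB | ((Y.1 : Set CantorC) ∩ U).Nonempty}}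

/-- A subset of a standard Borel space is analytic if it is the image of a Borel map
from the Baire space `ℕ^ℕ`. -/
def IsAnalyticIn {α : Type*} [MeasurableSpace α] (A : Set α) : Prop :=
  ∃ f : (ℕ → ℕ) → α, Measurable f ∧ A = Set.range f

/-! ### Embeddings, isomorphisms, universality -/

/-- `X` embeds isomorphically into `Y`: there is a bounded linear map which is
bounded below, i.e. an isomorphism onto its range. -/
def Embeds (X Y : Type*) [SeminormedAddCommGroup X] [NormedSpace ℝ X]
    [SeminormedAddCommGroup Y] [NormedSpace ℝ Y] : Prop :=
  ∃ (T : X →L[ℝ] Y) (c : ℝ), 0 < c ∧ ∀ x : X, c * ‖x‖ ≤ ‖T x‖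

/-- `X` embeds isometrically into `Y` (i.e. `Y` contains an isometric copy of `X`). -/
def EmbedsIsometrically (X Y : Type*) [SeminormedAddCommGroup X] [NormedSpace ℝ X]
    [SeminormedAddCommGroup Y] [NormedSpace ℝ Y] : Prop :=
  Nonempty (X →ₗᵢ[ℝ] Y)

/-- `X` and `Y` are isomorphic Banach spaces (linearly homeomorphic). -/
def IsomorphicTo (X Y : Type*) [SeminormedAddCommGroup X] [NormedSpace ℝ X]
    [SeminormedAddCommGroup Y] [NormedSpace ℝ Y] : Prop :=
  Nonempty (X ≃L[ℝ] Y)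

/-- The class `NU ⊆ SB` of non-universal spaces: those `X ∈ SB` which do not contain
an isomorphic copy of `C(2^ℕ)` (equivalently, are not universal for all separable
Banach spaces). -/
def NU : Set SB := {Y : SB | ¬ Embeds CantorC Y.1}

/-- The class `NC_X ⊆ SB` of all `Y ∈ SB` containing no isomorphic copy of `X`. -/
def NCin (X : Type*) [SeminormedAddCommGroup X] [NormedSpace ℝ X] : Set SB :=
  {Y : SB | ¬ Embeds X Y.1}

/-! ### Schauder bases -/

/-- `x` is a Schauder basis of `E`: every vector has a unique representation as a
norm convergent series `Σ aₙ • xₙ`. -/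
def IsSchauderBasis {E : Type*} [SeminormedAddCommGroup E] [NormedSpace ℝ E]
    (x : ℕ → E) : Prop :=
  ∀ y : E, ∃! a : ℕ → ℝ,
    Tendsto (fun m => ∑ n ∈ Finset.range m, a n • x n) atTop (𝓝 y)

/-- `E` has a Schauder basis. -/
def HasSchauderBasis (E : Type*) [SeminormedAddCommGroup E] [NormedSpace ℝ E] : Prop :=
  ∃ x : ℕ → E, IsSchauderBasis x

/-- `x` is a monotone basis sequence: initial-segment projections have norm at most 1. -/
def IsMonotoneSeq {E : Type*} [SeminormedAddCommGroup E] [NormedSpace ℝ E]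
    (x : ℕ → E) : Prop :=
  ∀ (a : ℕ → ℝ) (k m : ℕ), k ≤ m →
    ‖∑ n ∈ Finset.range k, a n • x n‖ ≤ ‖∑ n ∈ Finset.range m, a n • x n‖

/-- `x` is a bi-monotone sequence: interval projections have norm at most 1. -/
def IsBimonotoneSeq {E : Type*} [SeminormedAddCommGroup E] [NormedSpace ℝ E]
    (x : ℕ → E) : Prop :=
  ∀ (a : ℕ → ℝ) (j k m : ℕ), j ≤ k → k ≤ m →
    ‖∑ n ∈ Finset.Ico j k, a n • x n‖ ≤ ‖∑ n ∈ Finset.range m, a n • x n‖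

/-- `x` is a Schauder basic sequence: it is a Schauder basis of its closed linear span. -/
def IsSchauderBasicSeq {E : Type*} [NormedAddCommGroup E] [NormedSpace ℝ E]
    (x : ℕ → E) : Prop :=
  ∀ y ∈ (Submodule.span ℝ (Set.range x)).topologicalClosure,
    ∃! a : ℕ → ℝ,
      Tendsto (fun m => ∑ n ∈ Finset.range m, a n • x n) atTop (𝓝 y)

/-! ### Trees, ordinal ranks and Bourgain's index -/

/-- A tree on `Λ`: a set of finite sequences closed under initial segments. -/
def IsTree {Λ : Type*} (T : Set (List Λ)) : Prop :=
  ∀ s t : List Λ, s <+: t → t ∈ T → s ∈ T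

/-- A pruned tree: every node has a proper extension in the tree. -/
def IsPruned {Λ : Type*} (T : Set (List Λ)) : Prop :=
  ∀ t ∈ T, ∃ a : Λ, t ++ [a] ∈ T

/-- `σ` is an infinite branch of `T`. -/
def IsBranch {Λ : Type*} (T : Set (List Λ)) (σ : ℕ → Λ) : Prop :=
  ∀ n : ℕ, (List.ofFn fun i : Fin n => σ i) ∈ T

/-- `T` is ill-founded: it has an infinite branch. -/
def TreeIllFounded {Λ : Type*} (T : Set (List Λ)) : Prop :=
  ∃ σ : ℕ → Λ, IsBranch T σ

/-- The derivative of a tree: its non-maximal nodes, i.e. nodes having a proper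
extension in the tree. -/
def treeDeriv {Λ : Type*} (T : Set (List Λ)) : Set (List Λ) :=
  {l | l ∈ T ∧ ∃ a : Λ, l ++ [a] ∈ T}

/-- The iterated derivatives `T^(ξ)` of a tree, defined by transfinite recursion. -/
def treeDerivIter {Λ : Type*} (T : Set (List Λ)) (ξ : Ordinal.{0}) : Set (List Λ) :=
  Ordinal.limitRecOn ξ T (fun _ S => treeDeriv S)
    (fun o _ ih => ⋂ (o' : Ordinal.{0}) (h : o' < o), ih o' h)

/-- The ordinal rank `o(T)` of a (well-founded) tree: the least `ξ` with `T^(ξ) = ∅`. -/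
def treeRank {Λ : Type*} (T : Set (List Λ)) : Ordinal.{0} :=
  sInf {ξ : Ordinal.{0} | treeDerivIter T ξ = ∅}

/-- The first uncountable ordinal `ω₁`. -/
def omega1 : Ordinal.{0} := (Cardinal.aleph 1).ord

/-- Bourgain's tree `T(Y, (e_n), δ)`: all finite sequences `(y_0, …, y_k)` in `Y`
which are `δ`-equivalent to `(e_0, …, e_k)`. -/
def bourgainTree {W : Type*} [SeminormedAddCommGroup W] [NormedSpace ℝ W] (e : ℕ → W)
    (δ : ℝ) (Y : Type*) [SeminormedAddCommGroup Y] [NormedSpace ℝ Y] : Set (List Y) :=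
  {l : List Y | ∀ a : ℕ → ℝ,
    δ * ‖∑ i ∈ Finset.range l.length, a i • e i‖ ≤
        ‖∑ i ∈ Finset.range l.length, a i • l.getD i 0‖ ∧
    ‖∑ i ∈ Finset.range l.length, a i • l.getD i 0‖ ≤
        δ⁻¹ * ‖∑ i ∈ Finset.range l.length, a i • e i‖}

open Classical in
/-- Bourgain's ordinal index of `Y` relative to a (normalized Schauder) basis `(e_n)`
of a space `W`: it equals `ω₁` if some tree `T(Y, (e_n), δ)` is ill-founded, and
otherwise `sup_{0 < δ ≤ 1} o(T(Y, (e_n), δ))`.  With `W = C(2^ℕ)` this is `φ_NU`,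
and with `W = Z` it is `φ_{NC_Z}`. -/
def bourgainIndex {W : Type*} [SeminormedAddCommGroup W] [NormedSpace ℝ W] (e : ℕ → W)
    (Y : Type*) [SeminormedAddCommGroup Y] [NormedSpace ℝ Y] : Ordinal.{0} :=
  if ∃ δ ∈ Set.Ioc (0:ℝ) 1, TreeIllFounded (bourgainTree e δ Y) then omega1
  else ⨆ δ : Set.Ioc (0:ℝ) 1, treeRank (bourgainTree e δ.1 Y)

/-! ### The Schur property and the Radon-Nikodym property -/

/-- `X` has the Schur property: weakly convergent sequences are norm convergent. -/
def HasSchurProperty (X : Type*) [SeminormedAddCommGroup X] [NormedSpace ℝ X] : Prop :=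
  ∀ (f : ℕ → X) (x : X),
    (∀ φ : X →L[ℝ] ℝ, Tendsto (fun n => φ (f n)) atTop (𝓝 (φ x))) →
    Tendsto f atTop (𝓝 x)

/-- `X` has the Radon-Nikodym property: on every finite measure space, every
`X`-valued vector measure of bounded variation which is absolutely continuous
with respect to the measure has a Bochner-integrable density. -/
def HasRNP (X : Type*) [NormedAddCommGroup X] [NormedSpace ℝ X] : Prop :=
  ∀ (Ω : Type) [MeasurableSpace Ω] (μ : Measure Ω), IsFiniteMeasure μ →
    ∀ τ : VectorMeasure Ω X,
      (∀ s : Set Ω, MeasurableSet s → μ s = 0 → τ s = 0) →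
      (∃ C : ℝ, ∀ P : Finset (Set Ω), (∀ s ∈ P, MeasurableSet s) →
        ((P : Set (Set Ω)).Pairwise fun s t => Disjoint s t) →
        ∑ s ∈ P, ‖τ s‖ ≤ C) →
      ∃ g : Ω → X, Integrable g μ ∧
        ∀ s : Set Ω, MeasurableSet s → τ s = ∫ x in s, g x ∂μ

/-! ### `𝓛_{∞,λ}`-spaces -/

/-- The Banach-Mazur distance from `G` to `ℓ∞^n` is at most `θ`, witnessed by an
isomorphism `e` with `‖e‖ ⬝ ‖e⁻¹‖ ≤ θ'` for every `θ' > θ`. -/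
def BMdistToLinftyLE (G : Type*) [SeminormedAddCommGroup G] [NormedSpace ℝ G]
    (n : ℕ) (θ : ℝ) : Prop :=
  ∀ θ' : ℝ, θ < θ' → ∃ e : G ≃L[ℝ] (Fin n → ℝ),
    ‖(e : G →L[ℝ] (Fin n → ℝ))‖ * ‖(e.symm : (Fin n → ℝ) →L[ℝ] G)‖ ≤ θ'

/-- `X` is an (infinite-dimensional) `𝓛_{∞,λ}`-space: every finite-dimensional subspace
`F` of `X` is contained in a finite-dimensional subspace `G` with `d(G, ℓ∞^(dim G)) ≤ λ`. -/
def IsLinftyLam (lam : ℝ) (X : Type*) [NormedAddCommGroup X] [NormedSpace ℝ X] : Prop :=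
  (¬ FiniteDimensional ℝ X) ∧
  ∀ F : Submodule ℝ X, FiniteDimensional ℝ F →
    ∃ G : Submodule ℝ X, F ≤ G ∧ FiniteDimensional ℝ G ∧
      BMdistToLinftyLE G (Module.finrank ℝ G) lam

/-- `X` is an `𝓛_{∞,λ+}`-space: it is an `𝓛_{∞,θ}`-space for every `θ > λ`. -/
def IsLinftyPlus (lam : ℝ) (X : Type*) [NormedAddCommGroup X] [NormedSpace ℝ X] : Prop :=
  ∀ θ : ℝ, lam < θ → IsLinftyLam θ X

/-! ### Minimal spaces and `ℓ₁` -/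

/-- The space `ℓ₁`. -/
abbrev EllOne : Type := lp (fun _ : ℕ => ℝ) 1

/-- `X` is a minimal Banach space: it is infinite-dimensional and embeds isomorphically
into every infinite-dimensional (closed) subspace of itself. -/
def IsMinimal (X : Type*) [NormedAddCommGroup X] [NormedSpace ℝ X] : Prop :=
  (¬ FiniteDimensional ℝ X) ∧
  ∀ Z : Submodule ℝ X, IsClosed (Z : Set X) → ¬ FiniteDimensional ℝ Z → Embeds X Z


/-! ### Generic: completions of seminormed spaces -/

def PSp {V : Type} [AddCommGroup V] [Module ℝ V] (_p : Seminorm ℝ V) : Type := V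

section PSpSec
variable {V : Type} [AddCommGroup V] [Module ℝ V] (p : Seminorm ℝ V)

noncomputable instance PSp.inst1 : SeminormedAddCommGroup (PSp p) :=
  AddGroupSeminorm.toSeminormedAddCommGroup (E := V) p.toAddGroupSeminorm

noncomputable instance PSp.inst2 : Module ℝ (PSp p) := inferInstanceAs (Module ℝ V)

noncomputable instance PSp.inst3 : NormedSpace ℝ (PSp p) where
  norm_smul_le a b := le_of_eq (map_smul_eq_mul p a (b : V))

abbrev Ban : Type := UniformSpace.Completion (PSp p)

noncomputable def iota : V →ₗ[ℝ] Ban p :=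
  (UniformSpace.Completion.toComplL (𝕜 := ℝ) (E := PSp p)).toLinearMap

theorem norm_iota (x : V) : ‖iota p x‖ = p x :=
  UniformSpace.Completion.norm_coe (E := PSp p) x

theorem dense_iota : DenseRange (iota p) :=
  UniformSpace.Completion.denseRange_coe (α := PSp p)

theorem Ban_ext {F : Type*} [NormedAddCommGroup F] [NormedSpace ℝ F] [CompleteSpace F]
    (f : V →ₗ[ℝ] F) (C : ℝ) (h : ∀ x, ‖f x‖ ≤ C * p x) :
    ∃ T : Ban p →L[ℝ] F, (∀ x, T (iota p x) = f x) ∧ ∀ y, ‖T y‖ ≤ C * ‖y‖ := by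
  have h' : ∀ x, ‖f x‖ ≤ C * ‖iota p x‖ := fun x => by rw [norm_iota]; exact h x
  refine ⟨f.extendOfNorm (iota p), fun x => ?_, fun y => ?_⟩
  · exact LinearMap.extendOfNorm_eq (dense_iota p) ⟨C, h'⟩ x
  · exact LinearMap.norm_extendOfNorm_apply_le (dense_iota p) C h' y

theorem Ban_le {F : Type*} [NormedAddCommGroup F] [NormedSpace ℝ F]
    (T : Ban p →L[ℝ] F) (c : ℝ) (h : ∀ x, c * p x ≤ ‖T (iota p x)‖) (y : Ban p) :
    c * ‖y‖ ≤ ‖T y‖ := by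
  refine (dense_iota p).induction_on y (isClosed_le (by fun_prop) (by fun_prop)) fun x => ?_
  rw [norm_iota]; exact h x

theorem Ban_separable (h : ∃ s : Set V, s.Countable ∧ Submodule.span ℝ s = ⊤) :
    TopologicalSpace.SeparableSpace (Ban p) := by
  obtain ⟨s, hs, hs'⟩ := h
  have h1 : TopologicalSpace.IsSeparable (Submodule.span ℝ (iota p '' s) : Set (Ban p)) :=
    (Set.Countable.isSeparable (hs.image _)).span (R := ℝ)
  rw [← Submodule.map_span, hs', Submodule.map_top] at h1
  have h2 := h1.closure
  have : closure ((LinearMap.range (iota p) : Submodule ℝ (Ban p)) : Set (Ban p)) = Set.univ := by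
    have := (dense_iota p).closure_eq
    simpa [LinearMap.coe_range] using this
  rw [this] at h2
  exact TopologicalSpace.isSeparable_univ_iff.mp h2

end PSpSec

theorem Embeds.trans' {X Y Z : Type*} [SeminormedAddCommGroup X] [NormedSpace ℝ X]
    [SeminormedAddCommGroup Y] [NormedSpace ℝ Y] [SeminormedAddCommGroup Z] [NormedSpace ℝ Z]
    (h : Embeds X Y) (h' : Embeds Y Z) : Embeds X Z := by
  obtain ⟨T, c, hc, hT⟩ := h
  obtain ⟨S, d, hd, hS⟩ := h'
  refine ⟨S.comp T, d * c, by positivity, fun x => ?_⟩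
  have := hS (T x)
  have := hT x
  simp only [ContinuousLinearMap.comp_apply]
  nlinarith

/-- Quotient seminorm. -/
theorem exists_quot_seminorm {W V : Type*} [AddCommGroup W] [Module ℝ W] [AddCommGroup V]
    [Module ℝ V] (π : W →ₗ[ℝ] V) (hπ : Function.Surjective π) (q : Seminorm ℝ W) :
    ∃ Q : Seminorm ℝ V, (∀ w, Q (π w) ≤ q w) ∧
      ∀ v ε, 0 < ε → ∃ w, π w = v ∧ q w < Q v + ε := by
  let f : V → ℝ := fun v => sInf (q '' {w | π w = v})
  have hbdd : ∀ v, BddBelow (q '' {w | π w = v}) := fun v =>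
    ⟨0, by rintro _ ⟨w, -, rfl⟩; exact apply_nonneg q w⟩
  have hne : ∀ v, (q '' {w | π w = v}).Nonempty := fun v => by
    obtain ⟨w, hw⟩ := hπ v
    exact ⟨_, w, hw, rfl⟩
  have hle : ∀ w, f (π w) ≤ q w := fun w => csInf_le (hbdd _) ⟨w, rfl, rfl⟩
  have happ : ∀ v ε, 0 < ε → ∃ w, π w = v ∧ q w < f v + ε := by
    intro v ε hε
    obtain ⟨_, ⟨w, hw, rfl⟩, h⟩ := exists_lt_of_csInf_lt (hne v) (show f v < f v + ε by linarith)
    exact ⟨w, hw, h⟩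
  refine ⟨Seminorm.ofSMulLE f ?_ ?_ ?_, hle, happ⟩
  · apply le_antisymm
    · have := hle 0
      simpa using this
    · refine le_csInf (hne 0) ?_
      rintro _ ⟨w, -, rfl⟩; exact apply_nonneg q w
  · intro x y
    refine le_of_forall_pos_le_add fun ε hε => ?_
    obtain ⟨w, hw, h⟩ := happ x (ε/2) (by linarith)
    obtain ⟨w', hw', h'⟩ := happ y (ε/2) (by linarith)
    have h1 := hle (w + w')
    rw [map_add, hw, hw'] at h1
    have h2 := map_add_le_add q w w'
    linarith
  · intro r x
    refine le_of_forall_pos_le_add fun ε hε => ?_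
    obtain ⟨w, hw, h⟩ := happ x (ε/(‖r‖+1)) (by positivity)
    have h1 := hle (r • w)
    rw [map_smul, hw, map_smul_eq_mul] at h1
    have h2 : ‖r‖ * q w ≤ ‖r‖ * (f x + ε/(‖r‖+1)) := by gcongr
    have h3 : ‖r‖ * (ε/(‖r‖+1)) ≤ ε := by
      rw [mul_div_assoc', div_le_iff₀ (by positivity)]
      nlinarith [norm_nonneg r]
    nlinarith

/-- Hahn–Banach for seminorms. -/
theorem seminorm_hahn_banach {V : Type*} [AddCommGroup V] [Module ℝ V] (p : Seminorm ℝ V)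
    (S : Submodule ℝ V) (f : S →ₗ[ℝ] ℝ) (hf : ∀ x : S, |f x| ≤ p x) :
    ∃ g : V →ₗ[ℝ] ℝ, (∀ x : S, g x = f x) ∧ ∀ x, |g x| ≤ p x := by
  obtain ⟨g, hg, hg'⟩ := exists_extension_of_le_sublinear ⟨S, f⟩ p
    (fun c hc x => by rw [map_smul_eq_mul]; simp [abs_of_pos hc])
    (fun x y => map_add_le_add p x y) (fun x => (le_abs_self _).trans (hf x))
  refine ⟨g, hg, fun x => abs_le.2 ⟨?_, hg' x⟩⟩
  have := hg' (-x)
  rw [map_neg, map_neg_eq_map] at this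
  linarith

theorem seminorm_dual_vector {V : Type*} [AddCommGroup V] [Module ℝ V] (p : Seminorm ℝ V)
    (x : V) : ∃ g : V →ₗ[ℝ] ℝ, g x = p x ∧ ∀ y, |g y| ≤ p y := by
  by_cases hx : p x = 0
  · exact ⟨0, by simp [hx], fun y => by simp⟩
  have hx0 : x ≠ 0 := by rintro rfl; simp at hx
  obtain ⟨g, hg, hg'⟩ := seminorm_hahn_banach p (Submodule.span ℝ {x})
    (p x • (LinearEquiv.toSpanNonzeroSingleton ℝ V x hx0).symm.toLinearMap) (by
      intro y
      obtain ⟨a, ha⟩ := (LinearEquiv.toSpanNonzeroSingleton ℝ V x hx0).surjective y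
      subst ha
      simp only [LinearMap.smul_apply, LinearEquiv.coe_coe, LinearEquiv.symm_apply_apply,
        smul_eq_mul]
      rw [LinearEquiv.toSpanNonzeroSingleton_apply]
      simp only [map_smul_eq_mul, abs_mul, Real.norm_eq_abs]
      rw [abs_of_nonneg (apply_nonneg p x), mul_comm])
  refine ⟨g, ?_, hg'⟩
  have h1 := hg (LinearEquiv.toSpanNonzeroSingleton ℝ V x hx0 1)
  rw [LinearMap.smul_apply, LinearEquiv.coe_coe, LinearEquiv.symm_apply_apply] at h1
  simpa using h1

/-- Finite norming sets. -/
theorem exists_norming {V : Type} [AddCommGroup V] [Module ℝ V] [FiniteDimensional ℝ V]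
    (p : Seminorm ℝ V) (l : ℝ) (hl : 1 < l) :
    ∃ (k : ℕ) (c : Fin (k+1) → V →ₗ[ℝ] ℝ), (∀ j x, |c j x| ≤ p x) ∧
      ∀ x, ∃ j, p x ≤ l * |c j x| := by
  let Q := SeparationQuotient (PSp p)
  let m : V →ₗ[ℝ] Q := (SeparationQuotient.mkCLM ℝ (PSp p)).toLinearMap
  have hm : ∀ x, ‖m x‖ = p x := fun x => SeparationQuotient.norm_mk (E := PSp p) x
  have hsurj : Function.Surjective m := SeparationQuotient.surjective_mk (X := PSp p)
  have : FiniteDimensional ℝ Q := Module.Finite.of_surjective m hsurj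
  have : ProperSpace Q := FiniteDimensional.proper ℝ Q
  have hex : ∀ u : Q, ∃ g : Q →ₗ[ℝ] ℝ, g u = ‖u‖ ∧ ∀ y, |g y| ≤ ‖y‖ := fun u => by
    obtain ⟨g, h1, h2⟩ := seminorm_dual_vector (normSeminorm ℝ Q) u
    exact ⟨g, by simpa using h1, by simpa using h2⟩
  choose g hg hg' using hex
  have hc : ∀ u, Continuous (g u) := fun u => LinearMap.continuous_of_finiteDimensional _
  obtain ⟨t, ht⟩ := (isCompact_sphere (0:Q) 1).elim_finite_subcover
    (fun u : Metric.sphere (0:Q) 1 => {v | 1 < l * |g u v|})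
    (fun u => isOpen_lt continuous_const (continuous_const.mul (hc u).abs)) (by
      intro u hu
      refine Set.mem_iUnion.2 ⟨⟨u, hu⟩, ?_⟩
      have : ‖u‖ = 1 := by simpa using hu
      simp [hg, this, hl])
  let L : List (V →ₗ[ℝ] ℝ) := 0 :: (t.toList.map fun u : Metric.sphere (0:Q) 1 => (g (u : Q)).comp m)
  have hLpos : 0 < L.length := by simp [L]
  have hL : ∀ f ∈ L, ∀ x, |f x| ≤ p x := by
    intro f hmem x
    simp only [L, List.mem_cons, List.mem_map] at hmem
    rcases hmem with rfl | ⟨u, -, rfl⟩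
    · simp
    · simpa [hm] using hg' u (m x)
  refine ⟨L.length - 1, fun j => L[j.1]'(by omega), ?_, ?_⟩
  · intro j x
    exact hL _ (List.getElem_mem _) x
  · intro x
    have key : ∃ f ∈ L, p x ≤ l * |f x| := by
      by_cases hx : p x = 0
      · exact ⟨0, by simp [L], by simp [hx]⟩
      have hpos : 0 < p x := lt_of_le_of_ne (apply_nonneg p x) (Ne.symm hx)
      have : (p x)⁻¹ • m x ∈ Metric.sphere (0:Q) 1 := by
        simp only [mem_sphere_iff_norm, sub_zero, norm_smul, hm]
        rw [norm_inv, Real.norm_of_nonneg hpos.le, inv_mul_cancel₀ hx]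
      obtain ⟨u, hu, h⟩ := Set.mem_iUnion₂.1 (ht this)
      refine ⟨(g u).comp m, ?_, ?_⟩
      · simp only [L, List.mem_cons, List.mem_map, Finset.mem_toList]
        exact Or.inr ⟨u, hu, rfl⟩
      · simp only [Set.mem_ofPred_eq, map_smul, smul_eq_mul, abs_mul, abs_inv,
          abs_of_pos hpos] at h
        have h2 := mul_lt_mul_of_pos_left h hpos
        have h3 : p x * (l * ((p x)⁻¹ * |g u (m x)|)) = l * |g u (m x)| := by
          field_simp
        rw [h3] at h2
        simpa using h2.le
    obtain ⟨f, hf, hle⟩ := key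
    obtain ⟨j, hj, rfl⟩ := List.getElem_of_mem hf
    exact ⟨⟨j, by omega⟩, hle⟩


/-! ### Perturbation -/

theorem perturb_core {X : Type*} [NormedAddCommGroup X] [NormedSpace ℝ X] [CompleteSpace X]
    (y : ℕ → X) (P : ℕ → Prop) (f : ℕ → X →L[ℝ] ℝ) (hf : ∀ n j, j < n → f n (y j) = 0)
    (hf1 : ∀ n, P n → f n (y n) = 1) (Q : Set X) (hQ : Dense Q) (ε : ℝ) (hε : 0 < ε)
    (hε1 : ε < 1) :
    ∃ T : X ≃L[ℝ] X, (∀ x, ‖T x - x‖ ≤ ε * ‖x‖) ∧ ∀ n, P n → T (y n) ∈ Q := by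
  have hpick : ∀ (n : ℕ) (w : X), ∃ v : X, w + v ∈ Q ∧ ‖v‖ ≤ ε * (1/2) ^ (n+1) / (‖f n‖ + 1) := by
    intro n w
    obtain ⟨q, hq, hd⟩ := hQ.exists_dist_lt w
      (show 0 < ε * (1/2) ^ (n+1) / (‖f n‖ + 1) by positivity)
    refine ⟨q - w, by simpa using hq, ?_⟩
    rw [← dist_eq_norm, dist_comm]; exact hd.le
  choose pick hpQ hpn using hpick
  let T : ℕ → X →L[ℝ] X := fun n => Nat.rec (ContinuousLinearMap.id ℝ X)
    (fun n S => S + (f n).smulRight (pick n (S (y n)))) n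
  have hT0 : T 0 = ContinuousLinearMap.id ℝ X := rfl
  have hTs : ∀ n, T (n+1) = T n + (f n).smulRight (pick n (T n (y n))) := fun n => rfl
  let K : ℕ → X →L[ℝ] X := fun n => (f n).smulRight (pick n (T n (y n)))
  have hK : ∀ n, ‖K n‖ ≤ ε * (1/2) ^ (n+1) := by
    intro n
    simp only [K, ContinuousLinearMap.norm_smulRight_apply]
    calc _ ≤ ‖f n‖ * (ε * (1/2) ^ (n+1) / (‖f n‖ + 1)) := by gcongr; exact hpn _ _
      _ ≤ _ := by
        rw [mul_div_assoc', div_le_iff₀ (by positivity)]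
        have : 0 ≤ ε * (1/2) ^ (n+1) := by positivity
        nlinarith [norm_nonneg (f n)]
  have hg : HasSum (fun n : ℕ => ε * (1/2 : ℝ) ^ (n+1)) ε := by
    have := (hasSum_geometric_two).mul_left (ε * (1/2))
    have e1 : (fun n : ℕ => ε * (1/2 : ℝ) ^ (n+1)) = fun n : ℕ => ε * (1/2) * (1/2 : ℝ) ^ n := by
      funext n; ring
    have e2 : ε * (1/2) * 2 = ε := by ring
    rw [e1]
    rwa [e2] at this
  have hsum : Summable K := Summable.of_norm_bounded hg.summable hK
  have hnorm : ‖∑' n, K n‖ ≤ ε := tsum_of_norm_bounded hg hK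
  have hpart : ∀ n, T n = ContinuousLinearMap.id ℝ X + ∑ m ∈ Finset.range n, K m := by
    intro n
    induction n with
    | zero => simp [hT0]
    | succ n ih => rw [Finset.sum_range_succ, ← add_assoc, ← ih, hTs]
  let u : (X →L[ℝ] X)ˣ := Units.oneSub (-∑' n, K n) (by rw [norm_neg]; linarith)
  have hu : ∀ x, (u : X →L[ℝ] X) x = x + (∑' n, K n) x := by
    intro x
    simp [u, Units.val_oneSub]
  refine ⟨ContinuousLinearEquiv.unitsEquiv ℝ X u, fun x => ?_, fun n hP => ?_⟩
  · rw [ContinuousLinearEquiv.unitsEquiv_apply, hu, add_sub_cancel_left]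
    exact ((∑' n, K n).le_opNorm x).trans (by gcongr)
  · rw [ContinuousLinearEquiv.unitsEquiv_apply, hu]
    have h1 : (∑' m, K m) (y n) = ∑' m, K m (y n) :=
      ((ContinuousLinearMap.apply ℝ X (y n)).map_tsum hsum)
    have h2 : ∑' m, K m (y n) = ∑ m ∈ Finset.range (n+1), K m (y n) := by
      apply tsum_eq_sum
      intro m hm
      have : n < m := by simpa [Nat.lt_succ_iff] using hm
      simp [K, hf m n this]
    have h3 : y n + ∑ m ∈ Finset.range (n+1), K m (y n) = T n (y n) + pick n (T n (y n)) := by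
      rw [Finset.sum_range_succ, ← add_assoc]
      congr 1
      · rw [hpart]; simp
      · simp [K, hf1 n hP]
    rw [h1, h2, h3]
    exact hpQ _ _

theorem exists_dual_last {X : Type*} [NormedAddCommGroup X] [NormedSpace ℝ X]
    (n : ℕ) (y : Fin (n+1) → X) (hy : LinearIndependent ℝ y) :
    ∃ f : X →L[ℝ] ℝ, (∀ j : Fin n, f (y j.castSucc) = 0) ∧ f (y (Fin.last n)) = 1 := by
  let b := Module.Basis.span hy
  have : FiniteDimensional ℝ (Submodule.span ℝ (Set.range y)) :=
    FiniteDimensional.span_of_finite ℝ (Set.finite_range y)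
  obtain ⟨g, hg, -⟩ := exists_extension_norm_eq (𝕜 := ℝ) (Submodule.span ℝ (Set.range y))
    (LinearMap.toContinuousLinearMap (b.coord (Fin.last n)))
  have h : ∀ i, g (y i) = if i = Fin.last n then 1 else 0 := by
    intro i
    have h1 := hg (b i)
    have h2 : (b i : X) = y i := by simp [b, Module.Basis.span_apply]
    rw [h2] at h1
    rw [h1]
    simp [Finsupp.single_apply]
  refine ⟨g, fun j => ?_, by simp [h]⟩
  rw [h, if_neg (Fin.castSucc_lt_last j).ne]

theorem perturb {X : Type*} [NormedAddCommGroup X] [NormedSpace ℝ X] [CompleteSpace X]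
    (y : ℕ → X) (hy : LinearIndependent ℝ y) (Q : Set X) (hQ : Dense Q) (ε : ℝ) (hε : 0 < ε)
    (hε1 : ε < 1) :
    ∃ T : X ≃L[ℝ] X, (∀ x, ‖T x - x‖ ≤ ε * ‖x‖) ∧ ∀ n, T (y n) ∈ Q := by
  have : ∀ n, ∃ f : X →L[ℝ] ℝ, (∀ j, j < n → f (y j) = 0) ∧ f (y n) = 1 := by
    intro n
    obtain ⟨f, h1, h2⟩ := exists_dual_last n (fun i : Fin (n+1) => y i)
      (hy.comp _ Fin.val_injective)
    exact ⟨f, fun j hj => h1 ⟨j, hj⟩, h2⟩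
  choose f h1 h2 using this
  obtain ⟨T, hT, hT'⟩ := perturb_core y (fun _ => True) f h1 (fun n _ => h2 n) Q hQ ε hε hε1
  exact ⟨T, hT, fun n => hT' n trivial⟩

theorem perturb_fin {X : Type*} [NormedAddCommGroup X] [NormedSpace ℝ X] [CompleteSpace X]
    (m : ℕ) (y : Fin m → X) (hy : LinearIndependent ℝ y) (Q : Set X) (hQ : Dense Q) (ε : ℝ)
    (hε : 0 < ε) (hε1 : ε < 1) :
    ∃ T : X ≃L[ℝ] X, (∀ x, ‖T x - x‖ ≤ ε * ‖x‖) ∧ ∀ n, T (y n) ∈ Q := by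
  let y' : ℕ → X := fun n => if h : n < m then y ⟨n, h⟩ else 0
  have : ∀ n, ∃ f : X →L[ℝ] ℝ, (∀ j, j < n → f (y' j) = 0) ∧ (n < m → f (y' n) = 1) := by
    intro n
    by_cases hn : n < m
    · obtain ⟨f, h1, h2⟩ := exists_dual_last n (fun i : Fin (n+1) => y ⟨i, by omega⟩)
        (hy.comp _ (fun i j h => by simpa [Fin.ext_iff] using h))
      refine ⟨f, fun j hj => ?_, fun _ => ?_⟩
      · have := h1 ⟨j, hj⟩
        simpa [y', show j < m by omega] using this
      · simpa [y', hn] using h2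
    · exact ⟨0, by simp, fun h => absurd h hn⟩
  choose f h1 h2 using this
  obtain ⟨T, hT, hT'⟩ := perturb_core y' (fun n => n < m) f h1 h2 Q hQ ε hε hε1
  refine ⟨T, hT, fun n => ?_⟩
  have := hT' n n.2
  simpa [y'] using this


/-! ### The Bourgain–Pisier step in coordinates -/

theorem seminorm_hb_along {A V : Type*} [AddCommGroup V] [Module ℝ V] [AddCommGroup A]
    [Module ℝ A] (p : Seminorm ℝ V) (i : A →ₗ[ℝ] V) (hi : Function.Injective i)
    (f : A →ₗ[ℝ] ℝ) (hf : ∀ x, |f x| ≤ p (i x)) :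
    ∃ g : V →ₗ[ℝ] ℝ, (∀ x, g (i x) = f x) ∧ ∀ x, |g x| ≤ p x := by
  let e := LinearEquiv.ofInjective i hi
  obtain ⟨g, h1, h2⟩ := seminorm_hahn_banach p (LinearMap.range i) (f.comp e.symm.toLinearMap) (by
    intro x
    obtain ⟨a, rfl⟩ := e.surjective x
    simpa [e] using hf a)
  refine ⟨g, fun x => ?_, h2⟩
  have := h1 (e x)
  simpa [e] using this

theorem exists_norming_sub {V : Type} [AddCommGroup V] [Module ℝ V] (W : Submodule ℝ V)
    [FiniteDimensional ℝ W] (p : Seminorm ℝ V) (l : ℝ) (hl : 1 < l) :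
    ∃ (k : ℕ) (c : Fin (k+1) → V →ₗ[ℝ] ℝ), (∀ j x, |c j x| ≤ p x) ∧
      ∀ x ∈ W, ∃ j, p x ≤ l * |c j x| := by
  obtain ⟨k, c, h1, h2⟩ := exists_norming (p.comp W.subtype) l hl
  have : ∀ j, ∃ g : V →ₗ[ℝ] ℝ, (∀ x : W, g x = c j x) ∧ ∀ x, |g x| ≤ p x := fun j =>
    seminorm_hahn_banach p W (c j) (by simpa using h1 j)
  choose g hg hg' using this
  refine ⟨k, g, hg', fun x hx => ?_⟩
  obtain ⟨j, hj⟩ := h2 ⟨x, hx⟩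
  exact ⟨j, by simpa [← hg] using hj⟩

theorem exists_quot2 {W V V1 V2 : Type*} [AddCommGroup W] [Module ℝ W] [AddCommGroup V]
    [Module ℝ V] [AddCommGroup V1] [Module ℝ V1] [AddCommGroup V2] [Module ℝ V2]
    (π : W →ₗ[ℝ] V) (hπ : Function.Surjective π) (p1 : Seminorm ℝ V1) (p2 : Seminorm ℝ V2)
    (f1 : W →ₗ[ℝ] V1) (f2 : W →ₗ[ℝ] V2) :
    ∃ Q : Seminorm ℝ V, (∀ w, Q (π w) ≤ p1 (f1 w) + p2 (f2 w)) ∧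
      ∀ v ε, 0 < ε → ∃ w, π w = v ∧ p1 (f1 w) + p2 (f2 w) < Q v + ε :=
  exists_quot_seminorm π hπ (p1.comp f1 + p2.comp f2)

theorem exists_quot3 {W V V1 V2 V3 : Type*} [AddCommGroup W] [Module ℝ W] [AddCommGroup V]
    [Module ℝ V] [AddCommGroup V1] [Module ℝ V1] [AddCommGroup V2] [Module ℝ V2]
    [AddCommGroup V3] [Module ℝ V3]
    (π : W →ₗ[ℝ] V) (hπ : Function.Surjective π) (p1 : Seminorm ℝ V1) (p2 : Seminorm ℝ V2)
    (p3 : Seminorm ℝ V3) (f1 : W →ₗ[ℝ] V1) (f2 : W →ₗ[ℝ] V2) (f3 : W →ₗ[ℝ] V3) :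
    ∃ Q : Seminorm ℝ V, (∀ w, Q (π w) ≤ p1 (f1 w) + p2 (f2 w) + p3 (f3 w)) ∧
      ∀ v ε, 0 < ε → ∃ w, π w = v ∧ p1 (f1 w) + p2 (f2 w) + p3 (f3 w) < Q v + ε :=
  exists_quot_seminorm π hπ (p1.comp f1 + p2.comp f2 + p3.comp f3)

structure Stage (Γ Z : Type) [NormedAddCommGroup Z] [NormedSpace ℝ Z] where
  S : Finset Γ
  N : Seminorm ℝ (Γ →₀ ℝ)
  C : Γ → (Γ →₀ ℝ) →ₗ[ℝ] ℝ
  R : Submodule ℝ ((Γ →₀ ℝ) × Z)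

section StepSec
variable {Γ Z : Type} [NormedAddCommGroup Z] [NormedSpace ℝ Z]

/-- vectors supported on the labels of the stage -/
abbrev Stage.VS (st : Stage Γ Z) : Submodule ℝ (Γ →₀ ℝ) := Finsupp.supported ℝ ℝ (st.S : Set Γ)

noncomputable def Stage.A (st : Stage Γ Z) : Seminorm ℝ (Γ →₀ ℝ) :=
  st.S.sup fun γ => (normSeminorm ℝ ℝ).comp (st.C γ)

theorem Stage.le_A (st : Stage Γ Z) {γ : Γ} (h : γ ∈ st.S) (x) : |st.C γ x| ≤ st.A x := by
  have := Seminorm.le_finset_sup_apply (p := fun γ => (normSeminorm ℝ ℝ).comp (st.C γ))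
    (s := st.S) (x := x) h
  simpa [Stage.A] using this

theorem Stage.A_le (st : Stage Γ Z) (x) {B : ℝ} (hB : 0 ≤ B) (h : ∀ γ ∈ st.S, |st.C γ x| ≤ B) :
    st.A x ≤ B := by
  apply Seminorm.finset_sup_apply_le hB
  simpa using h

structure Stage.Good (lam : ℝ) (st : Stage Γ Z) : Prop where
  a : ∀ γ ∈ st.S, ∀ x, |st.C γ x| ≤ st.N x
  b : ∀ x, st.N x ≤ lam * st.A x
  c : ∀ c : Γ → ℝ, ∃ v ∈ st.VS, ∀ γ ∈ st.S, st.C γ v = c γ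
  c' : ∀ γ ∈ st.S, ∀ x y : Γ →₀ ℝ, (∀ δ ∈ st.S, x δ = y δ) → st.C γ x = st.C γ y
  d : ∀ u z, (u, z) ∈ st.R → u ∈ st.VS ∧ st.N u = ‖z‖
  K : ∀ γ ∈ st.S, ∃ K : ℝ, 0 ≤ K ∧ ∀ x : Γ →₀ ℝ, |x γ| ≤ K * st.N x
  fd : FiniteDimensional ℝ st.R

structure Stage.Ext (lam lam' : ℝ) (g : Z) (st st' : Stage Γ Z) : Prop where
  sub : st.S ⊆ st'.S
  N_eq : ∀ x ∈ st.VS, st'.N x = st.N x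
  C_eq : ∀ γ ∈ st.S, st'.C γ = st.C γ
  R_le : st.R ≤ st'.R
  gen : ∃ b, (b, g) ∈ st'.R
  R_gen : ∀ r ∈ st'.R, ∃ r' ∈ st.R, ∃ τ : ℝ, r.2 = r'.2 + τ • g
  K : ∀ γ ∈ st'.S, γ ∉ st.S → ∀ x : Γ →₀ ℝ, |x γ| ≤ (1 + lam) * st'.N x
  i : ∀ y ε, 0 < ε → ∃ p x u z, x ∈ st.VS ∧ (u, z) ∈ st'.R ∧ y = p + x + u ∧
    lam * st'.A p + st.N x + ‖z‖ ≤ st'.N y + ε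
  ii : ∀ x u z, x ∈ st.VS → (u, z) ∈ st'.R → st'.N (x + u) ≤ lam' * st'.A (x + u)
  iii : ∀ x u z ε, x ∈ st.VS → (u, z) ∈ st'.R → 0 < ε → ∃ x' u' z', x' ∈ st.VS ∧
    (u', z') ∈ st'.R ∧ x + u = x' + u' ∧ st.N x' ≤ st'.N (x + u) + ε
  v : ∀ u z, u ∈ st.VS → (u, z) ∈ st'.R → (u, z) ∈ st.R

theorem Stage.Good.N_le {lam : ℝ} {st : Stage Γ Z} (h : st.Good lam) (hl : 0 ≤ lam) (x) {B : ℝ}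
    (hB : 0 ≤ B) (h' : ∀ γ ∈ st.S, |st.C γ x| ≤ B) : st.N x ≤ lam * B :=
  (h.b x).trans (by gcongr; exact st.A_le x hB h')

theorem Stage.Good.N_congr {lam : ℝ} {st : Stage Γ Z} (h : st.Good lam) (hl : 0 ≤ lam)
    (x y : Γ →₀ ℝ) (hxy : ∀ δ ∈ st.S, x δ = y δ) : st.N x = st.N y := by
  have key : st.N (x - y) = 0 := by
    apply le_antisymm _ (apply_nonneg _ _)
    have := h.N_le hl (x - y) le_rfl (fun γ hγ => by
      rw [map_sub, h.c' γ hγ x y hxy]; simp)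
    simpa using this
  have h1 := map_add_le_add st.N (x - y) y
  have h2 := map_add_le_add st.N (-(x - y)) x
  rw [map_neg_eq_map] at h2
  have e1 : x - y + y = x := by abel
  have e2 : -(x - y) + x = y := by abel
  rw [e1] at h1; rw [e2] at h2
  linarith

/-- the seminorm on the pushout -/
theorem exists_NG (st : Stage Γ Z) {lam : ℝ} (hg : st.Good lam) (g : Z) :
    ∃ G : Seminorm ℝ ((Γ →₀ ℝ) × ℝ),
      (∀ x τ u z, (u, z) ∈ st.R → G (x, τ) ≤ st.N (x + u) + ‖τ • g - z‖) ∧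
      (∀ x τ ε, 0 < ε → ∃ u z, (u, z) ∈ st.R ∧ st.N (x + u) + ‖τ • g - z‖ < G (x, τ) + ε) ∧
      (∀ x, G (x, 0) = st.N x) ∧
      (∀ u z τ, (u, z) ∈ st.R → G (u, τ) = ‖z + τ • g‖) := by
  let V := Γ →₀ ℝ
  let f1 : ((V × ℝ) × st.R) →ₗ[ℝ] V :=
    LinearMap.fst ℝ V ℝ ∘ₗ LinearMap.fst ℝ (V × ℝ) st.R +
      LinearMap.fst ℝ V Z ∘ₗ st.R.subtype ∘ₗ LinearMap.snd ℝ (V × ℝ) st.R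
  let f2 : ((V × ℝ) × st.R) →ₗ[ℝ] Z :=
    (LinearMap.toSpanSingleton ℝ Z g) ∘ₗ LinearMap.snd ℝ V ℝ ∘ₗ LinearMap.fst ℝ (V × ℝ) st.R -
      LinearMap.snd ℝ V Z ∘ₗ st.R.subtype ∘ₗ LinearMap.snd ℝ (V × ℝ) st.R
  obtain ⟨G, h1, h2⟩ := exists_quot2 (W := (V × ℝ) × st.R) (LinearMap.fst ℝ (V × ℝ) st.R)
    LinearMap.fst_surjective st.N (normSeminorm ℝ Z) f1 f2
  have q : ∀ x τ u z (h : (u, z) ∈ st.R),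
      st.N (f1 ((x, τ), ⟨(u, z), h⟩)) + normSeminorm ℝ Z (f2 ((x, τ), ⟨(u, z), h⟩)) =
        st.N (x + u) + ‖τ • g - z‖ := by
    intro x τ u z h
    simp [f1, f2]
  have H1 : ∀ x τ u z, (u, z) ∈ st.R → G (x, τ) ≤ st.N (x + u) + ‖τ • g - z‖ := by
    intro x τ u z h
    rw [← q x τ u z h]
    exact h1 ((x, τ), ⟨(u, z), h⟩)
  have H2 : ∀ x τ ε, 0 < ε →
      ∃ u z, (u, z) ∈ st.R ∧ st.N (x + u) + ‖τ • g - z‖ < G (x, τ) + ε := by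
    intro x τ ε hε
    obtain ⟨⟨w, ⟨u, z⟩, h⟩, hw, hq⟩ := h2 (x, τ) ε hε
    simp only [LinearMap.fst_apply] at hw
    subst hw
    rw [q] at hq
    exact ⟨u, z, h, hq⟩
  refine ⟨G, H1, H2, fun x => le_antisymm ?_ ?_, fun u z τ h => le_antisymm ?_ ?_⟩
  · simpa using H1 x 0 0 0 st.R.zero_mem
  · refine le_of_forall_pos_le_add fun ε hε => ?_
    obtain ⟨u, z, h, h'⟩ := H2 x 0 ε hε
    have h3 := (hg.d u z h).2
    have h4 := map_sub_le_add st.N (x + u) u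
    rw [add_sub_cancel_right] at h4
    rw [zero_smul, zero_sub, norm_neg] at h'
    linarith
  · have := H1 u τ (-u) (-z) (st.R.neg_mem h)
    rw [add_neg_cancel, map_zero, zero_add, sub_neg_eq_add, add_comm (τ • g)] at this
    exact this
  · refine le_of_forall_pos_le_add fun ε hε => ?_
    obtain ⟨u', z', h', h''⟩ := H2 u τ ε hε
    have h3 := (hg.d (u + u') (z + z') (st.R.add_mem h h')).2
    rw [h3] at h''
    have := norm_add_le (z + z') (τ • g - z')
    have e : z + z' + (τ • g - z') = z + τ • g := by abel
    rw [e] at this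
    linarith

end StepSec


section StepSec
variable {Γ Z : Type} [NormedAddCommGroup Z] [NormedSpace ℝ Z]

instance finiteDim_supported (S : Finset Γ) :
    FiniteDimensional ℝ (Finsupp.supported ℝ ℝ (S : Set Γ)) :=
  Module.Finite.equiv (Finsupp.supportedEquivFinsupp (M := ℝ) (R := ℝ) (S : Set Γ)).symm

theorem exists_cc (st : Stage Γ Z) {lam lam' : ℝ} (hg : st.Good lam) (hl' : 1 < lam')
    (fresh : ℕ → Γ) (hinj : Function.Injective fresh)
    (hfr : ∀ j, fresh j ∉ st.S) (G : Seminorm ℝ ((Γ →₀ ℝ) × ℝ)) (hG : ∀ x, G (x, 0) = st.N x) :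
    ∃ (S' : Finset Γ) (cc : Γ → ((Γ →₀ ℝ) × ℝ) →ₗ[ℝ] ℝ), st.S ⊆ S' ∧
      (∀ γ ∈ S', γ ∉ st.S → ∃ j, γ = fresh j) ∧
      (∀ γ w, |cc γ w| ≤ G w) ∧ (∀ γ ∈ st.S, ∀ x, cc γ (x, 0) = st.C γ x) ∧
      (∀ x ∈ st.VS, ∀ τ, ∃ γ ∈ S', γ ∉ st.S ∧ G (x, τ) ≤ lam' * |cc γ (x, τ)|) := by
  classical
  have h1 : ∀ γ, ∃ c : ((Γ →₀ ℝ) × ℝ) →ₗ[ℝ] ℝ, (∀ w, |c w| ≤ G w) ∧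
      (γ ∈ st.S → ∀ x, c (x, 0) = st.C γ x) := by
    intro γ
    by_cases hγ : γ ∈ st.S
    · obtain ⟨c, h, h'⟩ := seminorm_hb_along G (LinearMap.inl ℝ (Γ →₀ ℝ) ℝ)
        LinearMap.inl_injective (st.C γ) (fun x => by
          simpa [hG] using hg.a γ hγ x)
      exact ⟨c, h', fun _ x => by simpa using h x⟩
    · exact ⟨0, fun w => by simp, fun h => absurd h hγ⟩
  choose c0 hc0 hc0' using h1
  have : FiniteDimensional ℝ (st.VS.prod (⊤ : Submodule ℝ ℝ)) :=
    Module.Finite.iff_fg.2 ((Module.Finite.iff_fg.1 (finiteDim_supported st.S)).prod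
      Module.Finite.fg_top)
  obtain ⟨k, c, hc1, hc2⟩ := exists_norming_sub (st.VS.prod (⊤ : Submodule ℝ ℝ)) G lam' hl'
  let S' := st.S ∪ (Finset.univ : Finset (Fin (k+1))).image (fun j : Fin (k+1) => fresh j)
  let cc : Γ → ((Γ →₀ ℝ) × ℝ) →ₗ[ℝ] ℝ := fun γ =>
    if γ ∈ st.S then c0 γ else if h : ∃ j : Fin (k+1), fresh j = γ then c h.choose else 0
  have hcc : ∀ j : Fin (k+1), cc (fresh j) = c j := by
    intro j
    have h : ∃ j' : Fin (k+1), fresh j' = fresh j := ⟨j, rfl⟩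
    simp only [cc, hfr, if_false, h, dif_pos]
    congr 1
    exact Fin.val_injective (hinj h.choose_spec)
  refine ⟨S', cc, Finset.subset_union_left, ?_, ?_, ?_, ?_⟩
  · intro γ h h'
    simp only [S', Finset.mem_union, h', false_or, Finset.mem_image] at h
    obtain ⟨j, -, rfl⟩ := h
    exact ⟨j, rfl⟩
  · intro γ w
    simp only [cc]
    split_ifs with h1 h2
    · exact hc0 _ _
    · exact hc1 _ _
    · simp
  · intro γ h x
    simp only [cc, h, if_true]
    exact hc0' γ h x
  · intro x hx τ
    obtain ⟨j, hj⟩ := hc2 (x, τ) ⟨hx, trivial⟩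
    refine ⟨fresh j, ?_, hfr _, ?_⟩
    · simp only [S', Finset.mem_union, Finset.mem_image]
      exact Or.inr ⟨j, Finset.mem_univ _, rfl⟩
    · rw [hcc]; exact hj
end StepSec


section StepSec
variable {Γ Z : Type} [NormedAddCommGroup Z] [NormedSpace ℝ Z]

theorem exists_step (st : Stage Γ Z) {lam lam' : ℝ} (hg : st.Good lam) (hl' : 1 < lam')
    (hll : lam' ≤ lam) (fresh : ℕ → Γ) (hinj : Function.Injective fresh)
    (hfr : ∀ j, fresh j ∉ st.S) (g : Z) :
    ∃ st' : Stage Γ Z, st'.Good lam ∧ st.Ext lam lam' g st' ∧ (∃ γ ∈ st'.S, γ ∉ st.S) ∧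
      (∀ γ ∈ st'.S, γ ∉ st.S → ∃ j, γ = fresh j) := by
  classical
  have hl0 : 0 ≤ lam := by linarith
  obtain ⟨G, G1, G2, G3, G4⟩ := exists_NG st hg g
  obtain ⟨S', cc, cS, cfr, ccG, ccC, ccN⟩ := exists_cc st hg hl' fresh hinj hfr G G3
  -- projection
  let P : (Γ →₀ ℝ) →ₗ[ℝ] (Γ →₀ ℝ) := st.VS.subtype ∘ₗ Finsupp.restrictDom ℝ ℝ (st.S : Set Γ)
  have hP : ∀ x, P x ∈ st.VS := fun x => (Finsupp.restrictDom ℝ ℝ (st.S : Set Γ) x).2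
  have hPx : ∀ x γ, γ ∈ st.S → P x γ = x γ := by
    intro x γ h
    simp [P, Finsupp.restrictDom_apply, Finsupp.filter_apply, h]
  have hmem : ∀ (x : Γ →₀ ℝ), x ∈ st.VS → ∀ γ, γ ∉ st.S → x γ = 0 := by
    intro x hx γ hγ
    by_contra h
    exact hγ ((Finsupp.mem_supported ℝ x).1 hx (by simpa using h))
  have hPid : ∀ x ∈ st.VS, P x = x := by
    intro x hx
    ext γ
    by_cases h : γ ∈ st.S
    · exact hPx x γ h
    · rw [hmem _ (hP x) γ h, hmem _ hx γ h]
  have hNP : ∀ x, st.N (P x) = st.N x := fun x => hg.N_congr hl0 _ _ (fun γ h => hPx x γ h)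
  let C' : Γ → (Γ →₀ ℝ) →ₗ[ℝ] ℝ := fun γ =>
    cc γ ∘ₗ LinearMap.inl ℝ (Γ →₀ ℝ) ℝ ∘ₗ P + if γ ∈ st.S then 0 else Finsupp.lapply γ
  have C'old : ∀ γ ∈ st.S, C' γ = st.C γ := by
    intro γ h
    ext1 x
    simp only [C', h, if_true, add_zero, LinearMap.comp_apply, LinearMap.inl_apply]
    ext
    simp only [LinearMap.comp_apply, LinearMap.inl_apply]
    rw [ccC γ h]
    exact hg.c' γ h _ _ (fun δ hδ => hPx _ δ hδ)
  have C'new : ∀ γ, γ ∉ st.S → ∀ x, C' γ x = cc γ (P x, 0) + x γ := by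
    intro γ h x
    simp [C', h]
  have C'VS : ∀ γ, ∀ x ∈ st.VS, C' γ x = cc γ (x, 0) := by
    intro γ x hx
    by_cases h : γ ∈ st.S
    · rw [C'old γ h, ccC γ h]
    · rw [C'new γ h, hPid x hx, hmem x hx γ h, add_zero]
  have VSle : st.VS ≤ Finsupp.supported ℝ ℝ (S' : Set Γ) :=
    Finsupp.supported_mono (by exact_mod_cast cS)
  have hc : ∀ c : Γ → ℝ, ∃ v ∈ Finsupp.supported ℝ ℝ (S' : Set Γ), ∀ γ ∈ S', C' γ v = c γ := by
    intro c
    obtain ⟨v, hv, hv'⟩ := hg.c c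
    let w : Γ →₀ ℝ := ∑ δ ∈ S' \ st.S, Finsupp.single δ (c δ - cc δ (v, 0))
    have hw0 : ∀ γ ∈ st.S, w γ = 0 := by
      intro γ h
      simp only [w, Finsupp.finsetSum_apply]
      apply Finset.sum_eq_zero
      intro δ hδ
      rw [Finsupp.single_apply, if_neg]
      rintro rfl
      exact (Finset.mem_sdiff.1 hδ).2 h
    have hw1 : ∀ γ ∈ S', γ ∉ st.S → w γ = c γ - cc γ (v, 0) := by
      intro γ h h'
      simp only [w, Finsupp.finsetSum_apply]
      rw [Finset.sum_eq_single γ]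
      · simp
      · intro δ _ hne; rw [Finsupp.single_apply, if_neg hne]
      · intro hn; exact absurd (Finset.mem_sdiff.2 ⟨h, h'⟩) hn
    have hPw : P w = 0 := by
      ext γ
      by_cases h : γ ∈ st.S
      · rw [hPx w γ h, hw0 γ h]; rfl
      · rw [hmem _ (hP w) γ h]; rfl
    refine ⟨v + w, Submodule.add_mem _ (VSle hv) ?_, fun γ hγ => ?_⟩
    · refine Submodule.sum_mem _ fun δ hδ => Finsupp.single_mem_supported ℝ _ ?_
      exact_mod_cast (Finset.mem_sdiff.1 hδ).1
    · by_cases h : γ ∈ st.S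
      · have : C' γ w = 0 := by
          rw [C'old γ h, hg.c' γ h w 0 (fun δ hδ => by rw [hw0 δ hδ]; rfl), map_zero]
        rw [map_add, this, add_zero, C'old γ h, hv' γ h]
      · rw [map_add, C'VS γ v hv, C'new γ h, hPw, hw1 γ hγ h]
        have : cc γ ((0 : Γ →₀ ℝ), (0:ℝ)) = 0 := map_zero _
        rw [this]; ring
  obtain ⟨b, hbS, hb⟩ := hc (fun γ => cc γ (0, 1))
  have hCb : ∀ γ ∈ S', ∀ x ∈ st.VS, ∀ τ : ℝ, C' γ (x + τ • b) = cc γ (x, τ) := by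
    intro γ hγ x hx τ
    rw [map_add, map_smul, hb γ hγ, C'VS γ x hx, ← map_smul, ← map_add]
    simp
  let A : Seminorm ℝ (Γ →₀ ℝ) := S'.sup fun γ => (normSeminorm ℝ ℝ).comp (C' γ)
  have leA : ∀ γ ∈ S', ∀ x, |C' γ x| ≤ A x := by
    intro γ hγ x
    have := Seminorm.le_finset_sup_apply (p := fun γ => (normSeminorm ℝ ℝ).comp (C' γ))
      (s := S') (x := x) hγ
    simpa [A] using this
  have A0 : ∀ x, 0 ≤ A x := fun x => apply_nonneg A x
  have GA : ∀ x ∈ st.VS, ∀ τ : ℝ, G (x, τ) ≤ lam' * A (x + τ • b) := by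
    intro x hx τ
    obtain ⟨γ, h1, h2, h3⟩ := ccN x hx τ
    refine h3.trans ?_
    rw [← hCb γ h1 x hx τ]
    have := leA γ h1 (x + τ • b)
    gcongr
  let R' : Submodule ℝ ((Γ →₀ ℝ) × Z) := st.R ⊔ Submodule.span ℝ {(b, g)}
  have hR' : ∀ u z, (u, z) ∈ R' → ∃ u0 z0, ∃ τ : ℝ, (u0, z0) ∈ st.R ∧ u = u0 + τ • b ∧
      z = z0 + τ • g := by
    intro u z h
    obtain ⟨⟨u0, z0⟩, h0, w, hw, e⟩ := Submodule.mem_sup.1 h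
    obtain ⟨τ, rfl⟩ := Submodule.mem_span_singleton.1 hw
    simp only [Prod.smul_mk, Prod.mk_add_mk, Prod.mk.injEq] at e
    exact ⟨u0, z0, τ, h0, e.1.symm, e.2.symm⟩
  have hRR' : ∀ u0 z0 (τ : ℝ), (u0, z0) ∈ st.R → (u0 + τ • b, z0 + τ • g) ∈ R' := by
    intro u0 z0 τ h
    refine Submodule.mem_sup.2 ⟨(u0, z0), h, τ • (b, g), Submodule.smul_mem _ _
      (Submodule.mem_span_singleton_self _), ?_⟩
    simp
  have hRVS : ∀ u z, (u, z) ∈ st.R → u ∈ st.VS := fun u z h => (hg.d u z h).1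
  -- the new norm
  have hN' : ∃ N' : Seminorm ℝ (Γ →₀ ℝ),
      (∀ p x u z, x ∈ st.VS → (u, z) ∈ R' → N' (p + x + u) ≤ lam * A p + st.N x + ‖z‖) ∧
      (∀ y ε, 0 < ε → ∃ p x u z, x ∈ st.VS ∧ (u, z) ∈ R' ∧ y = p + x + u ∧
        lam * A p + st.N x + ‖z‖ < N' y + ε) := by
    obtain ⟨Q, h1, h2⟩ := exists_quot3 (W := (Γ →₀ ℝ) × st.VS × R') (V := Γ →₀ ℝ)
      (LinearMap.fst ℝ (Γ →₀ ℝ) (st.VS × R') +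
        (st.VS.subtype ∘ₗ LinearMap.fst ℝ st.VS R' ∘ₗ LinearMap.snd ℝ (Γ →₀ ℝ) (st.VS × R')) +
        (LinearMap.fst ℝ (Γ →₀ ℝ) Z ∘ₗ R'.subtype ∘ₗ LinearMap.snd ℝ st.VS R' ∘ₗ
          LinearMap.snd ℝ (Γ →₀ ℝ) (st.VS × R')))
      (fun v => ⟨(v, 0, 0), by simp⟩) (Real.toNNReal lam • A) st.N (normSeminorm ℝ Z)
      (LinearMap.fst ℝ (Γ →₀ ℝ) (st.VS × R'))
      (st.VS.subtype ∘ₗ LinearMap.fst ℝ st.VS R' ∘ₗ LinearMap.snd ℝ (Γ →₀ ℝ) (st.VS × R'))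
      (LinearMap.snd ℝ (Γ →₀ ℝ) Z ∘ₗ R'.subtype ∘ₗ LinearMap.snd ℝ st.VS R' ∘ₗ
          LinearMap.snd ℝ (Γ →₀ ℝ) (st.VS × R'))
    have hs : ∀ x, (Real.toNNReal lam • A) x = lam * A x := by
      intro x
      rw [Seminorm.smul_apply, NNReal.smul_def, Real.coe_toNNReal _ hl0]; rfl
    refine ⟨Q, ?_, ?_⟩
    · intro p x u z hx hu
      have := h1 (p, ⟨x, hx⟩, ⟨(u, z), hu⟩)
      rw [hs] at this
      simpa using this
    · intro y ε hε
      obtain ⟨⟨p, ⟨x, hx⟩, ⟨⟨u, z⟩, hu⟩⟩, e, h⟩ := h2 y ε hε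
      rw [hs] at h
      refine ⟨p, x, u, z, hx, hu, ?_, ?_⟩
      · simpa using e.symm
      · simpa using h
  obtain ⟨N', N1, N2⟩ := hN'
  have Nkey : ∀ x ∈ st.VS, ∀ τ : ℝ, N' (x + τ • b) = G (x, τ) := by
    intro x hx τ
    apply le_antisymm
    · refine le_of_forall_pos_le_add fun ε hε => ?_
      obtain ⟨u, z, h, h'⟩ := G2 x τ ε hε
      have h1 := N1 0 (x + u) (-u + τ • b) (-z + τ • g) (Submodule.add_mem _ hx (hRVS u z h))
        (hRR' _ _ _ (st.R.neg_mem h))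
      have e : 0 + (x + u) + (-u + τ • b) = x + τ • b := by abel
      rw [e, map_zero, mul_zero, zero_add, neg_add_eq_sub] at h1
      linarith
    · refine le_of_forall_pos_le_add fun ε hε => ?_
      obtain ⟨p, x1, u1, z1, hx1, hu1, e, h⟩ := N2 (x + τ • b) ε hε
      obtain ⟨u, z, σ, hu, rfl, rfl⟩ := hR' u1 z1 hu1
      have hp : p = (x - x1 - u) + (τ - σ) • b := by
        rw [sub_smul]
        have : p = (x + τ • b) - x1 - (u + σ • b) := by rw [e]; abel
        rw [this]; abel
      have h1 := GA (x - x1 - u) (Submodule.sub_mem _ (Submodule.sub_mem _ hx hx1)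
        (hRVS u z hu)) (τ - σ)
      rw [← hp] at h1
      have h2 : lam' * A p ≤ lam * A p := by have := A0 p; gcongr
      have h3 := G4 u z σ hu
      have h4 := G3 x1
      have h5 := map_add_le_add G (x - x1 - u, τ - σ) (x1, 0)
      have h6 := map_add_le_add G ((x - x1 - u, τ - σ) + (x1, 0)) (u, σ)
      have e2 : ((x - x1 - u, τ - σ) + (x1, (0:ℝ)) + (u, σ) : (Γ →₀ ℝ) × ℝ) = (x, τ) := by
        simp only [Prod.mk_add_mk, Prod.mk.injEq]
        exact ⟨by abel, by ring⟩
      rw [e2] at h6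
      linarith
  have Na : ∀ γ ∈ S', ∀ x, |C' γ x| ≤ N' x := by
    intro γ hγ y
    refine le_of_forall_pos_le_add fun ε hε => ?_
    obtain ⟨p, x1, u1, z1, hx1, hu1, rfl, h⟩ := N2 y ε hε
    obtain ⟨u, z, σ, hu, rfl, rfl⟩ := hR' u1 z1 hu1
    have h1 := leA γ hγ p
    have h2 : A p ≤ lam * A p := by nlinarith [A0 p]
    have h3 := ccG γ (x1, 0)
    rw [← C'VS γ x1 hx1, G3] at h3
    have h4 := ccG γ (u, σ)
    rw [← hCb γ hγ u (hRVS u z hu), G4 u z σ hu] at h4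
    rw [map_add, map_add]
    have h5 := abs_add_le (C' γ p + C' γ x1) (C' γ (u + σ • b))
    have h6 := abs_add_le (C' γ p) (C' γ x1)
    linarith
  have Nb : ∀ x, N' x ≤ lam * A x := by
    intro x
    have := N1 x 0 0 0 (Submodule.zero_mem _) (Submodule.zero_mem _)
    simpa using this
  have NleN : ∀ x, st.N x ≤ lam * N' x := by
    intro x
    apply hg.N_le hl0 x (apply_nonneg _ _)
    intro γ h
    rw [← C'old γ h]
    exact Na γ (cS h) x
  have Knew : ∀ γ ∈ S', γ ∉ st.S → ∀ x : Γ →₀ ℝ, |x γ| ≤ (1 + lam) * N' x := by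
    intro γ hγ h x
    have h1 := Na γ hγ x
    have h2 := ccG γ (P x, 0)
    rw [G3, hNP] at h2
    have h3 := NleN x
    have h4 := C'new γ h x
    have h5 := abs_sub (C' γ x) (cc γ (P x, 0))
    have e : C' γ x - cc γ (P x, 0) = x γ := by rw [h4]; ring
    rw [e] at h5
    linarith
  let st' : Stage Γ Z := ⟨S', N', C', R'⟩
  have hA' : st'.A = A := rfl
  refine ⟨st', ?_, ?_, ?_, cfr⟩
  · refine ⟨Na, Nb, hc, ?_, ?_, ?_, ?_⟩
    · intro γ hγ x y hxy
      by_cases h : γ ∈ st.S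
      · change C' γ x = C' γ y
        rw [C'old γ h]
        exact hg.c' γ h x y (fun δ hδ => hxy δ (cS hδ))
      · change C' γ x = C' γ y
        rw [C'new γ h, C'new γ h, hxy γ hγ]
        have : P x = P y := by
          ext δ
          by_cases h' : δ ∈ st.S
          · rw [hPx _ _ h', hPx _ _ h', hxy δ (cS h')]
          · rw [hmem _ (hP x) δ h', hmem _ (hP y) δ h']
        rw [this]
    · intro u z h
      obtain ⟨u0, z0, τ, h0, rfl, rfl⟩ := hR' u z h
      exact ⟨Submodule.add_mem _ (VSle (hRVS _ _ h0)) (Submodule.smul_mem _ _ hbS), by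
        change N' _ = _
        rw [Nkey u0 (hRVS _ _ h0), G4 u0 z0 τ h0]⟩
    · intro γ hγ
      by_cases h : γ ∈ st.S
      · obtain ⟨K, hK, hK'⟩ := hg.K γ h
        refine ⟨K * lam, by positivity, fun x => (hK' x).trans ?_⟩
        rw [mul_assoc]
        exact mul_le_mul_of_nonneg_left (NleN x) hK
      · exact ⟨1 + lam, by linarith, Knew γ hγ h⟩
    · have := hg.fd
      change FiniteDimensional ℝ (st.R ⊔ Submodule.span ℝ {(b, g)} : Submodule ℝ _)
      infer_instance
  · refine ⟨cS, ?_, C'old, le_sup_left, ⟨b, ?_⟩, ?_, Knew, ?_, ?_, ?_, ?_⟩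
    · intro x hx
      have := Nkey x hx 0
      rw [zero_smul, add_zero, G3] at this
      exact this
    · simpa using hRR' 0 0 1 st.R.zero_mem
    · rintro ⟨u, z⟩ h
      obtain ⟨u0, z0, τ, h0, -, rfl⟩ := hR' u z h
      exact ⟨(u0, z0), h0, τ, rfl⟩
    · intro y ε hε
      obtain ⟨p, x, u, z, hx, hu, e, h⟩ := N2 y ε hε
      exact ⟨p, x, u, z, hx, hu, e, h.le⟩
    · intro x u z hx h
      obtain ⟨u0, z0, τ, h0, rfl, rfl⟩ := hR' u z h
      rw [← add_assoc, hA']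
      have hxu : x + u0 ∈ st.VS := Submodule.add_mem _ hx (hRVS _ _ h0)
      change N' _ ≤ _
      rw [Nkey _ hxu]
      exact GA _ hxu τ
    · intro x u z ε hx h hε
      obtain ⟨u0, z0, τ, h0, rfl, rfl⟩ := hR' u z h
      have hxu : x + u0 ∈ st.VS := Submodule.add_mem _ hx (hRVS _ _ h0)
      obtain ⟨u', z', h', h''⟩ := G2 (x + u0) τ ε hε
      refine ⟨x + u0 + u', -u' + τ • b, -z' + τ • g, Submodule.add_mem _ hxu (hRVS _ _ h'),
        hRR' _ _ _ (st.R.neg_mem h'), by abel, ?_⟩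
      change _ ≤ N' _ + ε
      rw [← add_assoc, Nkey _ hxu]
      linarith [norm_nonneg (τ • g - z')]
    · intro u z hu h
      obtain ⟨u0, z0, τ, h0, rfl, rfl⟩ := hR' u z h
      by_cases hτ : τ = 0
      · simpa [hτ] using h0
      have hbV : b ∈ st.VS := by
        have h1 : τ • b ∈ st.VS := by
          have := Submodule.sub_mem _ hu (hRVS _ _ h0)
          rwa [add_sub_cancel_left] at this
        exact (Submodule.smul_mem_iff _ hτ).1 h1
      have hG0 : G (-b, 1) = 0 := by
        rw [← Nkey (-b) (Submodule.neg_mem _ hbV), one_smul, neg_add_cancel, map_zero]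
      -- g is in the closure of the second projection
      have hfd := hg.fd
      have hclosed : IsClosed ((st.R.map (LinearMap.snd ℝ (Γ →₀ ℝ) Z) : Submodule ℝ Z) : Set Z) :=
        Submodule.closed_of_finiteDimensional _
      have hgm : g ∈ st.R.map (LinearMap.snd ℝ (Γ →₀ ℝ) Z) := by
        rw [← SetLike.mem_coe, ← hclosed.closure_eq, Metric.mem_closure_iff]
        intro ε hε
        obtain ⟨u', z', h', h''⟩ := G2 (-b) 1 ε hε
        refine ⟨z', ⟨(u', z'), h', rfl⟩, ?_⟩
        rw [hG0, one_smul] at h''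
        rw [dist_eq_norm]
        have := apply_nonneg st.N (-b + u')
        linarith
      obtain ⟨⟨ub, _⟩, hub, rfl⟩ := hgm
      simp only [LinearMap.snd_apply] at *
      rename_i g'
      have hN0 : st.N (-b + ub) = 0 := by
        refine le_antisymm (le_of_forall_pos_le_add fun ε hε => ?_) (apply_nonneg _ _)
        obtain ⟨u', z', h', h''⟩ := G2 (-b) 1 ε hε
        rw [hG0, one_smul] at h''
        have h3 := (hg.d _ _ (st.R.sub_mem hub h')).2
        have h4 := map_add_le_add st.N (-b + u') (ub - u')
        have e : -b + u' + (ub - u') = -b + ub := by abel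
        rw [e, h3] at h4
        linarith
      have hbu : b = ub := by
        ext γ
        by_cases h' : γ ∈ st.S
        · obtain ⟨K, -, hK⟩ := hg.K γ h'
          have := hK (-b + ub)
          rw [hN0, mul_zero] at this
          have := abs_nonpos_iff.1 this
          simp only [Finsupp.add_apply, Finsupp.neg_apply] at this
          linarith
        · rw [hmem _ hbV γ h', hmem _ (hRVS _ _ hub) γ h']
      rw [hbu]
      have := st.R.add_mem h0 (st.R.smul_mem τ hub)
      simpa using this
  · obtain ⟨γ, h1, h2, -⟩ := ccN 0 (Submodule.zero_mem _) 0
    exact ⟨γ, h1, h2⟩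
end StepSec


structure TreeSys (Λ Z : Type) [NormedAddCommGroup Z] [NormedSpace ℝ Z] (lam lam' : ℝ)
    (g : Λ → Z) where
  st : List Λ → Stage (List Λ × ℕ) Z
  good : ∀ s, (st s).Good lam
  ext : ∀ s a, (st s).Ext lam lam' (g a) (st (a :: s))
  nil_S : (st []).S = ∅
  nil_R : (st []).R = ⊥
  grow : ∀ s a, ∃ γ ∈ (st (a :: s)).S, γ ∉ (st s).S
  new : ∀ s a γ, γ ∈ (st (a :: s)).S → γ ∉ (st s).S → γ.1 = a :: s

theorem exists_treeSys (Λ Z : Type) [NormedAddCommGroup Z] [NormedSpace ℝ Z] (lam lam' : ℝ)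
    (hl' : 1 < lam') (hll : lam' ≤ lam) (g : Λ → Z) : Nonempty (TreeSys Λ Z lam lam' g) := by
  have hstep : ∀ (s : List Λ) (st : Stage (List Λ × ℕ) Z) (a : Λ),
      ∃ st' : Stage (List Λ × ℕ) Z, (st.Good lam ∧ ∀ γ ∈ st.S, γ.1 <:+ s) →
        (st'.Good lam ∧ ∀ γ ∈ st'.S, γ.1 <:+ (a :: s)) ∧ st.Ext lam lam' (g a) st' ∧
        (∃ γ ∈ st'.S, γ ∉ st.S) ∧ (∀ γ ∈ st'.S, γ ∉ st.S → γ.1 = a :: s) := by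
    intro s st a
    by_cases h : st.Good lam ∧ ∀ γ ∈ st.S, γ.1 <:+ s
    · obtain ⟨st', h1, h2, h3, h4⟩ := exists_step st h.1 hl' hll (fun j => (a :: s, j))
        (fun i j hij => by simpa using hij) (fun j hj => by
          have := (h.2 _ hj).length_le
          simp at this) (g a)
      refine ⟨st', fun _ => ⟨⟨h1, fun γ hγ => ?_⟩, h2, h3, fun γ hγ hγ' => ?_⟩⟩
      · by_cases hγ' : γ ∈ st.S
        · exact (h.2 γ hγ').trans (List.suffix_cons a s)
        · obtain ⟨j, rfl⟩ := h4 γ hγ hγ'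
          exact List.suffix_rfl
      · obtain ⟨j, rfl⟩ := h4 γ hγ hγ'
        rfl
    · exact ⟨st, fun h' => absurd h' h⟩
  choose nxt hnxt using hstep
  let st : List Λ → Stage (List Λ × ℕ) Z := fun s =>
    List.rec ⟨∅, 0, fun _ => 0, ⊥⟩ (fun a s st => nxt s st a) s
  have hst : ∀ s a, st (a :: s) = nxt s (st s) a := fun _ _ => rfl
  have inv : ∀ s, (st s).Good lam ∧ ∀ γ ∈ (st s).S, γ.1 <:+ s := by
    intro s
    induction s with
    | nil =>
      refine ⟨⟨?_, ?_, ?_, ?_, ?_, ?_, ?_⟩, ?_⟩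
      · intro γ h; simp [st] at h
      · intro x; simp [st, Stage.A]
      · intro c; exact ⟨0, Submodule.zero_mem _, fun γ h => by simp [st] at h⟩
      · intro γ h; simp [st] at h
      · intro u z h
        have h' : (u, z) ∈ (⊥ : Submodule ℝ ((List Λ × ℕ →₀ ℝ) × Z)) := h
        rw [Submodule.mem_bot] at h'
        obtain ⟨rfl, rfl⟩ := Prod.mk.injEq _ _ _ _ ▸ h'
        exact ⟨Submodule.zero_mem _, by simp⟩
      · intro γ h; simp [st] at h
      · change FiniteDimensional ℝ (⊥ : Submodule ℝ ((List Λ × ℕ →₀ ℝ) × Z))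
        infer_instance
      · intro γ h; simp [st] at h
    | cons a s ih =>
      rw [hst]
      exact (hnxt s (st s) a ih).1
  exact ⟨⟨st, fun s => (inv s).1, fun s a => by rw [hst]; exact (hnxt s (st s) a (inv s)).2.1,
    rfl, rfl, fun s a => by rw [hst]; exact (hnxt s (st s) a (inv s)).2.2.1,
    fun s a γ h h' => by rw [hst] at h; exact (hnxt s (st s) a (inv s)).2.2.2 γ h h'⟩⟩

structure SeqSys (Γ Z : Type) [NormedAddCommGroup Z] [NormedSpace ℝ Z] (lam lam' : ℝ)
    (g : ℕ → Z) where
  st : ℕ → Stage Γ Z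
  good : ∀ n, (st n).Good lam
  ext : ∀ n, (st n).Ext lam lam' (g n) (st (n+1))
  zero_R : (st 0).R = ⊥
  grow : ∀ n, ∃ γ ∈ (st (n+1)).S, γ ∉ (st n).S

def pre {Λ : Type} (σ : ℕ → Λ) : ℕ → List Λ
  | 0 => []
  | n+1 => σ n :: pre σ n

def TreeSys.branch {Λ Z : Type} [NormedAddCommGroup Z] [NormedSpace ℝ Z] {lam lam' : ℝ}
    {g : Λ → Z} (T : TreeSys Λ Z lam lam' g) (σ : ℕ → Λ) :
    SeqSys (List Λ × ℕ) Z lam lam' (fun n => g (σ n)) where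
  st n := T.st (pre σ n)
  good n := T.good _
  ext n := T.ext _ _
  zero_R := T.nil_R
  grow n := T.grow _ _

namespace TreeSys
variable {Λ Z : Type} [NormedAddCommGroup Z] [NormedSpace ℝ Z] {lam lam' : ℝ}
    {g : Λ → Z} (T : TreeSys Λ Z lam lam' g)

theorem S_mono {r s : List Λ} (h : r <:+ s) : (T.st r).S ⊆ (T.st s).S := by
  induction s with
  | nil => rw [List.suffix_nil.1 h]
  | cons a s ih =>
    rcases List.suffix_cons_iff.1 h with rfl | h
    · exact Finset.Subset.refl _
    · exact (ih h).trans (T.ext s a).sub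

theorem VS_mono {r s : List Λ} (h : r <:+ s) : (T.st r).VS ≤ (T.st s).VS :=
  Finsupp.supported_mono (by exact_mod_cast T.S_mono h)

theorem N_eq {r s : List Λ} (h : r <:+ s) : ∀ x ∈ (T.st r).VS, (T.st s).N x = (T.st r).N x := by
  induction s with
  | nil => rw [List.suffix_nil.1 h]; exact fun _ _ => rfl
  | cons a s ih =>
    rcases List.suffix_cons_iff.1 h with rfl | h
    · exact fun _ _ => rfl
    · intro x hx
      rw [(T.ext s a).N_eq x (T.VS_mono h hx), ih h x hx]

theorem C_eq {r s : List Λ} (h : r <:+ s) : ∀ γ ∈ (T.st r).S, (T.st s).C γ = (T.st r).C γ := by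
  induction s with
  | nil => rw [List.suffix_nil.1 h]; exact fun _ _ => rfl
  | cons a s ih =>
    rcases List.suffix_cons_iff.1 h with rfl | h
    · exact fun _ _ => rfl
    · intro γ hγ
      rw [(T.ext s a).C_eq γ (T.S_mono h hγ), ih h γ hγ]

theorem N_le {r s : List Λ} (hl : 0 ≤ lam) (h : r <:+ s) (x) :
    (T.st r).N x ≤ lam * (T.st s).N x := by
  apply (T.good r).N_le hl x (apply_nonneg _ _)
  intro γ hγ
  rw [← T.C_eq h γ hγ]
  exact (T.good s).a γ (T.S_mono h hγ) x

theorem lab {s : List Λ} {γ} (h : γ ∈ (T.st s).S) : γ.1 <:+ s ∧ γ ∈ (T.st γ.1).S := by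
  induction s with
  | nil => rw [T.nil_S] at h; simp at h
  | cons a s ih =>
    by_cases h' : γ ∈ (T.st s).S
    · exact ⟨(ih h').1.trans (List.suffix_cons a s), (ih h').2⟩
    · have := T.new s a γ h h'
      exact ⟨by rw [this], by rwa [this]⟩

theorem mem_S {s : List Λ} {γ} : γ ∈ (T.st s).S ↔ γ.1 <:+ s ∧ γ ∈ (T.st γ.1).S :=
  ⟨T.lab, fun h => T.S_mono h.1 h.2⟩

theorem K_bound (hl : 1 ≤ lam) {s : List Λ} {γ} (h : γ ∈ (T.st s).S) (x : List Λ × ℕ →₀ ℝ) :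
    |x γ| ≤ (1 + lam) * lam * (T.st s).N x := by
  induction s with
  | nil => rw [T.nil_S] at h; simp at h
  | cons a s _ =>
    have ⟨h1, h2⟩ := T.lab h
    obtain ⟨r, n⟩ := γ
    cases r with
    | nil => rw [T.nil_S] at h2; simp at h2
    | cons b r =>
      have h3 : ((b :: r, n) : List Λ × ℕ) ∉ (T.st r).S := fun h' => by
        have := (T.lab h').1.length_le
        simp at this
      have h4 := (T.ext r b).K _ h2 h3 x
      have h5 := T.N_le (by linarith) h1 x
      simp only at h5
      rw [mul_assoc]
      refine h4.trans ?_
      gcongr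

end TreeSys


theorem isom_closure {D E F : Type*} [AddCommGroup D] [Module ℝ D] [NormedAddCommGroup E]
    [NormedSpace ℝ E] [NormedAddCommGroup F] [NormedSpace ℝ F] [CompleteSpace F]
    (i : D →ₗ[ℝ] E) (j : D →ₗ[ℝ] F) (h : ∀ d, ‖i d‖ = ‖j d‖) :
    ∃ T : (LinearMap.range i).topologicalClosure →L[ℝ] (LinearMap.range j).topologicalClosure,
      ∀ x, ‖T x‖ = ‖x‖ := by
  let e : D →ₗ[ℝ] (LinearMap.range i).topologicalClosure :=
    i.codRestrict _ (fun d => Submodule.le_topologicalClosure _ ⟨d, rfl⟩)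
  let f : D →ₗ[ℝ] (LinearMap.range j).topologicalClosure :=
    j.codRestrict _ (fun d => Submodule.le_topologicalClosure _ ⟨d, rfl⟩)
  have he : DenseRange e := by
    intro x
    rw [closure_subtype]
    have hx : (x : E) ∈ closure ((LinearMap.range i : Submodule ℝ E) : Set E) := x.2
    convert hx using 2
    ext y
    constructor
    · rintro ⟨_, ⟨d, rfl⟩, rfl⟩; exact ⟨d, rfl⟩
    · rintro ⟨d, rfl⟩; exact ⟨_, ⟨d, rfl⟩, rfl⟩
  have : CompleteSpace (LinearMap.range j).topologicalClosure :=
    (Submodule.isClosed_topologicalClosure _).completeSpace_coe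
  have hn : ∀ d, ‖f d‖ ≤ 1 * ‖e d‖ := fun d => by
    rw [one_mul]; exact (h d).symm.le
  refine ⟨f.extendOfNorm e, fun x => ?_⟩
  refine he.induction_on x (isClosed_eq (by fun_prop) (by fun_prop)) fun d => ?_
  rw [LinearMap.extendOfNorm_eq he ⟨1, hn⟩]
  exact (h d).symm

theorem embeds_closure {D E F : Type*} [AddCommGroup D] [Module ℝ D] [NormedAddCommGroup E]
    [NormedSpace ℝ E] [NormedAddCommGroup F] [NormedSpace ℝ F] [CompleteSpace F]
    (i : D →ₗ[ℝ] E) (j : D →ₗ[ℝ] F) (h : ∀ d, ‖i d‖ = ‖j d‖) :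
    Embeds (LinearMap.range i).topologicalClosure (LinearMap.range j).topologicalClosure := by
  obtain ⟨T, hT⟩ := isom_closure i j h
  exact ⟨T, 1, one_pos, fun x => by rw [hT, one_mul]⟩

theorem embeds_sub {E : Type*} [NormedAddCommGroup E] [NormedSpace ℝ E] (Y : Submodule ℝ E) :
    Embeds Y E := ⟨Y.subtypeL, 1, one_pos, fun x => by simp⟩

theorem embeds_of_le {E : Type*} [NormedAddCommGroup E] [NormedSpace ℝ E] {Y W : Submodule ℝ E}
    (h : Y ≤ W) : Embeds Y W :=
  ⟨Y.subtypeL.codRestrict W (fun x => h x.2), 1, one_pos, fun x => by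
    rw [one_mul]; exact le_rfl⟩

namespace SeqSys
variable {Γ Z : Type} [NormedAddCommGroup Z] [NormedSpace ℝ Z] {lam lam' : ℝ}
    {g : ℕ → Z} (T : SeqSys Γ Z lam lam' g)

theorem S_mono : Monotone fun n => (T.st n).S := monotone_nat_of_le_succ fun n => (T.ext n).sub

theorem VS_mono {m n : ℕ} (h : m ≤ n) : (T.st m).VS ≤ (T.st n).VS :=
  Finsupp.supported_mono (by exact_mod_cast T.S_mono h)

theorem R_mono : Monotone fun n => (T.st n).R := monotone_nat_of_le_succ fun n => (T.ext n).R_le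

theorem N_eq {m n : ℕ} (h : m ≤ n) : ∀ x ∈ (T.st m).VS, (T.st n).N x = (T.st m).N x := by
  induction n, h using Nat.le_induction with
  | base => exact fun _ _ => rfl
  | succ n h ih =>
    intro x hx
    rw [(T.ext n).N_eq x (T.VS_mono h hx), ih x hx]

theorem C_eq {m n : ℕ} (h : m ≤ n) : ∀ γ ∈ (T.st m).S, (T.st n).C γ = (T.st m).C γ := by
  induction n, h using Nat.le_induction with
  | base => exact fun _ _ => rfl
  | succ n h ih =>
    intro γ hγ
    rw [(T.ext n).C_eq γ (T.S_mono h hγ), ih γ hγ]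

theorem N_le {m n : ℕ} (hl : 0 ≤ lam) (h : m ≤ n) (x) : (T.st m).N x ≤ lam * (T.st n).N x := by
  apply (T.good m).N_le hl x (apply_nonneg _ _)
  intro γ hγ
  rw [← T.C_eq h γ hγ]
  exact (T.good n).a γ (T.S_mono h hγ) x

/-- approximating by a finitely supported vector in some stage -/
theorem exists_proj (x : Γ →₀ ℝ) : ∃ n, ∃ y ∈ (T.st n).VS, ∀ m, n ≤ m →
    ∀ γ ∈ (T.st m).S, x γ = y γ := by
  classical
  have h1 : ∀ γ, ∃ n, ∀ m, γ ∈ (T.st m).S → γ ∈ (T.st n).S := by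
    intro γ
    by_cases h : ∃ n, γ ∈ (T.st n).S
    · obtain ⟨n, hn⟩ := h; exact ⟨n, fun _ _ => hn⟩
    · push Not at h; exact ⟨0, fun m hm => absurd hm (h m)⟩
  choose k hk using h1
  let n := x.support.sup k
  refine ⟨n, x.filter (· ∈ (T.st n).S), ?_, fun m hm γ hγ => ?_⟩
  · rw [Finsupp.mem_supported]
    intro γ hγ
    rw [Finsupp.support_filter] at hγ
    exact (Finset.mem_filter.1 hγ).2
  · rw [Finsupp.filter_apply]
    split_ifs with h
    · rfl
    · by_contra hne
      have hs : γ ∈ x.support := by simpa using hne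
      exact h (T.S_mono (Finset.le_sup hs) (hk γ m hγ))

theorem exists_stab (hl : 0 ≤ lam) (x : Γ →₀ ℝ) :
    ∃ n, ∀ m, n ≤ m → (T.st m).N x = (T.st n).N x := by
  obtain ⟨n, y, hy, h⟩ := T.exists_proj x
  refine ⟨n, fun m hm => ?_⟩
  rw [(T.good m).N_congr hl x y (h m hm), (T.good n).N_congr hl x y (h n le_rfl), T.N_eq hm y hy]

open Classical in
/-- the limit seminorm -/
noncomputable def NL (T : SeqSys Γ Z lam lam' g) : Seminorm ℝ (Γ →₀ ℝ) :=
  if hl : 0 ≤ lam then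
  Seminorm.of (fun x => (T.st (T.exists_stab hl x).choose).N x) (by
    intro x y
    have h1 := (T.exists_stab hl x).choose_spec
    have h2 := (T.exists_stab hl y).choose_spec
    have h3 := (T.exists_stab hl (x + y)).choose_spec
    set a := (T.exists_stab hl x).choose
    set b := (T.exists_stab hl y).choose
    set c := (T.exists_stab hl (x + y)).choose
    rw [← h1 (max a (max b c)) (by simp), ← h2 (max a (max b c)) (by simp),
      ← h3 (max a (max b c)) (by simp)]
    exact map_add_le_add _ _ _) (by
    intro r x
    have h1 := (T.exists_stab hl x).choose_spec
    have h2 := (T.exists_stab hl (r • x)).choose_spec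
    set a := (T.exists_stab hl x).choose
    set b := (T.exists_stab hl (r • x)).choose
    rw [← h1 (max a b) (by simp), ← h2 (max a b) (by simp)]
    exact map_smul_eq_mul _ _ _)
  else 0

theorem NL_spec (hl : 0 ≤ lam) (x : Γ →₀ ℝ) : ∃ n, ∀ m, n ≤ m → (T.st m).N x = T.NL x := by
  refine ⟨(T.exists_stab hl x).choose, fun m hm => ?_⟩
  rw [(T.exists_stab hl x).choose_spec m hm, NL, dif_pos hl]
  rfl

theorem NL_eq (hl : 0 ≤ lam) {n : ℕ} (x) (hx : x ∈ (T.st n).VS) : T.NL x = (T.st n).N x := by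
  obtain ⟨m, hm⟩ := T.NL_spec hl x
  rw [← hm (max m n) (le_max_left _ _), T.N_eq (le_max_right _ _) x hx]

theorem N_le_NL (hl : 0 ≤ lam) (n : ℕ) (x) : (T.st n).N x ≤ lam * T.NL x := by
  obtain ⟨m, hm⟩ := T.NL_spec hl x
  rw [← hm (max m n) (le_max_left _ _)]
  exact T.N_le hl (le_max_right _ _) x

theorem NL_proj (hl : 0 ≤ lam) (x : Γ →₀ ℝ) : ∃ n, ∃ y ∈ (T.st n).VS, T.NL (x - y) = 0 := by
  obtain ⟨n, y, hy, h⟩ := T.exists_proj x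
  obtain ⟨m, hm⟩ := T.NL_spec hl (x - y)
  refine ⟨n, y, hy, ?_⟩
  rw [← hm (max m n) (le_max_left _ _), (T.good _).N_congr hl (x - y) 0, map_zero]
  intro γ hγ
  simp [h _ (le_max_right _ _) γ hγ]

/-- union of the graphs -/
noncomputable def RL : Submodule ℝ ((Γ →₀ ℝ) × Z) := ⨆ n, (T.st n).R

theorem mem_RL {r} : r ∈ T.RL ↔ ∃ n, r ∈ (T.st n).R :=
  Submodule.mem_iSup_of_directed _ (T.R_mono.directed_le)

theorem RL_norm (hl : 0 ≤ lam) (r : T.RL) : T.NL r.1.1 = ‖r.1.2‖ := by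
  obtain ⟨n, hn⟩ := T.mem_RL.1 r.2
  have := (T.good n).d r.1.1 r.1.2 hn
  rw [T.NL_eq hl _ this.1, this.2]

noncomputable def iL : T.RL →ₗ[ℝ] Ban T.NL :=
  iota T.NL ∘ₗ LinearMap.fst ℝ (Γ →₀ ℝ) Z ∘ₗ T.RL.subtype

noncomputable def jL : T.RL →ₗ[ℝ] Z := LinearMap.snd ℝ (Γ →₀ ℝ) Z ∘ₗ T.RL.subtype

theorem ij_norm (hl : 0 ≤ lam) (r : T.RL) : ‖T.iL r‖ = ‖T.jL r‖ := by
  simp only [iL, jL, LinearMap.comp_apply, norm_iota]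
  exact T.RL_norm hl r

theorem range_jL : LinearMap.range T.jL = Submodule.span ℝ (Set.range g) := by
  apply le_antisymm
  · rintro _ ⟨⟨r, hr⟩, rfl⟩
    obtain ⟨n, hn⟩ := T.mem_RL.1 hr
    change r.2 ∈ _
    clear hr
    induction n generalizing r with
    | zero =>
      rw [T.zero_R, Submodule.mem_bot] at hn
      rw [hn]; exact Submodule.zero_mem _
    | succ n ih =>
      obtain ⟨r', hr', τ, e⟩ := (T.ext n).R_gen r hn
      rw [e]
      exact Submodule.add_mem _ (ih r' hr') (Submodule.smul_mem _ _ (Submodule.subset_span ⟨n, rfl⟩))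
  · rw [Submodule.span_le]
    rintro _ ⟨n, rfl⟩
    obtain ⟨b, hb⟩ := (T.ext n).gen
    exact ⟨⟨(b, g n), T.mem_RL.2 ⟨n+1, hb⟩⟩, rfl⟩

/-- the image of `X` in `L` -/
noncomputable abbrev X' : Submodule ℝ (Ban T.NL) := (LinearMap.range T.iL).topologicalClosure

theorem X_embeds_X' (hl : 0 ≤ lam) :
    Embeds (Submodule.span ℝ (Set.range g)).topologicalClosure T.X' := by
  have h := embeds_closure T.jL T.iL (fun d => (T.ij_norm hl d).symm)
  have h2 : (Submodule.span ℝ (Set.range g)).topologicalClosure ≤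
      (LinearMap.range T.jL).topologicalClosure := by rw [T.range_jL]
  exact Embeds.trans' (embeds_of_le h2) h

theorem X'_embeds_X [CompleteSpace Z] (hl : 0 ≤ lam) :
    Embeds T.X' (Submodule.span ℝ (Set.range g)).topologicalClosure := by
  have h := embeds_closure T.iL T.jL (fun d => (T.ij_norm hl d))
  have h2 : (LinearMap.range T.jL).topologicalClosure ≤
    (Submodule.span ℝ (Set.range g)).topologicalClosure := by rw [T.range_jL]
  exact Embeds.trans' h (embeds_of_le h2)

end SeqSys


theorem BM_of_map {ι X : Type*} [Fintype ι] [NormedAddCommGroup X] [NormedSpace ℝ X]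
    (w : (ι → ℝ) →ₗ[ℝ] X) (α β : ℝ) (hα : 0 < α) (hβ : 0 ≤ β) (h1 : ∀ a, α * ‖a‖ ≤ ‖w a‖)
    (h2 : ∀ a, ‖w a‖ ≤ β * ‖a‖) : FiniteDimensional ℝ (LinearMap.range w) ∧
    BMdistToLinftyLE (LinearMap.range w) (Module.finrank ℝ (LinearMap.range w)) (β / α) := by
  classical
  have inj : Function.Injective w := by
    rw [injective_iff_map_eq_zero]
    intro a ha
    have := h1 a
    rw [ha, norm_zero] at this
    rw [← norm_le_zero_iff]
    exact le_of_mul_le_mul_left (by simpa using this) hα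
  have fd : FiniteDimensional ℝ (LinearMap.range w) := inferInstance
  refine ⟨fd, ?_⟩
  intro θ' hθ
  have hcard : Module.finrank ℝ (LinearMap.range w) = Fintype.card ι := by
    rw [LinearMap.finrank_range_of_inj inj, Module.finrank_fintype_fun_eq_card]
  let r : Fin (Module.finrank ℝ (LinearMap.range w)) ≃ ι :=
    (finCongr hcard).trans (Fintype.equivFin ι).symm
  let e1 : (ι → ℝ) ≃ₗ[ℝ] LinearMap.range w := LinearEquiv.ofInjective w inj
  let e2 : (ι → ℝ) ≃ₗ[ℝ] (Fin (Module.finrank ℝ (LinearMap.range w)) → ℝ) :=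
    LinearEquiv.funCongrLeft ℝ ℝ r
  have he2 : ∀ a, ‖e2 a‖ = ‖a‖ := by
    intro a
    have h : ∀ i, e2 a i = a (r i) := fun i => rfl
    apply le_antisymm
    · rw [pi_norm_le_iff_of_nonneg (norm_nonneg _)]
      intro i
      rw [h]; exact norm_le_pi_norm _ _
    · rw [pi_norm_le_iff_of_nonneg (norm_nonneg _)]
      intro i
      have := norm_le_pi_norm (e2 a) (r.symm i)
      rw [h] at this
      simpa using this
  let e := (e1.symm.trans e2).toContinuousLinearEquiv
  refine ⟨e, ?_⟩
  have b1 : ‖(e : LinearMap.range w →L[ℝ] (Fin (Module.finrank ℝ (LinearMap.range w)) → ℝ))‖ ≤ α⁻¹ := by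
    apply ContinuousLinearMap.opNorm_le_bound _ (by positivity)
    intro x
    obtain ⟨a, rfl⟩ := e1.surjective x
    have : (e : LinearMap.range w →L[ℝ] (Fin (Module.finrank ℝ (LinearMap.range w)) → ℝ)) (e1 a) = e2 a := by simp [e]
    rw [this, he2]
    have h3 : ‖e1 a‖ = ‖w a‖ := rfl
    rw [h3, inv_mul_eq_div, le_div_iff₀ hα, mul_comm]
    exact h1 a
  have b2 : ‖(e.symm : (Fin (Module.finrank ℝ (LinearMap.range w)) → ℝ) →L[ℝ] LinearMap.range w)‖ ≤ β := by
    apply ContinuousLinearMap.opNorm_le_bound _ hβ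
    intro x
    obtain ⟨a, rfl⟩ := e2.surjective x
    have : (e.symm : (Fin (Module.finrank ℝ (LinearMap.range w)) → ℝ) →L[ℝ] LinearMap.range w) (e2 a) = e1 a := by simp [e]
    rw [this, he2]
    exact h2 a
  refine le_trans ?_ hθ.le
  calc _ ≤ α⁻¹ * β := by gcongr
    _ = _ := by rw [inv_mul_eq_div]

namespace SeqSys
variable {Γ Z : Type} [NormedAddCommGroup Z] [NormedSpace ℝ Z] {lam lam' : ℝ}
    {g : ℕ → Z} (T : SeqSys Γ Z lam lam' g)

theorem exists_w (hl : 1 ≤ lam) (n : ℕ) : ∃ w : ((T.st n).S → ℝ) →ₗ[ℝ] Ban T.NL,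
    (∀ a, ‖a‖ ≤ ‖w a‖) ∧ (∀ a, ‖w a‖ ≤ lam * ‖a‖) ∧
    LinearMap.range w = (T.st n).VS.map (iota T.NL) := by
  have hl0 : (0:ℝ) ≤ lam := by linarith
  let st := T.st n
  let c : st.VS →ₗ[ℝ] (st.S → ℝ) := LinearMap.pi fun γ => (st.C γ) ∘ₗ st.VS.subtype
  have b1 : ∀ v : st.VS, ‖c v‖ ≤ st.N v := by
    intro v
    rw [pi_norm_le_iff_of_nonneg (apply_nonneg _ _)]
    intro γ
    exact (T.good n).a γ γ.2 v
  have b2 : ∀ v : st.VS, st.N v ≤ lam * ‖c v‖ := by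
    intro v
    refine (T.good n).N_le hl0 v (norm_nonneg _) fun γ hγ => ?_
    exact norm_le_pi_norm (c v) ⟨γ, hγ⟩
  have bij : Function.Bijective c := by
    constructor
    · rw [injective_iff_map_eq_zero]
      intro v hv
      have h0 := b2 v
      rw [hv, norm_zero, mul_zero] at h0
      have h0' : st.N v = 0 := le_antisymm h0 (apply_nonneg _ _)
      ext γ
      by_cases hγ : γ ∈ st.S
      · obtain ⟨K, -, hK⟩ := (T.good n).K γ hγ
        have := hK v
        change _ ≤ K * st.N v at this
        rw [h0', mul_zero] at this
        simpa using abs_nonpos_iff.1 this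
      · have := (Finsupp.mem_supported' ℝ v.1).1 v.2 γ (by exact_mod_cast hγ)
        simpa using this
    · intro a
      classical
      obtain ⟨v, hv, h⟩ := (T.good n).c (fun γ => if h : γ ∈ st.S then a ⟨γ, h⟩ else 0)
      refine ⟨⟨v, hv⟩, ?_⟩
      ext γ
      have := h γ γ.2
      rw [dif_pos γ.2] at this
      exact this
  let e := LinearEquiv.ofBijective c bij
  have nrm : ∀ v : st.VS, ‖iota T.NL v‖ = st.N v := by
    intro v
    rw [norm_iota, T.NL_eq hl0 _ v.2]
  refine ⟨(iota T.NL ∘ₗ st.VS.subtype) ∘ₗ e.symm.toLinearMap, fun a => ?_, fun a => ?_, ?_⟩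
  · obtain ⟨v, rfl⟩ := e.surjective a
    have h := b1 v
    rw [← nrm] at h
    simp only [LinearMap.comp_apply, LinearEquiv.coe_coe, LinearEquiv.symm_apply_apply]
    exact h
  · obtain ⟨v, rfl⟩ := e.surjective a
    have h := b2 v
    rw [← nrm] at h
    simp only [LinearMap.comp_apply, LinearEquiv.coe_coe, LinearEquiv.symm_apply_apply]
    exact h
  · rw [LinearMap.range_comp, LinearEquiv.range, Submodule.map_top, LinearMap.range_comp,
      Submodule.range_subtype]

theorem card_S (n : ℕ) : n ≤ (T.st n).S.card := by
  induction n with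
  | zero => simp
  | succ n ih =>
    obtain ⟨γ, h1, h2⟩ := T.grow n
    have : (T.st n).S ⊂ (T.st (n+1)).S :=
      (Finset.ssubset_iff_of_subset (T.S_mono (Nat.le_succ n))).2 ⟨γ, h1, h2⟩
    have := Finset.card_lt_card this
    omega

theorem not_fd (hl : 1 ≤ lam) : ¬ FiniteDimensional ℝ (Ban T.NL) := by
  intro hfd
  obtain ⟨w, h1, -, -⟩ := T.exists_w hl (Module.finrank ℝ (Ban T.NL) + 1)
  have inj : Function.Injective w := by
    rw [injective_iff_map_eq_zero]
    intro a ha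
    have := h1 a
    rw [ha, norm_zero] at this
    exact norm_le_zero_iff.1 this
  have := LinearMap.finrank_le_finrank_of_injective inj
  rw [Module.finrank_fintype_fun_eq_card] at this
  have h2 := T.card_S (Module.finrank ℝ (Ban T.NL) + 1)
  simp at this
  omega

theorem iota_stage (hl : 0 ≤ lam) (x) : ∃ n, ∃ y ∈ (T.st n).VS, iota T.NL x = iota T.NL y := by
  obtain ⟨n, y, hy, h⟩ := T.NL_proj hl x
  refine ⟨n, y, hy, ?_⟩
  rw [← sub_eq_zero, ← map_sub, ← norm_eq_zero, norm_iota, h]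

theorem isLinfty (hl : 1 ≤ lam) : IsLinftyPlus lam (Ban T.NL) := by
  intro θ hθ
  have hl0 : (0:ℝ) ≤ lam := by linarith
  refine ⟨T.not_fd hl, fun F hF => ?_⟩
  let b := Module.finBasis ℝ F
  let y : Fin (Module.finrank ℝ F) → Ban T.NL := fun i => b i
  have hy : LinearIndependent ℝ y := b.linearIndependent.map' F.subtype (Submodule.ker_subtype F)
  set ε := (θ - lam) / (θ + lam) with hε
  have e0 : 0 < ε := div_pos (by linarith) (by linarith)
  have e1 : ε < 1 := by rw [hε, div_lt_one (by linarith)]; linarith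
  obtain ⟨A, hA, hA2⟩ := perturb_fin (Module.finrank ℝ F) y hy
    (LinearMap.range (iota T.NL)) (dense_iota _) ε e0 e1
  have : ∀ i, ∃ n, ∃ y' ∈ (T.st n).VS, A (y i) = iota T.NL y' := by
    intro i
    obtain ⟨x, hx⟩ := hA2 i
    rw [← hx]; exact T.iota_stage hl0 x
  choose n v hv hAv using this
  let M := Finset.univ.sup n
  obtain ⟨w, h1, h2, h3⟩ := T.exists_w hl M
  have l1 : ∀ x, (1 - ε) * ‖x‖ ≤ ‖A x‖ := fun x => by
    have := hA x
    have := norm_sub_norm_le x (A x)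
    rw [norm_sub_rev] at this
    linarith
  have l2 : ∀ x, ‖A x‖ ≤ (1 + ε) * ‖x‖ := fun x => by
    have := hA x
    have := norm_sub_norm_le (A x) x
    linarith
  have key := BM_of_map (A.symm.toLinearEquiv.toLinearMap ∘ₗ w) (1 / (1 + ε)) (lam / (1 - ε))
    (by positivity) (div_nonneg hl0 (by linarith)) (fun a => by
      have := l2 (A.symm (w a))
      rw [A.apply_symm_apply] at this
      have h4 := h1 a
      rw [one_div_mul_eq_div, div_le_iff₀ (by linarith)]
      change _ ≤ ‖A.symm (w a)‖ * _
      linarith) (fun a => by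
      have := l1 (A.symm (w a))
      rw [A.apply_symm_apply] at this
      have h4 := h2 a
      rw [div_mul_eq_mul_div, le_div_iff₀ (by linarith)]
      change ‖A.symm (w a)‖ * _ ≤ _
      linarith)
  refine ⟨_, ?_, key.1, ?_⟩
  · have : F = Submodule.span ℝ (Set.range y) := by
      have h5 := congrArg (Submodule.map F.subtype) b.span_eq
      rw [Submodule.map_span, Submodule.map_top, Submodule.range_subtype, ← Set.range_comp] at h5
      exact h5.symm
    rw [this, Submodule.span_le]
    rintro _ ⟨i, rfl⟩
    have h6 : A (y i) ∈ LinearMap.range w := by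
      rw [h3, hAv]
      exact ⟨v i, T.VS_mono (Finset.le_sup (Finset.mem_univ i)) (hv i), rfl⟩
    obtain ⟨a, ha⟩ := h6
    refine ⟨a, ?_⟩
    change A.symm (w a) = _
    rw [ha, A.symm_apply_apply]
  · convert key.2 using 1
    have h7 : θ + lam ≠ 0 := by linarith
    have h8 : 1 + ε = 2 * θ / (θ + lam) := by rw [hε]; field_simp; ring
    have h9 : 1 - ε = 2 * lam / (θ + lam) := by rw [hε]; field_simp; ring
    rw [h8, h9]
    have : lam ≠ 0 := by linarith
    have : θ ≠ 0 := by linarith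
    field_simp
end SeqSys


theorem seminorm_sum_le {V ι : Type*} [AddCommGroup V] [Module ℝ V] (P : Seminorm ℝ V)
    (A : Finset ι) (y : ι → V) : P (∑ i ∈ A, y i) ≤ ∑ i ∈ A, P (y i) :=
  Finset.le_sum_of_subadditive P (map_zero P).le (map_add_le_add P) A y

section dS
variable {V : Type*} [AddCommGroup V] [Module ℝ V] (P : Seminorm ℝ V) (W : Submodule ℝ V)

theorem exists_dS : ∃ Q : Seminorm ℝ V, (∀ x, ∀ w ∈ W, Q x ≤ P (x - w)) ∧
    ∀ x ε, 0 < ε → ∃ w ∈ W, P (x - w) < Q x + ε := by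
  obtain ⟨Q, h1, h2⟩ := exists_quot_seminorm (W := V × W) (LinearMap.fst ℝ V W)
    LinearMap.fst_surjective
    (P.comp (LinearMap.fst ℝ V W - W.subtype ∘ₗ LinearMap.snd ℝ V W))
  refine ⟨Q, fun x w hw => by simpa using h1 (x, ⟨w, hw⟩), fun x ε hε => ?_⟩
  obtain ⟨⟨y, w⟩, h3, h4⟩ := h2 x ε hε
  simp only [LinearMap.fst_apply] at h3
  subst h3
  exact ⟨w, w.2, by simpa using h4⟩

/-- distance to a subspace with respect to a seminorm -/
noncomputable def dS : Seminorm ℝ V := (exists_dS P W).choose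

theorem dS_le_sub (x) {w} (hw : w ∈ W) : dS P W x ≤ P (x - w) :=
  (exists_dS P W).choose_spec.1 x w hw

theorem dS_lt (x) {ε : ℝ} (hε : 0 < ε) : ∃ w ∈ W, P (x - w) < dS P W x + ε :=
  (exists_dS P W).choose_spec.2 x ε hε

theorem dS_le (x) : dS P W x ≤ P x := by simpa using dS_le_sub P W x W.zero_mem

theorem dS_zero {w} (hw : w ∈ W) : dS P W w = 0 :=
  le_antisymm (by simpa using dS_le_sub P W w hw) (apply_nonneg _ _)

theorem dS_add (x) {w} (hw : w ∈ W) : dS P W (x + w) = dS P W x := by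
  have h1 := map_add_le_add (dS P W) x w
  have h2 := map_sub_le_add (dS P W) (x + w) w
  rw [add_sub_cancel_right] at h2
  rw [dS_zero P W hw] at h1 h2
  linarith

theorem dS_anti {W' : Submodule ℝ V} (h : W ≤ W') (x) : dS P W' x ≤ dS P W x := by
  refine le_of_forall_pos_le_add fun ε hε => ?_
  obtain ⟨w, hw, h1⟩ := dS_lt P W x hε
  exact (dS_le_sub P W' x (h hw)).trans h1.le
end dS

namespace SeqSys
variable {Γ Z : Type} [NormedAddCommGroup Z] [NormedSpace ℝ Z] {lam lam' : ℝ}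
    {g : ℕ → Z} (T : SeqSys Γ Z lam lam' g)

noncomputable def FL : Submodule ℝ (Γ →₀ ℝ) := T.RL.map (LinearMap.fst ℝ _ _)

theorem mem_FL {f} : f ∈ T.FL ↔ ∃ n z, (f, z) ∈ (T.st n).R := by
  constructor
  · rintro ⟨⟨f, z⟩, h, rfl⟩
    obtain ⟨n, hn⟩ := T.mem_RL.1 h
    exact ⟨n, z, hn⟩
  · rintro ⟨n, z, h⟩
    exact ⟨(f, z), T.mem_RL.2 ⟨n, h⟩, rfl⟩

noncomputable def q : Seminorm ℝ (Γ →₀ ℝ) := dS T.NL T.FL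
noncomputable def d (n : ℕ) : Seminorm ℝ (Γ →₀ ℝ) := dS T.NL ((T.st n).VS ⊔ T.FL)

theorem key (hl' : 1 < lam') (hll : lam' ≤ lam) (n : ℕ) {M : ℕ} (hM : n ≤ M) :
    ∀ (ι : Type) [Fintype ι] (y : ι → (Γ →₀ ℝ)) (s f : Γ →₀ ℝ) (z : Z),
      (∀ i, y i ∈ (T.st M).VS) → s ∈ (T.st n).VS → (f, z) ∈ (T.st M).R →
      ∑ i, y i = s + f →
      T.q s + (lam - lam') / lam * ∑ i, T.d n (y i) ≤ ∑ i, T.NL (y i) := by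
  have hl0 : (0:ℝ) < lam := by linarith
  set c := (lam - lam') / lam with hc
  have hc0 : 0 ≤ c := div_nonneg (by linarith) hl0.le
  induction M, hM using Nat.le_induction with
  | base =>
    intro ι _ y s f z hy hs hf e
    have h1 : ∑ i, T.d n (y i) = 0 := Finset.sum_eq_zero fun i _ =>
      dS_zero _ _ (Submodule.mem_sup_left (hy i))
    rw [h1, mul_zero, add_zero]
    have h2 : T.q s ≤ T.NL (s + f) := by
      have := dS_le_sub T.NL T.FL s (w := -f) (T.FL.neg_mem (T.mem_FL.2 ⟨n, z, hf⟩))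
      rw [sub_neg_eq_add] at this
      exact this
    rw [← e] at h2
    exact h2.trans (seminorm_sum_le T.NL _ _)
  | succ M hM ih =>
    intro ι _ y s f z hy hs hf e
    have main : ∀ ε : ℝ, 0 < ε → T.q s + c * ∑ i, T.d n (y i) ≤
        ∑ i, T.NL (y i) + (Fintype.card ι + 1) * ε := by
      intro ε hε
      have X := T.ext M
      have h1 : ∀ i, ∃ p x u z, x ∈ (T.st M).VS ∧ (u, z) ∈ (T.st (M+1)).R ∧ y i = p + x + u ∧
        lam * (T.st (M+1)).A p + (T.st M).N x + ‖z‖ ≤ (T.st (M+1)).N (y i) + ε :=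
        fun i => X.i (y i) ε hε
      choose p x u zz hx hu hy' hN using h1
      have hfu : (f - ∑ i, u i, z - ∑ i, zz i) ∈ (T.st (M+1)).R := by
        have h2 : ∑ i, (u i, zz i) ∈ (T.st (M+1)).R := Submodule.sum_mem _ fun i _ => hu i
        have h3 := Submodule.sub_mem _ hf h2
        convert h3 using 1
        ext1 <;> simp [Prod.fst_sum, Prod.snd_sum]
      have hsx : s - ∑ i, x i ∈ (T.st M).VS :=
        Submodule.sub_mem _ (T.VS_mono hM hs) (Submodule.sum_mem _ fun i _ => hx i)
      have e1 : ∑ i, p i + ∑ i, x i + ∑ i, u i = s + f := by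
        rw [← e, ← Finset.sum_add_distrib, ← Finset.sum_add_distrib]
        exact Finset.sum_congr rfl fun i _ => (hy' i).symm
      have e2 : ∑ i, p i = (s - ∑ i, x i) + (f - ∑ i, u i) := by
        rw [show (s - ∑ i, x i) + (f - ∑ i, u i) = (s + f) - ∑ i, x i - ∑ i, u i by abel, ← e1]
        abel
      have h4 := X.ii _ _ _ hsx hfu
      obtain ⟨x', u', z', hx', hu', e3, h5⟩ := X.iii _ _ _ ε hsx hfu hε
      rw [← e2] at h4 h5 e3
      have e4 : ∑ i, x i + x' = s + (f - ∑ i, u i - u') := by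
        have : x' = ∑ i, p i - u' := by rw [e3]; abel
        rw [this, e2]; abel
      have h6 : (f - ∑ i, u i - u', z - ∑ i, zz i - z') ∈ (T.st M).R := by
        apply X.v
        · rw [show f - ∑ i, u i - u' = ∑ i, x i + x' - s by rw [e4]; abel]
          exact Submodule.sub_mem _ (Submodule.add_mem _ (Submodule.sum_mem _ fun i _ => hx i) hx')
            (T.VS_mono hM hs)
        · exact Submodule.sub_mem _ hfu hu'
      have h7 := ih (Option ι) (fun o => o.elim x' x) s _ _ (by
        rintro (_ | i); exacts [hx', hx i]) hs h6 (by
        rw [Fintype.sum_option, ← e4, add_comm]; rfl)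
      simp only [Fintype.sum_option, Option.elim] at h7
      have h8 : (T.st (M+1)).A (∑ i, p i) ≤ ∑ i, (T.st (M+1)).A (p i) := seminorm_sum_le _ _ _
      have hp : ∀ i, p i ∈ (T.st (M+1)).VS := by
        intro i
        have : p i = y i - x i - u i := by rw [hy' i]; abel
        rw [this]
        exact Submodule.sub_mem _ (Submodule.sub_mem _ (hy i) (T.VS_mono (Nat.le_succ M) (hx i)))
          ((T.good (M+1)).d _ _ (hu i)).1
      have h9 : ∀ i, T.d n (y i) ≤ T.d n (x i) + lam * (T.st (M+1)).A (p i) := by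
        intro i
        rw [hy' i, d, dS_add _ _ _ (Submodule.mem_sup_right (T.mem_FL.2 ⟨_, _, hu i⟩)), add_comm (p i)]
        refine (map_add_le_add _ _ _).trans (add_le_add le_rfl ?_)
        refine (dS_le _ _ _).trans ?_
        rw [T.NL_eq hl0.le _ (hp i)]
        exact (T.good (M+1)).b _
      have h10 : ∑ i, (lam * (T.st (M+1)).A (p i) + T.NL (x i)) ≤ ∑ i, (T.NL (y i) + ε) := by
        refine Finset.sum_le_sum fun i _ => ?_
        rw [T.NL_eq hl0.le _ (hx i), T.NL_eq hl0.le _ (hy i)]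
        have := hN i
        have := norm_nonneg (zz i)
        linarith
      have h11 : ∑ i, T.d n (y i) ≤ ∑ i, (T.d n (x i) + lam * (T.st (M+1)).A (p i)) :=
        Finset.sum_le_sum fun i _ => h9 i
      rw [Finset.sum_add_distrib, ← Finset.mul_sum] at h10 h11
      rw [Finset.sum_add_distrib, Finset.sum_const, Finset.card_univ, nsmul_eq_mul] at h10
      rw [T.NL_eq hl0.le _ hx'] at h7
      have h12 : 0 ≤ T.d n x' := apply_nonneg _ _
      set a := ∑ i, (T.st (M+1)).A (p i)
      have h13 : lam' * (T.st (M+1)).A (∑ i, p i) ≤ lam' * a := by gcongr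
      have h14 := mul_le_mul_of_nonneg_left h11 hc0
      have h15 : c * (∑ i, T.d n (x i) + lam * a) = c * ∑ i, T.d n (x i) + (lam - lam') * a := by
        rw [mul_add, ← mul_assoc, hc, div_mul_cancel₀ _ hl0.ne']
      have h16 : 0 ≤ c * T.d n x' := mul_nonneg hc0 h12
      rw [mul_add] at h7
      linarith
    refine le_of_forall_pos_le_add fun ε hε => ?_
    have := main (ε / (Fintype.card ι + 1)) (by positivity)
    rwa [mul_div_cancel₀ _ (by positivity)] at this

theorem conv (hl' : 1 < lam') (hll : lam' ≤ lam) (n : ℕ) (s z) (hs : s ∈ (T.st n).VS)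
    (hz : ∃ m, z ∈ (T.st m).VS) :
    2 * T.q s + 2 * ((lam - lam') / lam) * T.d n z ≤ T.q (s + z) + T.q (s - z) := by
  refine le_of_forall_pos_le_add fun ε hε => ?_
  obtain ⟨f1, hf1, h1⟩ := dS_lt T.NL T.FL (s + z) (half_pos hε)
  obtain ⟨f2, hf2, h2⟩ := dS_lt T.NL T.FL (s - z) (half_pos hε)
  obtain ⟨m, hm⟩ := hz
  obtain ⟨m1, z1, h3⟩ := T.mem_FL.1 hf1
  obtain ⟨m2, z2, h4⟩ := T.mem_FL.1 hf2
  let M := max (max n m) (max m1 m2)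
  have hn : n ≤ M := by simp [M]
  have a1 := T.VS_mono hn hs
  have a2 := T.VS_mono (show m ≤ M by simp [M]) hm
  have a3 := T.R_mono (show m1 ≤ M by simp [M]) h3
  have a4 := T.R_mono (show m2 ≤ M by simp [M]) h4
  have b3 := ((T.good M).d _ _ a3).1
  have b4 := ((T.good M).d _ _ a4).1
  have := T.key hl' hll n hn Bool (fun b => cond b (s + z - f1) (s - z - f2)) ((2:ℝ) • s)
    (-f1 + -f2) (-z1 + -z2) (by
      rintro (_ | _)
      · exact Submodule.sub_mem _ (Submodule.sub_mem _ a1 a2) b4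
      · exact Submodule.sub_mem _ (Submodule.add_mem _ a1 a2) b3) (Submodule.smul_mem _ _ hs)
    (Submodule.add_mem _ (Submodule.neg_mem _ a3) (Submodule.neg_mem _ a4)) (by
      simp only [Fintype.sum_bool, cond]; rw [two_smul]; abel)
  simp only [Fintype.sum_bool, cond] at this
  rw [map_smul_eq_mul, Real.norm_two] at this
  have c1 : T.d n (s + z - f1) = T.d n z := by
    rw [d, show s + z - f1 = z + (s - f1) by abel, dS_add]
    exact Submodule.sub_mem _ (Submodule.mem_sup_left hs) (Submodule.mem_sup_right hf1)
  have c2 : T.d n (s - z - f2) = T.d n z := by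
    rw [d, show s - z - f2 = -z + (s - f2) by abel, dS_add, map_neg_eq_map]
    exact Submodule.sub_mem _ (Submodule.mem_sup_left hs) (Submodule.mem_sup_right hf2)
  rw [c1, c2] at this
  change _ ≤ dS T.NL T.FL (s+z) + dS T.NL T.FL (s-z) + ε
  linarith

theorem c0free (hl' : 1 < lam') (hll : lam' < lam) (v : ℕ → (Γ →₀ ℝ))
    (hv : ∀ k, ∃ m, v k ∈ (T.st m).VS) (B : ℝ)
    (hB : ∀ (A : Finset ℕ) (θ : ℕ → ℝ), (∀ k, |θ k| ≤ 1) → T.NL (∑ k ∈ A, θ k • v k) ≤ B)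
    (ε : ℝ) (hε : 0 < ε) (hq : ∀ k, ε ≤ T.q (v k)) : False := by
  classical
  have hB0 : 0 ≤ B := (apply_nonneg _ _).trans (hB ∅ 0 (by simp))
  have fin : ∀ n, {k | T.d n (v k) < ε / 8}.Finite := by
    intro n
    have : FiniteDimensional ℝ (T.st n).VS := inferInstance
    obtain ⟨m, c, hc1, hc2⟩ := exists_norming_sub (T.st n).VS T.q 2 one_lt_two
    have big : ∀ k, T.d n (v k) < ε / 8 → 5 * ε / 16 ≤ ∑ j, |c j (v k)| := by
      intro k hk
      obtain ⟨w, hw, h1⟩ := dS_lt T.NL ((T.st n).VS ⊔ T.FL) (v k) (sub_pos.2 hk)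
      obtain ⟨s, hs, f, hf, rfl⟩ := Submodule.mem_sup.1 hw
      have h1' : T.NL (v k - (s + f)) < ε / 8 := by
        refine h1.trans_le ?_
        change T.d n (v k) + _ ≤ _
        linarith
      have h2 : T.q (v k - s) < ε / 8 := by
        refine lt_of_le_of_lt ?_ h1'
        have := dS_le_sub T.NL T.FL (v k - s) hf
        rwa [sub_sub] at this
      have h3 : T.q (v k) ≤ T.q (v k - s) + T.q s := by
        have := map_add_le_add T.q (v k - s) s
        rwa [sub_add_cancel] at this
      obtain ⟨j, hj⟩ := hc2 s hs
      have h4 := hc1 j (v k - s)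
      rw [map_sub] at h4
      have h5 : |c j s| ≤ |c j (v k) - c j s| + |c j (v k)| := by
        have := abs_sub_abs_le_abs_sub (c j s) (c j (v k))
        rw [abs_sub_comm] at this
        linarith
      have h6 : |c j (v k)| ≤ ∑ j, |c j (v k)| :=
        Finset.single_le_sum (f := fun j => |c j (v k)|) (fun i _ => abs_nonneg _)
          (Finset.mem_univ j)
      have := hq k
      linarith
    by_contra hinf
    obtain ⟨A, hA, hcard⟩ := Set.Infinite.exists_subset_card_eq hinf
      (⌈(m + 1) * B / (5 * ε / 16)⌉₊ + 1)
    have h1 : ∑ k ∈ A, 5 * ε / 16 ≤ ∑ k ∈ A, ∑ j, |c j (v k)| :=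
      Finset.sum_le_sum fun k hk => big k (hA hk)
    have h2 : ∀ j, ∑ k ∈ A, |c j (v k)| ≤ B := by
      intro j
      have := hB A (fun k => SignType.sign (c j (v k))) (fun k => by
        rcases lt_trichotomy (c j (v k)) 0 with h | h | h <;> simp [h])
      have h3 := (hc1 j _).trans ((dS_le _ _ _).trans this)
      refine le_trans ?_ ((le_abs_self _).trans h3)
      rw [map_sum]
      refine Finset.sum_le_sum fun k _ => ?_
      rw [map_smul, smul_eq_mul, sign_mul_self]
    rw [Finset.sum_comm] at h1
    have h3 := h1.trans (Finset.sum_le_sum fun j _ => h2 j)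
    simp only [Finset.sum_const, hcard, Finset.card_univ, Fintype.card_fin, nsmul_eq_mul] at h3
    have h4 := Nat.le_ceil ((m + 1) * B / (5 * ε / 16))
    rw [div_le_iff₀ (by positivity)] at h4
    push_cast at h3
    nlinarith
  have grow : ∀ j : ℕ, ∃ (A : Finset ℕ) (θ : ℕ → ℝ), (∀ k, |θ k| ≤ 1) ∧
      j * ((lam - lam') / lam * (ε / 8)) ≤ T.q (∑ k ∈ A, θ k • v k) := by
    intro j
    induction j with
    | zero => exact ⟨∅, 0, by simp, by simp⟩
    | succ j ih =>
      obtain ⟨A, θ, h1, h2⟩ := ih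
      choose m hm using hv
      let n := A.sup m
      have hs : ∑ k ∈ A, θ k • v k ∈ (T.st n).VS := Submodule.sum_mem _ fun k hk =>
        Submodule.smul_mem _ _ (T.VS_mono (Finset.le_sup hk) (hm k))
      obtain ⟨k, hk⟩ := ((fin n).union A.finite_toSet).infinite_compl.nonempty
      simp only [Set.mem_compl_iff, Set.mem_union, not_or] at hk
      have hkA : k ∉ A := by simpa using hk.2
      have hd : ε / 8 ≤ T.d n (v k) := by simpa using hk.1
      have hconv := T.conv hl' hll.le n _ (v k) hs ⟨_, hm k⟩
      set c := (lam - lam') / lam with hc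
      have hc0 : 0 ≤ c := div_nonneg (by linarith) (by linarith)
      have h3 : c * (ε / 8) ≤ c * T.d n (v k) := by gcongr
      have upd : ∀ τ : ℝ, ∑ k' ∈ insert k A, (Function.update θ k τ) k' • v k' =
          ∑ k ∈ A, θ k • v k + τ • v k := by
        intro τ
        rw [Finset.sum_insert hkA, add_comm, Function.update_self]
        congr 1
        refine Finset.sum_congr rfl fun k' hk' => ?_
        rw [Function.update_of_ne (by rintro rfl; exact hkA hk')]
      have upd2 : ∀ τ : ℝ, |τ| ≤ 1 → ∀ k', |Function.update θ k τ k'| ≤ 1 := by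
        intro τ hτ k'
        by_cases h : k' = k
        · subst h; simpa using hτ
        · rw [Function.update_of_ne h]; exact h1 k'
      push_cast
      rcases le_total (T.q (∑ k ∈ A, θ k • v k - v k)) (T.q (∑ k ∈ A, θ k • v k + v k)) with h | h
      · refine ⟨insert k A, Function.update θ k 1, upd2 1 (by simp), ?_⟩
        rw [upd, one_smul]
        linarith
      · refine ⟨insert k A, Function.update θ k (-1), upd2 (-1) (by simp), ?_⟩
        rw [upd, neg_smul, one_smul, ← sub_eq_add_neg]
        linarith
  have hc0 : 0 < (lam - lam') / lam * (ε / 8) := by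
    have : 0 < (lam - lam') / lam := div_pos (by linarith) (by linarith)
    positivity
  obtain ⟨j, hj⟩ := exists_nat_gt (B / ((lam - lam') / lam * (ε / 8)))
  obtain ⟨A, θ, h1, h2⟩ := grow j
  rw [div_lt_iff₀ hc0] at hj
  have h3 := (dS_le T.NL T.FL _).trans (hB A θ h1)
  change T.q _ ≤ B at h3
  linarith

end SeqSys


/-! ### Cantor space utilities -/

theorem pre_length {Λ : Type} (σ : ℕ → Λ) (n) : (pre σ n).length = n := by
  induction n with
  | zero => rfl
  | succ n ih => simp [pre, ih]

theorem pre_eq_iff {Λ : Type} {σ τ : ℕ → Λ} {n} : pre σ n = pre τ n ↔ ∀ i < n, σ i = τ i := by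
  induction n with
  | zero => simp [pre]
  | succ n ih =>
    simp only [pre, List.cons.injEq, ih]
    constructor
    · rintro ⟨h1, h2⟩ i hi
      rcases Nat.lt_succ_iff_lt_or_eq.1 hi with h | rfl
      exacts [h2 i h, h1]
    · exact fun h => ⟨h n (Nat.lt_succ_self n), fun i hi => h i (hi.trans (Nat.lt_succ_self n))⟩

theorem pre_mono {Λ : Type} {σ τ : ℕ → Λ} {m n} (h : m ≤ n) (e : pre σ n = pre τ n) :
    pre σ m = pre τ m := pre_eq_iff.2 fun i hi => pre_eq_iff.1 e i (hi.trans_le h)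

theorem pre_suffix {Λ : Type} (σ : ℕ → Λ) {m n} (h : m ≤ n) : pre σ m <:+ pre σ n := by
  induction n, h using Nat.le_induction with
  | base => exact List.suffix_rfl
  | succ n h ih => exact ih.trans (List.suffix_cons _ _)

theorem pre_locConst (n : ℕ) : IsLocallyConstant fun x : CantorSet => pre x n := by
  induction n with
  | zero => exact IsLocallyConstant.const _
  | succ n ih =>
    rw [IsLocallyConstant.iff_eventually_eq] at ih ⊢
    intro x
    have h : IsLocallyConstant fun x : CantorSet => x n :=
      (IsLocallyConstant.iff_continuous _).2 (continuous_apply n)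
    rw [IsLocallyConstant.iff_eventually_eq] at h
    filter_upwards [ih x, h x] with y h1 h2
    simp only [pre, h1, h2]

theorem cyl_clopen (s : List Bool) (n : ℕ) : IsClopen {y : CantorSet | pre y n = s} :=
  (pre_locConst n).isClopen_fiber s

open TopologicalSpace in
/-- indicator function of a clopen set -/
noncomputable def ind (U : Clopens CantorSet) : CantorC :=
  ⟨(U : Set CantorSet).indicator (fun _ => 1), U.isClopen.continuous_indicator continuous_const⟩

theorem ind_mem {U : TopologicalSpace.Clopens CantorSet} {x} (h : x ∈ U) : ind U x = 1 :=
  Set.indicator_of_mem (show x ∈ (U : Set CantorSet) from h) (fun _ => (1:ℝ))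

theorem ind_not_mem {U : TopologicalSpace.Clopens CantorSet} {x} (h : x ∉ U) : ind U x = 0 :=
  Set.indicator_of_notMem (show x ∉ (U : Set CantorSet) from h) (fun _ => (1:ℝ))

theorem abs_ind_le (U : TopologicalSpace.Clopens CantorSet) (x) : |ind U x| ≤ 1 := by
  by_cases h : x ∈ U
  · simp [ind_mem h]
  · simp [ind_not_mem h]

/-- cylinder sets -/
def cyl (s : List Bool) : TopologicalSpace.Clopens CantorSet :=
  ⟨{y | pre y s.length = s}, cyl_clopen s _⟩

theorem mem_cyl {s : List Bool} {y} : y ∈ cyl s ↔ pre y s.length = s := Iff.rfl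

theorem mem_cyl_pre {x y : CantorSet} {n} : y ∈ cyl (pre x n) ↔ ∀ i < n, y i = x i := by
  rw [mem_cyl, pre_length, pre_eq_iff]

theorem mem_cyl_cons {b : Bool} {s : List Bool} {y} : y ∈ cyl (b :: s) ↔ y s.length = b ∧ y ∈ cyl s := by
  rw [mem_cyl, mem_cyl, List.length_cons, pre, List.cons.injEq]

theorem exists_cyl {U : Set CantorSet} (hU : IsOpen U) {x} (hx : x ∈ U) :
    ∃ n, ∀ y ∈ cyl (pre x n), y ∈ U := by
  obtain ⟨v, ⟨x', n, rfl⟩, h1, h2⟩ :=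
    (PiNat.isTopologicalBasis_cylinders (fun _ => Bool)).exists_subset_of_mem_open hx hU
  refine ⟨n, fun y hy => h2 ?_⟩
  rw [mem_cyl_pre] at hy
  intro i hi
  rw [hy i hi]
  exact h1 i hi

theorem exists_cyl_unif (f : CantorC) {ε : ℝ} (hε : 0 < ε) :
    ∃ n, ∀ x y, pre x n = pre y n → |f x - f y| < ε := by
  have h1 : ∀ x, ∃ n, ∀ y ∈ cyl (pre x n), |f y - f x| < ε / 2 := by
    intro x
    refine exists_cyl (U := {y | |f y - f x| < ε / 2})
      (isOpen_lt (by fun_prop) continuous_const) ?_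
    simpa using hε
  choose n hn using h1
  obtain ⟨t, ht⟩ := CompactSpace.elim_nhds_subcover (fun x => (cyl (pre x (n x)) : Set CantorSet))
    (fun x => (cyl (pre x (n x))).isClopen.isOpen.mem_nhds (mem_cyl_pre.2 fun _ _ => rfl))
  refine ⟨t.sup n, fun x y h => ?_⟩
  have hx : x ∈ ⋃ z ∈ t, (cyl (pre z (n z)) : Set CantorSet) := by rw [ht]; trivial
  simp only [Set.mem_iUnion] at hx
  obtain ⟨z, hz, hxz⟩ := hx
  have h2 := hn z x hxz
  have h3 := hn z y (by
    have := pre_mono (Finset.le_sup hz) h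
    change x ∈ cyl (pre z (n z)) at hxz
    rw [mem_cyl, pre_length] at hxz ⊢
    rw [← this, hxz])
  rw [abs_lt] at *
  constructor <;> linarith

/-- a point whose initial segment is `s`, followed by zeros -/
def pt : List Bool → CantorSet
  | [] => fun _ => false
  | b :: s => Function.update (pt s) s.length b

theorem pt_ge {s : List Bool} {i} (h : s.length ≤ i) : pt s i = false := by
  induction s with
  | nil => rfl
  | cons b s ih =>
    rw [List.length_cons] at h
    rw [pt, Function.update_of_ne (by omega)]
    exact ih (by omega)

theorem pt_mem (s : List Bool) : pt s ∈ cyl s := by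
  induction s with
  | nil => rfl
  | cons b s ih =>
    rw [mem_cyl_cons, pt, Function.update_self]
    refine ⟨rfl, ?_⟩
    rw [mem_cyl] at ih ⊢
    conv_rhs => rw [← ih]
    rw [pre_eq_iff]
    intro i hi
    rw [Function.update_of_ne hi.ne]

theorem span_cyl_dense (P : Submodule ℝ CantorC) (hP : IsClosed (P : Set CantorC))
    (h : ∀ s, ind (cyl s) ∈ P) (f : CantorC) : f ∈ P := by
  have hc : ∀ n, Continuous fun x : CantorSet => f (pt (pre x n)) := fun n =>
    ((pre_locConst n).comp (fun s => f (pt s))).continuous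
  let F : ℕ → CantorC := fun n => ⟨fun x => f (pt (pre x n)), hc n⟩
  have h1 : ∀ n s, F (s.length + n) * ind (cyl s) ∈ P := by
    intro n
    induction n with
    | zero =>
      intro s
      have : F (s.length + 0) * ind (cyl s) = f (pt s) • ind (cyl s) := by
        ext x
        simp only [ContinuousMap.mul_apply, ContinuousMap.smul_apply, smul_eq_mul]
        by_cases hx : x ∈ cyl s
        · rw [ind_mem hx]
          rw [mem_cyl] at hx
          simp [F, hx]
        · simp [ind_not_mem hx]
      rw [this]
      exact P.smul_mem _ (h s)
    | succ n ih =>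
      intro s
      have : F (s.length + (n + 1)) * ind (cyl s) =
          F ((true :: s).length + n) * ind (cyl (true :: s)) +
          F ((false :: s).length + n) * ind (cyl (false :: s)) := by
        rw [List.length_cons, List.length_cons, show s.length + 1 + n = s.length + (n + 1) by ring,
          ← mul_add]
        congr 1
        ext x
        rw [ContinuousMap.add_apply]
        by_cases hx : x ∈ cyl s
        · by_cases hb : x s.length = true
          · rw [ind_mem hx, ind_mem (mem_cyl_cons.2 ⟨hb, hx⟩),
              ind_not_mem (fun h' => by simpa [hb] using (mem_cyl_cons.1 h').1)]
            ring
          · rw [ind_mem hx, ind_mem (U := cyl (false :: s)) (mem_cyl_cons.2 ⟨by simpa using hb, hx⟩),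
              ind_not_mem (fun h' => hb (mem_cyl_cons.1 h').1)]
            ring
        · rw [ind_not_mem hx, ind_not_mem (fun h' => hx (mem_cyl_cons.1 h').2),
            ind_not_mem (fun h' => hx (mem_cyl_cons.1 h').2), add_zero]
      rw [this]
      exact P.add_mem (ih _) (ih _)
  have h2 : ∀ n, F n ∈ P := by
    intro n
    have := h1 n []
    have e : F (([] : List Bool).length + n) * ind (cyl []) = F n := by
      ext x
      rw [ContinuousMap.mul_apply, ind_mem (by rfl), mul_one]
      simp
    rwa [e] at this
  have h3 : Tendsto F atTop (𝓝 f) := by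
    rw [Metric.tendsto_atTop]
    intro ε hε
    obtain ⟨N, hN⟩ := exists_cyl_unif f (half_pos hε)
    refine ⟨N, fun n hn => lt_of_le_of_lt ?_ (half_lt_self hε)⟩
    rw [ContinuousMap.dist_le (half_pos hε).le]
    intro x
    rw [Real.dist_eq]
    refine (hN _ _ (pre_mono hn ?_)).le
    have := pt_mem (pre x n)
    rwa [mem_cyl, pre_length] at this
  exact hP.mem_of_tendsto h3 (Eventually.of_forall h2)

/-- composition operator -/
noncomputable def compL (ρ : C(CantorSet, CantorSet)) : CantorC →L[ℝ] CantorC :=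
  LinearMap.mkContinuous
    { toFun := fun f => f.comp ρ
      map_add' := fun f g => rfl
      map_smul' := fun r f => rfl } 1 (fun f => by
      rw [one_mul, ContinuousMap.norm_le _ (norm_nonneg _)]
      exact fun x => f.norm_coe_le_norm _)

@[simp] theorem compL_apply (ρ : C(CantorSet, CantorSet)) (f : CantorC) (x) :
    compL ρ f x = f (ρ x) := rfl

theorem compL_norm (ρ : C(CantorSet, CantorSet)) (f : CantorC) : ‖compL ρ f‖ ≤ ‖f‖ := by
  rw [ContinuousMap.norm_le _ (norm_nonneg _)]
  exact fun x => f.norm_coe_le_norm _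

theorem norm_disj_sum {ι : Type*} (A : Finset ι) (f : ι → CantorC) (M : ℝ) (hM : 0 ≤ M)
    (h1 : ∀ k ∈ A, ∀ y, |f k y| ≤ M)
    (h2 : ∀ y, ∀ k ∈ A, ∀ l ∈ A, f k y ≠ 0 → f l y ≠ 0 → k = l) : ‖∑ k ∈ A, f k‖ ≤ M := by
  rw [ContinuousMap.norm_le _ hM]
  intro y
  rw [ContinuousMap.sum_apply]
  by_cases h : ∃ k ∈ A, f k y ≠ 0
  · obtain ⟨k, hk, hk'⟩ := h
    rw [Finset.sum_eq_single_of_mem k hk]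
    · exact h1 k hk y
    · intro l hl hlk
      by_contra h3
      exact hlk (h2 y l hl k hk h3 hk')
  · push Not at h
    rw [Finset.sum_eq_zero h]
    simpa using hM

theorem exists_fin_image_point (U : TopologicalSpace.Clopens CantorSet) {x : CantorSet} (hx : x ∈ U) :
    ∃ n0, ∀ y ∈ cyl (pre x n0), y ∈ U := exists_cyl U.isClopen.isOpen hx

/-- annulus around `x` -/
def ann (x : CantorSet) (n : ℕ) : TopologicalSpace.Clopens CantorSet := cyl ((! x n) :: pre x n)

theorem mem_ann {x y : CantorSet} {n} : y ∈ ann x n ↔ y n ≠ x n ∧ ∀ i < n, y i = x i := by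
  rw [ann, mem_cyl_cons, mem_cyl_pre, pre_length]
  constructor
  · rintro ⟨h1, h2⟩
    exact ⟨by rw [h1]; cases x n <;> simp, h2⟩
  · rintro ⟨h1, h2⟩
    refine ⟨?_, h2⟩
    revert h1; cases x n <;> cases y n <;> simp

theorem ann_disj {x y : CantorSet} {m n} (h1 : y ∈ ann x m) (h2 : y ∈ ann x n) : m = n := by
  rw [mem_ann] at h1 h2
  rcases lt_trichotomy m n with h | h | h
  · exact absurd (h2.2 m h) h1.1
  · exact h
  · exact absurd (h1.2 n h) h2.1

theorem not_mem_ann (x : CantorSet) (n) : x ∉ ann x n := fun h => (mem_ann.1 h).1 rfl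

theorem ann_sub {x y : CantorSet} {m n} (h : m ≤ n) (hy : y ∈ ann x n) : y ∈ cyl (pre x m) :=
  mem_cyl_pre.2 fun i hi => (mem_ann.1 hy).2 i (hi.trans_le h)

theorem ann_nonempty (x : CantorSet) (n) : ∃ y, y ∈ ann x n := ⟨_, pt_mem _⟩


/-- no uniformly separated `c₀`-like sequence modulo `X'` -/
def C0FreeMod {L : Type*} [NormedAddCommGroup L] [NormedSpace ℝ L] (X' : Submodule ℝ L) : Prop :=
  ∀ (v : ℕ → L) (B : ℝ),
    (∀ (A : Finset ℕ) (θ : ℕ → ℝ), (∀ k, |θ k| ≤ 1) → ‖∑ k ∈ A, θ k • v k‖ ≤ B) →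
    ∀ ε : ℝ, 0 < ε → (∀ k, ∀ x ∈ X', ε ≤ ‖v k - x‖) → False

theorem SeqSys.c0freeMod {Γ Z : Type} [NormedAddCommGroup Z] [NormedSpace ℝ Z] {lam lam' : ℝ}
    {g : ℕ → Z} (T : SeqSys Γ Z lam lam' g) (hl' : 1 < lam') (hll : lam' < lam) :
    C0FreeMod T.X' := by
  intro v B hB ε hε hv
  obtain ⟨δ, hδ, c, hc, hcε⟩ := posSumOfEncodable (half_pos hε) ℕ
  have h1 : ∀ k, ∃ y, (∃ m, y ∈ (T.st m).VS) ∧ ‖v k - iota T.NL y‖ < δ k := by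
    intro k
    obtain ⟨x, hx⟩ := (dense_iota T.NL).exists_dist_lt (v k) (hδ k)
    obtain ⟨n, y, hy, e⟩ := T.iota_stage (by linarith) x
    refine ⟨y, ⟨n, hy⟩, ?_⟩
    rw [← e, ← dist_eq_norm]; exact hx
  choose y hy hvy using h1
  have hδε : ∀ k, δ k ≤ ε / 2 := fun k =>
    (le_hasSum hc k fun j _ => (hδ j).le).trans hcε
  refine T.c0free hl' hll y hy (B + ε / 2) (fun A θ hθ => ?_) (ε / 2) (half_pos hε) (fun k => ?_)
  · rw [← norm_iota, map_sum]
    simp only [map_smul]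
    have e : ∑ k ∈ A, θ k • iota T.NL (y k) =
        ∑ k ∈ A, θ k • v k - ∑ k ∈ A, θ k • (v k - iota T.NL (y k)) := by
      rw [← Finset.sum_sub_distrib]
      refine Finset.sum_congr rfl fun k _ => ?_
      rw [smul_sub]; abel
    rw [e]
    refine (norm_sub_le _ _).trans (add_le_add (hB A θ hθ) ?_)
    calc _ ≤ ∑ k ∈ A, ‖θ k • (v k - iota T.NL (y k))‖ := norm_sum_le _ _
      _ ≤ ∑ k ∈ A, δ k := by
        refine Finset.sum_le_sum fun k _ => ?_
        rw [norm_smul]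
        have h2 := hθ k
        have h3 := (hvy k).le
        have h4 := norm_nonneg (v k - iota T.NL (y k))
        rw [Real.norm_eq_abs]
        nlinarith
      _ ≤ c := sum_le_hasSum A (fun j _ => (hδ j).le) hc
      _ ≤ _ := hcε
  · refine le_of_forall_pos_le_add fun η hη => ?_
    obtain ⟨f, hf, h2⟩ := dS_lt T.NL T.FL (y k) hη
    obtain ⟨⟨f', z⟩, hr, rfl⟩ := hf
    have h3 : iota T.NL f' ∈ T.X' := Submodule.le_topologicalClosure _ ⟨⟨(f', z), hr⟩, rfl⟩
    have h4 := hv k _ h3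
    have h5 := hδε k
    have h6 := (hvy k).le
    rw [← norm_iota, map_sub] at h2
    have h7 : ‖v k - iota T.NL f'‖ ≤ ‖v k - iota T.NL (y k)‖ +
      ‖iota T.NL (y k) - iota T.NL f'‖ := norm_sub_le_norm_sub_add_norm_sub _ _ _
    change ε / 2 ≤ dS T.NL T.FL (y k) + η
    have h8 : ‖iota T.NL (y k) - iota T.NL f'‖ < dS T.NL T.FL (y k) + η := h2
    linarith

open TopologicalSpace

section
variable {L : Type*} [NormedAddCommGroup L] [NormedSpace ℝ L] 

theorem exists_small_clopen {X' : Submodule ℝ L} (H : C0FreeMod X') (J : CantorC →L[ℝ] L)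
    (U : Clopens CantorSet) (hU : ∃ x, x ∈ U) (ε : ℝ) (hε : 0 < ε) :
    ∃ W : Clopens CantorSet, W ≤ U ∧ (∃ x, x ∈ W) ∧ (∃ x, x ∈ U ∧ x ∉ W) ∧
      ∃ a ∈ X', ‖J (ind W) - a‖ < ε := by
  by_contra hcon
  push Not at hcon
  obtain ⟨x, hx⟩ := hU
  obtain ⟨n0, hn0⟩ := exists_fin_image_point U hx
  refine H (fun k => J (ind (ann x (n0 + k)))) ‖J‖ (fun A θ hθ => ?_) ε hε (fun k => ?_)
  · have : ∑ k ∈ A, θ k • J (ind (ann x (n0 + k))) = J (∑ k ∈ A, θ k • ind (ann x (n0 + k))) := by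
      simp
    rw [this]
    refine (J.le_opNorm _).trans ?_
    refine mul_le_of_le_one_right (norm_nonneg _) (norm_disj_sum A _ 1 zero_le_one ?_ ?_)
    · intro k _ y
      simp only [ContinuousMap.smul_apply, smul_eq_mul, abs_mul]
      exact mul_le_one₀ (hθ k) (abs_nonneg _) (abs_ind_le _ _)
    · intro y k _ l _ h1 h2
      have h1' : y ∈ ann x (n0 + k) := by
        by_contra h; exact h1 (by simp [ind_not_mem h])
      have h2' : y ∈ ann x (n0 + l) := by
        by_contra h; exact h2 (by simp [ind_not_mem h])
      have := ann_disj h1' h2'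
      omega
  · exact hcon _ (fun y hy => hn0 y (ann_sub (Nat.le_add_right _ _) hy)) (ann_nonempty _ _)
      ⟨x, hx, not_mem_ann _ _⟩

theorem exists_rho (U : List Bool → Clopens CantorSet) (U0 : U [] = ⊤)
    (U2 : ∀ t, U (false :: t) = U t \ U (true :: t)) (Ule1 : ∀ t, U (true :: t) ≤ U t) :
    ∃ ρ : C(CantorSet, CantorSet), ∀ x t, x ∈ U t ↔ ρ x ∈ cyl t := by
  classical
  have Ule : ∀ t b, U (b :: t) ≤ U t := by
    intro t b
    cases b
    · rw [U2]; exact sdiff_le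
    · exact Ule1 t
  let nd : CantorSet → ℕ → List Bool := fun x n =>
    Nat.rec [] (fun _ t => decide (x ∈ U (true :: t)) :: t) n
  let ρ0 : CantorSet → CantorSet := fun x n => decide (x ∈ U (true :: nd x n))
  have nd_pre : ∀ x n, nd x n = pre (ρ0 x) n := by
    intro x n
    induction n with
    | zero => rfl
    | succ n ih =>
      change decide (x ∈ U (true :: nd x n)) :: nd x n = _
      rw [pre, ← ih]
  have nd_len : ∀ x n, (nd x n).length = n := fun x n => by rw [nd_pre, pre_length]
  have memU : ∀ x t, x ∈ U t ↔ ρ0 x ∈ cyl t := by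
    intro x t
    induction t with
    | nil => rw [U0]; exact ⟨fun _ => rfl, fun _ => trivial⟩
    | cons b t ih =>
      rw [mem_cyl_cons, ← ih]
      have key : ∀ h : x ∈ U t, ρ0 x t.length = decide (x ∈ U (true :: t)) := by
        intro h
        rw [ih, mem_cyl, ← nd_pre] at h
        change decide (x ∈ U (true :: nd x t.length)) = _
        rw [h]
      constructor
      · intro h
        have h' := Ule t b h
        refine ⟨?_, h'⟩
        rw [key h']
        cases b
        · rw [U2] at h
          simpa using h.2
        · simpa using h
      · rintro ⟨h1, h2⟩
        rw [key h2] at h1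
        cases b
        · rw [U2]
          exact ⟨h2, by simpa using h1⟩
        · simpa using h1
  have nd_lc : ∀ n, IsLocallyConstant fun x => nd x n := by
    intro n
    induction n with
    | zero => exact IsLocallyConstant.const _
    | succ n ih =>
      rw [IsLocallyConstant.iff_eventually_eq] at ih ⊢
      intro x
      have h : ∀ᶠ y in 𝓝 x, (y ∈ U (true :: nd x n) ↔ x ∈ U (true :: nd x n)) := by
        by_cases hx : x ∈ U (true :: nd x n)
        · filter_upwards [(U (true :: nd x n)).isClopen.isOpen.mem_nhds hx] with y hy
          exact ⟨fun _ => hx, fun _ => hy⟩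
        · filter_upwards [(U (true :: nd x n)).isClopen.compl.isOpen.mem_nhds hx] with y hy
          exact ⟨fun h => absurd h hy, fun h => absurd h hx⟩
      filter_upwards [ih x, h] with y h1 h2
      change decide (y ∈ U (true :: nd y n)) :: nd y n = decide (x ∈ U (true :: nd x n)) :: nd x n
      rw [h1, decide_eq_decide.2 h2]
  have hρc : Continuous ρ0 := by
    refine continuous_pi fun n => ?_
    have : (fun x => ρ0 x n) = (fun l : List Bool => l.head?.getD false) ∘ (fun x => nd x (n+1)) := rfl
    rw [this]
    exact ((nd_lc (n+1)).comp _).continuous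
  exact ⟨⟨ρ0, hρc⟩, memU⟩

theorem rho_surj {U : List Bool → Clopens CantorSet} {ρ : C(CantorSet, CantorSet)}
    (memU : ∀ x t, x ∈ U t ↔ ρ x ∈ cyl t) (Une : ∀ t, ∃ x, x ∈ U t)
    (Ule : ∀ t b, U (b :: t) ≤ U t) : Function.Surjective ρ := by
    intro y
    let t : ℕ → Set CantorSet := fun n => (U (pre y n)).carrier
    have ht1 : ∀ n, t (n+1) ⊆ t n := fun n => Ule _ _
    have ht2 : ∀ n, (t n).Nonempty := fun n => Une _
    obtain ⟨x, hx⟩ := IsCompact.nonempty_iInter_of_sequence_nonempty_isCompact_isClosed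
      t ht1 ht2
      (U (pre y 0)).isClopen.isClosed.isCompact (fun n => (U (pre y n)).isClopen.isClosed)
    refine ⟨x, ?_⟩
    funext i
    have h1 : x ∈ U (pre y (i+1)) := Set.mem_iInter.1 hx (i+1)
    rw [memU, mem_cyl_pre] at h1
    exact h1 i (Nat.lt_succ_self i)

theorem exists_phi : ∃ φ : List Bool → (CantorC →L[ℝ] ℝ), (∀ t, ‖φ t‖ ≤ 2) ∧
    ∀ t t', φ t (ind (cyl (true :: t'))) = if t = t' then 1 else 0 := by
  let ev : CantorSet → (CantorC →L[ℝ] ℝ) := fun x => ContinuousMap.evalCLM ℝ x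
  have hev : ∀ x, ‖ev x‖ ≤ 1 := fun x => ContinuousLinearMap.opNorm_le_bound _ zero_le_one
    fun f => by rw [one_mul]; exact f.norm_coe_le_norm x
  let φ : List Bool → (CantorC →L[ℝ] ℝ) := fun t => ev (pt (true :: t)) - ev (pt t)
  have hφ : ∀ t, ‖φ t‖ ≤ 2 := fun t => by
    have h1 := hev (pt (true :: t)); have h2 := hev (pt t)
    have h3 := norm_sub_le (ev (pt (true :: t))) (ev (pt t))
    change ‖ev (pt (true :: t)) - ev (pt t)‖ ≤ 2
    linarith
  have bior : ∀ t t', φ t (ind (cyl (true :: t'))) = if t = t' then 1 else 0 := by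
    intro t t'
    change ind (cyl (true :: t')) (pt (true :: t)) - ind (cyl (true :: t')) (pt t) = _
    split_ifs with h
    · subst h
      rw [ind_mem (pt_mem _), ind_not_mem, sub_zero]
      intro h
      have := (mem_cyl_cons.1 h).1
      rw [pt_ge le_rfl] at this
      simp at this
    · suffices hs : pt (true :: t) ∈ cyl (true :: t') ↔ pt t ∈ cyl (true :: t') by
        by_cases h1 : pt t ∈ cyl (true :: t')
        · rw [ind_mem h1, ind_mem (hs.2 h1), sub_self]
        · rw [ind_not_mem h1, ind_not_mem (fun h2 => h1 (hs.1 h2)), sub_self]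
      have agree : ∀ i, i ≠ t.length → pt (true :: t) i = pt t i := fun i hi => by
        rw [pt, Function.update_of_ne hi]
      rcases lt_trichotomy t'.length t.length with hl | hl | hl
      · rw [mem_cyl, mem_cyl, List.length_cons]
        have : pre (pt (true :: t)) (t'.length + 1) = pre (pt t) (t'.length + 1) :=
          pre_eq_iff.2 fun i hi => agree i (by omega)
        rw [this]
      · constructor
        · intro h'
          have h2 := (mem_cyl_cons.1 h').2
          have h3 := (mem_cyl_cons.1 (pt_mem (true :: t))).2
          rw [mem_cyl] at h2 h3
          rw [hl, h3] at h2
          exact absurd h2 h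
        · intro h'
          have := (mem_cyl_cons.1 h').1
          rw [pt_ge hl.ge] at this
          simp at this
      · constructor
        · intro h'
          have := (mem_cyl_cons.1 h').1
          rw [pt_ge (by simpa using hl)] at this
          simp at this
        · intro h'
          have := (mem_cyl_cons.1 h').1
          rw [pt_ge hl.le] at this
          simp at this
  exact ⟨φ, hφ, bior⟩

theorem gen_sum {E ι : Type*} [NormedAddCommGroup E] [CompleteSpace E] (δ : ι → ℝ) (C : ℝ)
  (hs2 : HasSum δ C) (D0 : ι → E) (hD0 : (∀ t, ‖D0 t‖ ≤ δ t)) : ∃ D, HasSum D0 D ∧  ‖D‖ ≤ C := by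
  have hsum := Summable.of_norm_bounded hs2.summable hD0
  obtain ⟨D, hDs⟩ := hsum
  refine ⟨D, hDs, ?_⟩
  rw [← hDs.tsum_eq]
  exact tsum_of_norm_bounded hs2 hD0

theorem exists_nuclear [CompleteSpace L] (w : List Bool → L) (δ : List Bool → ℝ) (C c : ℝ)
    (hC : HasSum δ C) (hCε : C ≤ c / 4) (hw : ∀ t, ‖w t‖ < δ t) :
    ∃ D : CantorC →L[ℝ] L, ‖D‖ ≤ c / 2 ∧ ∀ t, D (ind (cyl (true :: t))) = w t := by
  obtain ⟨φ, hφ, bior⟩ := exists_phi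
  obtain ⟨D0, hD0, hD1⟩ : ∃ D0 : List Bool → (CantorC →L[ℝ] L), (∀ t, ‖D0 t‖ ≤ 2 * δ t) ∧
      ∀ t f, D0 t f = φ t f • w t := by
    refine ⟨fun t => (φ t).smulRight (w t), fun t => ?_, fun t f => rfl⟩
    rw [ContinuousLinearMap.norm_smulRight_apply]
    exact mul_le_mul (hφ t) (hw t).le (norm_nonneg _) zero_le_two
  have hs2 : HasSum (fun t => 2 * δ t) (2 * C) := hC.mul_left 2
  obtain ⟨D, hDs, hD'⟩ := gen_sum (E := CantorC →L[ℝ] L) (fun t => 2 * δ t) _ hs2 D0 hD0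
  have hD : ‖D‖ ≤ c / 2 := hD'.trans (by linarith)
  have Dind : ∀ t, D (ind (cyl (true :: t))) = w t := by
    intro t
    have h1 : HasSum (fun t' => D0 t' (ind (cyl (true :: t)))) (D (ind (cyl (true :: t)))) :=
      (ContinuousLinearMap.apply ℝ L (ind (cyl (true :: t)))).hasSum hDs
    rw [← h1.tsum_eq, tsum_eq_single t]
    · rw [hD1, bior, if_pos rfl, one_smul]
    · intro t' ht
      rw [hD1, bior, if_neg ht, zero_smul]
  exact ⟨D, hD, Dind⟩

theorem three_space [CompleteSpace L] {X' : Submodule ℝ L} (hX : IsClosed (X' : Set L))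
    (H : C0FreeMod X') (hJ : Embeds CantorC L) : Embeds CantorC X' := by
  classical
  obtain ⟨J, c, hc, hJ⟩ := hJ
  obtain ⟨δ, hδ, C, hC, hCε⟩ := posSumOfEncodable (show 0 < c / 4 by positivity) (List Bool)
  have hstep : ∀ (t : List Bool) (U : Clopens CantorSet), ∃ W : Clopens CantorSet,
      (∃ x, x ∈ U) → W ≤ U ∧ (∃ x, x ∈ W) ∧ (∃ x, x ∈ U ∧ x ∉ W) ∧
      ∃ a ∈ X', ‖J (ind W) - a‖ < δ t := by
    intro t U
    by_cases hU : ∃ x, x ∈ U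
    · obtain ⟨W, hW⟩ := exists_small_clopen H J U hU (δ t) (hδ t)
      exact ⟨W, fun _ => hW⟩
    · exact ⟨U, fun h => absurd h hU⟩
  choose W hW using hstep
  let U : List Bool → Clopens CantorSet := fun s =>
    List.rec ⊤ (fun b t V => if b then W t V else V \ W t V) s
  have U0 : U [] = ⊤ := rfl
  have U1 : ∀ t, U (true :: t) = W t (U t) := fun t => rfl
  have U2 : ∀ t, U (false :: t) = U t \ W t (U t) := fun t => by
    change (if false = true then _ else _) = _
    simp only [Bool.false_eq_true, if_false]; rfl
  have Une : ∀ t, ∃ x, x ∈ U t := by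
    intro t
    induction t with
    | nil => exact ⟨pt [], trivial⟩
    | cons b t ih =>
      cases b
      · rw [U2]
        obtain ⟨x, h1, h2⟩ := (hW t (U t) ih).2.2.1
        exact ⟨x, h1, h2⟩
      · rw [U1]; exact (hW t (U t) ih).2.1
  have Ule : ∀ t b, U (b :: t) ≤ U t := by
    intro t b
    cases b
    · rw [U2]; exact sdiff_le
    · rw [U1]; exact (hW t (U t) (Une t)).1
  have Ha : ∀ t, ∃ a ∈ X', ‖J (ind (U (true :: t))) - a‖ < δ t := fun t => by
    rw [U1]; exact (hW t (U t) (Une t)).2.2.2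
  choose a haX ha using Ha
  have U2' : ∀ t, U (false :: t) = U t \ U (true :: t) := fun t => by rw [U2, U1]
  obtain ⟨ρ, memU⟩ := exists_rho U U0 U2' (fun t => Ule t true)
  have hρs : Function.Surjective ρ := rho_surj memU Une Ule
  clear_value U
  have κind : ∀ s, compL ρ (ind (cyl s)) = ind (U s) := by
    intro s
    ext x
    rw [compL_apply]
    by_cases h : x ∈ U s
    · rw [ind_mem h]; exact ind_mem ((memU x s).1 h)
    · rw [ind_not_mem h]; exact ind_not_mem (fun h' => h ((memU x s).2 h'))
  have κnorm : ∀ f, ‖f‖ ≤ ‖compL ρ f‖ := by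
    intro f
    rw [ContinuousMap.norm_le _ (norm_nonneg _)]
    intro y
    obtain ⟨x, rfl⟩ := hρs y
    exact (compL ρ f).norm_coe_le_norm x
  obtain ⟨D, hD, Dind⟩ := exists_nuclear (fun t => J (ind (U (true :: t))) - a t) δ C c hC hCε ha
  let S : CantorC →L[ℝ] L := J.comp (compL ρ) - D
  have Slow : ∀ f, c / 2 * ‖f‖ ≤ ‖S f‖ := by
    intro f
    have h1 := hJ (compL ρ f)
    have h2 := mul_le_mul_of_nonneg_left (κnorm f) hc.le
    have h3 := (D.le_opNorm f).trans (mul_le_mul_of_nonneg_right hD (norm_nonneg f))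
    have h4 : ‖J (compL ρ f)‖ - ‖D f‖ ≤ ‖S f‖ := norm_sub_norm_le _ _
    linarith
  have S1 : ∀ t, S (ind (cyl (true :: t))) ∈ X' := by
    intro t
    have : S (ind (cyl (true :: t))) = a t := by
      change J (compL ρ _) - D _ = _
      rw [Dind, κind]
      simp
    rw [this]; exact haX t
  have S2 : ∀ t, S (ind (cyl (t ++ [true]))) ∈ X' := by
    intro t
    induction t with
    | nil => exact S1 []
    | cons b t ih =>
      cases b
      · have e : ind (cyl (false :: (t ++ [true]))) =
            ind (cyl (t ++ [true])) - ind (cyl (true :: (t ++ [true]))) := by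
          ext x
          rw [ContinuousMap.sub_apply]
          by_cases hx : x ∈ cyl (t ++ [true])
          · by_cases hb : x (t ++ [true]).length = true
            · rw [ind_mem hx, ind_mem (U := cyl (true :: (t ++ [true]))) (mem_cyl_cons.2 ⟨hb, hx⟩),
                ind_not_mem (fun h' => Bool.noConfusion (hb.symm.trans (mem_cyl_cons.1 h').1))]
              ring
            · rw [ind_mem hx, ind_mem (U := cyl (false :: (t ++ [true])))
                (mem_cyl_cons.2 ⟨by simpa using hb, hx⟩),
                ind_not_mem (fun h' => hb (mem_cyl_cons.1 h').1)]
              ring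
          · rw [ind_not_mem hx, ind_not_mem (fun h' => hx (mem_cyl_cons.1 h').2),
              ind_not_mem (fun h' => hx (mem_cyl_cons.1 h').2), sub_zero]
        rw [List.cons_append, e, map_sub]
        exact X'.sub_mem ih (S1 _)
      · exact S1 _
  -- restrict to functions supported on the cylinder [true]
  let tail : C(CantorSet, CantorSet) := ⟨fun x i => x (i+1), by fun_prop⟩
  let E : CantorC →L[ℝ] CantorC :=
    (ContinuousLinearMap.mul ℝ CantorC (ind (cyl [true]))).comp (compL tail)
  have hE : ∀ f x, E f x = ind (cyl [true]) x * f (tail x) := fun f x => rfl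
  have Enorm : ∀ f, ‖f‖ ≤ ‖E f‖ := by
    intro f
    rw [ContinuousMap.norm_le _ (norm_nonneg _)]
    intro y
    have h1 := (E f).norm_coe_le_norm (fun i => Nat.casesOn i true y)
    rw [hE, ind_mem (by rfl), one_mul] at h1
    exact h1
  have memtail : ∀ (s : List Bool) (x : CantorSet), x ∈ cyl (s ++ [true]) ↔ x ∈ cyl [true] ∧ tail x ∈ cyl s := by
    intro s x
    induction s with
    | nil => exact ⟨fun h => ⟨h, rfl⟩, fun h => h.1⟩
    | cons b s ih =>
      have e1 := mem_cyl_cons (b := b) (s := s) (y := tail x)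
      rw [List.cons_append, mem_cyl_cons, e1, ih, List.length_append]
      change x (s.length + 1) = b ∧ _ ↔ _ ∧ x (s.length + 1) = b ∧ _
      tauto
  have Eind : ∀ s, E (ind (cyl s)) = ind (cyl (s ++ [true])) := by
    intro s
    ext x
    rw [hE]
    by_cases h1 : x ∈ cyl [true]
    · by_cases h2 : tail x ∈ cyl s
      · rw [ind_mem h1, ind_mem h2, ind_mem ((memtail s x).2 ⟨h1, h2⟩), one_mul]
      · rw [ind_not_mem h2, ind_not_mem (fun h => h2 ((memtail s x).1 h).2), mul_zero]
    · rw [ind_not_mem h1, ind_not_mem (fun h => h1 ((memtail s x).1 h).1), zero_mul]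
  have final : ∀ f, S (E f) ∈ X' := by
    intro f
    have := span_cyl_dense (X'.comap (S.comp E).toLinearMap) (hX.preimage (S.comp E).continuous)
      (fun s => by
        change S (E (ind (cyl s))) ∈ X'
        rw [Eind]; exact S2 s) f
    exact this
  refine ⟨(S.comp E).codRestrict X' final, c / 2, by positivity, fun f => ?_⟩
  change _ ≤ ‖S (E f)‖
  refine le_trans ?_ (Slow (E f))
  exact mul_le_mul_of_nonneg_left (Enorm f) (by positivity)
end

theorem SeqSys.nonuniv {Γ Z : Type} [NormedAddCommGroup Z] [NormedSpace ℝ Z] [CompleteSpace Z]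
    {lam lam' : ℝ} {g : ℕ → Z} (T : SeqSys Γ Z lam lam' g) (hl' : 1 < lam') (hll : lam' < lam)
    (h : ¬ Embeds CantorC (Submodule.span ℝ (Set.range g)).topologicalClosure) :
    ¬ Embeds CantorC (Ban T.NL) := fun hJ =>
  h (Embeds.trans' (three_space (Submodule.isClosed_topologicalClosure _)
    (T.c0freeMod hl' hll) hJ) (T.X'_embeds_X (by linarith)))


section Mazur
variable {K : Type*} [TopologicalSpace K] [CompactSpace K] [T2Space K]

open CompactlySupported in
/-- positive functionals satisfy dominated convergence -/
theorem pos_functional_dct (φ : C(K, ℝ) →L[ℝ] ℝ) (hφ : ∀ f : C(K, ℝ), (∀ q, 0 ≤ f q) → 0 ≤ φ f)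
    (G : ℕ → C(K, ℝ)) (B : ℝ) (hB : ∀ n q, |G n q| ≤ B)
    (h0 : ∀ q, Tendsto (fun n => G n q) atTop (𝓝 0)) :
    Tendsto (fun n => φ (G n)) atTop (𝓝 0) := by
  let _ : MeasurableSpace K := borel K
  have : BorelSpace K := ⟨rfl⟩
  let Λ : C_c(K, ℝ) →ₚ[ℝ] ℝ := PositiveLinearMap.mk₀
    { toFun := fun f => φ f.toContinuousMap
      map_add' := fun f g => by
        rw [← map_add]; rfl
      map_smul' := fun a f => by
        rw [RingHom.id_apply, ← map_smul]; rfl } (fun f hf => hφ _ (fun q => hf q))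
  have hi : ∀ f : C(K, ℝ), ∫ x, f x ∂(RealRMK.rieszMeasure Λ) = φ f := by
    intro f
    have := RealRMK.integral_rieszMeasure Λ (CompactlySupportedContinuousMap.continuousMapEquiv f)
    exact this
  have : IsFiniteMeasure (RealRMK.rieszMeasure Λ) := ⟨isCompact_univ.measure_lt_top⟩
  have := tendsto_integral_of_dominated_convergence (μ := RealRMK.rieszMeasure Λ)
    (F := fun n q => G n q) (f := fun _ => (0:ℝ)) (fun _ => B)
    (fun n => (G n).continuous.aestronglyMeasurable) (integrable_const _)
    (fun n => Eventually.of_forall (fun q => hB n q)) (Eventually.of_forall h0)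
  simpa [hi] using this

theorem mazur_null (g : ℕ → C(K, ℝ)) (B : ℝ) (hB : ∀ n q, |g n q| ≤ B)
    (h0 : ∀ q, Tendsto (fun n => g n q) atTop (𝓝 0)) (c : ℝ) (hc : 0 < c) :
    ∃ w : ℕ →₀ ℝ, (∀ i, 0 ≤ w i) ∧ Finsupp.linearCombination ℝ (fun _ : ℕ => (1:ℝ)) w = 1 ∧
      ‖Finsupp.linearCombination ℝ g w‖ ≤ c := by
  let Bs : Set C(K, ℝ) := {f | ∃ w : ℕ →₀ ℝ, (∀ i, 0 ≤ w i) ∧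
    Finsupp.linearCombination ℝ (fun _ : ℕ => (1:ℝ)) w = 1 ∧
    ∀ q, Finsupp.linearCombination ℝ (fun i => |g i q|) w ≤ f q}
  have hconv : Convex ℝ Bs := by
    rintro f1 ⟨w1, h1, h2, h3⟩ f2 ⟨w2, k1, k2, k3⟩ a b ha hb hab
    refine ⟨a • w1 + b • w2, fun i => ?_, ?_, fun q => ?_⟩
    · simp only [Finsupp.add_apply, Finsupp.smul_apply, smul_eq_mul]
      exact add_nonneg (mul_nonneg ha (h1 i)) (mul_nonneg hb (k1 i))
    · rw [map_add, map_smul, map_smul, h2, k2]; simpa using hab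
    · rw [map_add, map_smul, map_smul]
      simp only [ContinuousMap.add_apply, ContinuousMap.smul_apply, smul_eq_mul]
      exact add_le_add (mul_le_mul_of_nonneg_left (h3 q) ha) (mul_le_mul_of_nonneg_left (k3 q) hb)
  by_cases hd : Disjoint (Metric.ball (0 : C(K, ℝ)) c) Bs
  · exfalso
    obtain ⟨φ, u, h1, h2⟩ := geometric_hahn_banach_open (convex_ball _ _) Metric.isOpen_ball hconv hd
    have hu : 0 < u := by simpa using h1 0 (Metric.mem_ball_self hc)
    let G : ℕ → C(K, ℝ) := fun n => ⟨fun q => |g n q|, (g n).continuous.abs⟩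
    have hG : ∀ n, G n ∈ Bs := fun n => ⟨Finsupp.single n 1, fun i => by
      classical rw [Finsupp.single_apply]; split_ifs <;> norm_num, by simp, fun q => by
        rw [Finsupp.linearCombination_single]; simp [G]⟩
    have hpos : ∀ f : C(K, ℝ), (∀ q, 0 ≤ f q) → 0 ≤ φ f := by
      intro f hf
      by_contra hneg
      push Not at hneg
      have key : ∀ t : ℝ, 0 ≤ t → G 0 + t • f ∈ Bs := by
        intro t ht
        obtain ⟨w, a1, a2, a3⟩ := hG 0
        refine ⟨w, a1, a2, fun q => (a3 q).trans ?_⟩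
        simp only [ContinuousMap.add_apply, ContinuousMap.smul_apply, smul_eq_mul]
        have := mul_nonneg ht (hf q)
        linarith
      have h3 := h2 _ (key (|φ (G 0)| / (-φ f)) (div_nonneg (abs_nonneg _) (by linarith)))
      rw [map_add, map_smul, smul_eq_mul] at h3
      have h4 : |φ (G 0)| / (-φ f) * φ f = -|φ (G 0)| := by
        have : φ f ≠ 0 := hneg.ne
        field_simp
      rw [h4] at h3
      have := le_abs_self (φ (G 0))
      linarith
    have h3 := pos_functional_dct φ hpos G B (fun n q => by simpa [G] using hB n q)
      (fun q => by simpa [G] using (h0 q).abs)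
    obtain ⟨n, hn⟩ := (h3.eventually (gt_mem_nhds hu)).exists
    exact absurd (h2 _ (hG n)) (not_le.2 hn)
  · rw [Set.not_disjoint_iff] at hd
    obtain ⟨f, hf, w, h1, h2, h3⟩ := hd
    refine ⟨w, h1, h2, ?_⟩
    rw [ContinuousMap.norm_le _ hc.le]
    intro q
    have e : (Finsupp.linearCombination ℝ g w) q = Finsupp.linearCombination ℝ (fun i => g i q) w := by
      simp only [Finsupp.linearCombination_apply, Finsupp.sum, ContinuousMap.sum_apply,
        ContinuousMap.smul_apply]
    rw [e]
    have h4 : f q ≤ c := (le_abs_self _).trans ((f.norm_coe_le_norm q).trans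
      (by simpa using (mem_ball_zero_iff.1 hf).le))
    refine le_trans ?_ ((h3 q).trans h4)
    simp only [Finsupp.linearCombination_apply, Finsupp.sum, Real.norm_eq_abs, smul_eq_mul]
    refine (Finset.abs_sum_le_sum_abs _ _).trans (Finset.sum_le_sum fun i _ => ?_)
    rw [abs_mul, abs_of_nonneg (h1 i)]
end Mazur

theorem sign_choice {ι : Type*} (A : Finset ι) (a : ι → ι → ℝ) :
    ∃ θ : ι → ℝ, (∀ i, θ i = 1 ∨ θ i = -1) ∧
      ∑ i ∈ A, a i i ≤ ∑ i ∈ A, ∑ l ∈ A, θ i * θ l * a i l := by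
  classical
  induction A using Finset.induction_on with
  | empty => exact ⟨fun _ => 1, fun _ => Or.inl rfl, by simp⟩
  | insert b A hb ih =>
    obtain ⟨θ, h1, h2⟩ := ih
    let c := ∑ l ∈ A, θ l * (a b l + a l b)
    obtain ⟨t, ht, htc⟩ : ∃ t : ℝ, (t = 1 ∨ t = -1) ∧ 0 ≤ t * c := by
      rcases le_total 0 c with h | h
      · exact ⟨1, Or.inl rfl, by simpa using h⟩
      · exact ⟨-1, Or.inr rfl, by linarith⟩
    have htt : t * t = 1 := by rcases ht with rfl | rfl <;> norm_num
    refine ⟨Function.update θ b t, fun i => ?_, ?_⟩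
    · by_cases hi : i = b
      · subst hi; simpa using ht
      · simpa [Function.update_of_ne hi] using h1 i
    · have hu : ∀ l ∈ A, Function.update θ b t l = θ l := fun l hl =>
        Function.update_of_ne (ne_of_mem_of_not_mem hl hb) _ _
      rw [Finset.sum_insert hb, Finset.sum_insert hb]
      have e1 : ∑ l ∈ insert b A, Function.update θ b t b * Function.update θ b t l * a b l
          = a b b + t * ∑ l ∈ A, θ l * a b l := by
        rw [Finset.sum_insert hb, Function.update_self, htt, one_mul, Finset.mul_sum]
        congr 1
        exact Finset.sum_congr rfl fun l hl => by rw [hu l hl]; ring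
      have e2 : ∑ i ∈ A, ∑ l ∈ insert b A, Function.update θ b t i * Function.update θ b t l * a i l
          = t * ∑ i ∈ A, θ i * a i b + ∑ i ∈ A, ∑ l ∈ A, θ i * θ l * a i l := by
        rw [Finset.mul_sum, ← Finset.sum_add_distrib]
        refine Finset.sum_congr rfl fun i hi => ?_
        rw [Finset.sum_insert hb, Function.update_self, hu i hi]
        congr 1
        · ring
        · exact Finset.sum_congr rfl fun l hl => by rw [hu l hl]
      have e3 : t * c = t * ∑ l ∈ A, θ l * a b l + t * ∑ i ∈ A, θ i * a i b := by
        simp only [c, mul_add, Finset.sum_add_distrib]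
      rw [e1, e2]
      linarith



theorem exists_sep {Λ : Type} (A : Finset (ℕ → Λ)) :
    ∃ N, ∀ x ∈ A, ∀ y ∈ A, pre x N = pre y N → x = y := by
  classical
  have h : ∀ p : (ℕ → Λ) × (ℕ → Λ), ∃ n, pre p.1 n = pre p.2 n → p.1 = p.2 := by
    intro p
    by_cases hp : p.1 = p.2
    · exact ⟨0, fun _ => hp⟩
    · obtain ⟨i, hi⟩ := Function.ne_iff.1 hp
      exact ⟨i+1, fun h => absurd (pre_eq_iff.1 h i (Nat.lt_succ_self i)) hi⟩
  choose n hn using h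
  refine ⟨(A ×ˢ A).sup n, fun x hx y hy e => hn (x, y) (pre_mono ?_ e)⟩
  exact Finset.le_sup (f := n) (Finset.mk_mem_product hx hy)

/-- indicator of the basic neighbourhood -/
noncomputable abbrev hh (x : CantorSet) (n : ℕ) : CantorC := ind (cyl (pre x n))

theorem mem_cyl_self (x : CantorSet) (n) : x ∈ cyl (pre x n) := mem_cyl_pre.2 fun _ _ => rfl

theorem norm_hh_sum {ι : Type*} (A : Finset ι) (x : ι → CantorSet) {N : ℕ}
    (hN : ∀ i ∈ A, ∀ j ∈ A, pre (x i) N = pre (x j) N → i = j) (n : ι → ℕ) (hn : ∀ i, N ≤ n i)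
    (θ : ι → ℝ) (hθ : ∀ i, |θ i| ≤ 1) : ‖∑ i ∈ A, θ i • hh (x i) (n i)‖ ≤ 1 := by
  refine norm_disj_sum A _ 1 zero_le_one ?_ ?_
  · intro k _ y
    simp only [ContinuousMap.smul_apply, smul_eq_mul, abs_mul]
    exact mul_le_one₀ (hθ k) (abs_nonneg _) (abs_ind_le _ _)
  · intro y i hi j hj h1 h2
    have h1' : y ∈ cyl (pre (x i) (n i)) := by
      by_contra h; exact h1 (by simp [ind_not_mem h])
    have h2' : y ∈ cyl (pre (x j) (n j)) := by
      by_contra h; exact h2 (by simp [ind_not_mem h])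
    rw [mem_cyl_pre] at h1' h2'
    refine hN i hi j hj (pre_eq_iff.2 fun k hk => ?_)
    rw [← h1' k (hk.trans_le (hn i)), ← h2' k (hk.trans_le (hn j))]

theorem atoms_finite (m : CantorC →L[ℝ] ℝ) {ε : ℝ} (hε : 0 < ε) :
    {x : CantorSet | ∃ᶠ n in atTop, ε ≤ |m (hh x n)|}.Finite := by
  by_contra hinf
  obtain ⟨k, hk⟩ := exists_nat_gt (‖m‖ / ε)
  obtain ⟨A, hA, hAk⟩ := Set.Infinite.exists_subset_card_eq hinf k
  obtain ⟨N, hN⟩ := exists_sep A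
  have h1 : ∀ x : CantorSet, ∃ n, N ≤ n ∧ (x ∈ A → ε ≤ |m (hh x n)|) := by
    intro x
    by_cases hx : x ∈ A
    · obtain ⟨n, hn, hn'⟩ := frequently_atTop.1 (hA hx) N
      exact ⟨n, hn, fun _ => hn'⟩
    · exact ⟨N, le_rfl, fun h => absurd h hx⟩
  choose n hn hn' using h1
  have h2 : ∀ x : CantorSet, ∃ θ : ℝ, |θ| ≤ 1 ∧ θ * m (hh x (n x)) = |m (hh x (n x))| := by
    intro x
    rcases le_total 0 (m (hh x (n x))) with h | h
    · exact ⟨1, by simp, by rw [abs_of_nonneg h, one_mul]⟩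
    · exact ⟨-1, by simp, by rw [abs_of_nonpos h]; ring⟩
  choose θ hθ hθ' using h2
  have h3 := norm_hh_sum A id (fun i hi j hj e => hN i hi j hj e) n hn θ hθ
  have h4 : m (∑ i ∈ A, θ i • hh (id i) (n i)) = ∑ i ∈ A, |m (hh i (n i))| := by
    rw [map_sum]
    exact Finset.sum_congr rfl fun x _ => by rw [map_smul, smul_eq_mul, id, hθ']
  have h5 : (k : ℝ) * ε ≤ ∑ i ∈ A, |m (hh i (n i))| := by
    rw [← hAk, ← nsmul_eq_mul]
    exact Finset.card_nsmul_le_sum _ _ _ fun x hx => hn' x hx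
  have h6 : m (∑ i ∈ A, θ i • hh (id i) (n i)) ≤ ‖m‖ :=
    (le_abs_self _).trans ((m.le_opNorm _).trans (mul_le_of_le_one_right (norm_nonneg _) h3))
  rw [div_lt_iff₀ hε] at hk
  linarith

theorem atoms_countable (m : CantorC →L[ℝ] ℝ) :
    {x : CantorSet | ¬ Tendsto (fun n => m (hh x n)) atTop (𝓝 0)}.Countable := by
  refine (Set.countable_iUnion fun i : ℕ =>
    (atoms_finite m (ε := 1 / ((i:ℝ) + 1)) (by positivity)).countable).mono ?_
  intro x hx
  rw [Set.mem_ofPred_eq, Metric.tendsto_atTop] at hx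
  push Not at hx
  obtain ⟨ε, hε, h⟩ := hx
  obtain ⟨i, hi⟩ := exists_nat_one_div_lt hε
  refine Set.mem_iUnion.2 ⟨i, frequently_atTop.2 fun N => ?_⟩
  obtain ⟨n, hn, hn'⟩ := h N
  rw [Real.dist_eq, sub_zero] at hn'
  exact ⟨n, hn, by linarith⟩

theorem small_annulus (m : CantorC →L[ℝ] ℝ) (x : CantorSet) {η : ℝ} (hη : 0 < η) :
    ∃ N, ∀ f : CantorC, (∀ y, y ∉ cyl (pre x N) → f y = 0) →
      (∃ M, ∀ y ∈ cyl (pre x M), f y = 0) → |m f| ≤ η * ‖f‖ := by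
  let D : Set CantorC := {f | ‖f‖ ≤ 1 ∧ ∃ M, ∀ y ∈ cyl (pre x M), f y = 0}
  have bdd : BddAbove (m '' D) := by
    refine ⟨‖m‖, ?_⟩
    rintro _ ⟨f, hf, rfl⟩
    exact (le_abs_self _).trans ((m.le_opNorm _).trans
      (mul_le_of_le_one_right (norm_nonneg _) hf.1))
  have ne : (m '' D).Nonempty := ⟨_, 0, ⟨by simp, 0, fun _ _ => rfl⟩, rfl⟩
  obtain ⟨_, ⟨f0, ⟨hf0, M0, hM0⟩, rfl⟩, h0⟩ := exists_lt_of_lt_csSup ne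
    (show sSup (m '' D) - η < sSup (m '' D) by linarith)
  have key : ∀ f : CantorC, ‖f‖ ≤ 1 → (∀ y, y ∉ cyl (pre x M0) → f y = 0) →
      (∃ M, ∀ y ∈ cyl (pre x M), f y = 0) → m f ≤ η := by
    intro f hf h1 ⟨M, hM⟩
    have : f0 + f ∈ D := by
      refine ⟨?_, max M M0, fun y hy => ?_⟩
      · rw [ContinuousMap.norm_le _ zero_le_one]
        intro y
        rw [ContinuousMap.add_apply]
        by_cases hy : y ∈ cyl (pre x M0)
        · rw [hM0 y hy, zero_add]; exact (f.norm_coe_le_norm y).trans hf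
        · rw [h1 y hy, add_zero]; exact (f0.norm_coe_le_norm y).trans hf0
      · have h2 : y ∈ cyl (pre x M) := mem_cyl_pre.2 fun i hi =>
          mem_cyl_pre.1 hy i (hi.trans_le (le_max_left _ _))
        have h3 : y ∈ cyl (pre x M0) := mem_cyl_pre.2 fun i hi =>
          mem_cyl_pre.1 hy i (hi.trans_le (le_max_right _ _))
        rw [ContinuousMap.add_apply, hM y h2, hM0 y h3, add_zero]
    have := le_csSup bdd ⟨_, this, rfl⟩
    rw [map_add] at this
    linarith
  refine ⟨M0, fun f h1 ⟨M, hM⟩ => ?_⟩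
  by_cases hf : ‖f‖ = 0
  · rw [norm_eq_zero.1 hf]; simp
  have hpos : 0 < ‖f‖ := lt_of_le_of_ne (norm_nonneg _) (Ne.symm hf)
  have k1 : ∀ s : ℝ, |s| ≤ ‖f‖⁻¹ → m (s • f) ≤ η := fun s hs => by
    refine key (s • f) ?_ (fun y hy => by simp [h1 y hy]) ⟨M, fun y hy => by simp [hM y hy]⟩
    rw [norm_smul, Real.norm_eq_abs]
    calc _ ≤ ‖f‖⁻¹ * ‖f‖ := by gcongr
      _ = 1 := inv_mul_cancel₀ hf
  have a1 := k1 ‖f‖⁻¹ (by rw [abs_of_pos (inv_pos.2 hpos)])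
  have a2 := k1 (-‖f‖⁻¹) (by rw [abs_neg, abs_of_pos (inv_pos.2 hpos)])
  rw [map_smul, smul_eq_mul, inv_mul_le_iff₀ hpos] at a1
  rw [neg_smul, map_neg, map_smul, smul_eq_mul, ← mul_neg, inv_mul_le_iff₀ hpos] at a2
  rw [abs_le]
  constructor <;> linarith

theorem atom_lower (m : CantorC →L[ℝ] ℝ) (x : CantorSet) {ε η : ℝ} (hη : 0 < η)
    (hx : ∃ᶠ n in atTop, ε ≤ |m (hh x n)|) :
    ∃ N, ∀ f : CantorC, (∀ y, y ∉ cyl (pre x N) → f y = 0) →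
      ε * |f x| - η * ‖f‖ ≤ |m f| := by
  obtain ⟨N, hN⟩ := small_annulus m x hη
  refine ⟨N, fun f hf => ?_⟩
  refine le_of_forall_pos_le_add fun τ hτ => ?_
  obtain ⟨δ, hδ, hδτ⟩ : ∃ δ > 0, ‖m‖ * δ ≤ τ := by
    refine ⟨τ / (‖m‖ + 1), by positivity, ?_⟩
    rw [mul_div_assoc', div_le_iff₀ (by positivity)]
    nlinarith [norm_nonneg m]
  obtain ⟨n0, hn0⟩ := exists_cyl (U := {y | |f y - f x| < δ})
    (isOpen_lt ((f.continuous.sub continuous_const).abs) continuous_const)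
    (x := x) (by simpa using hδ)
  obtain ⟨n, hn, hne⟩ := frequently_atTop.1 hx n0
  let f1 : CantorC := (f - f x • 1) * hh x n
  let f2 : CantorC := f * (1 - hh x n)
  have e : f = f x • hh x n + f1 + f2 := by
    ext y
    simp only [f1, f2, ContinuousMap.add_apply, ContinuousMap.smul_apply, ContinuousMap.mul_apply,
      ContinuousMap.sub_apply, ContinuousMap.one_apply, smul_eq_mul]
    ring
  have b1 : |m f1| ≤ τ := by
    refine (m.le_opNorm f1).trans (le_trans ?_ hδτ)
    gcongr
    rw [ContinuousMap.norm_le _ hδ.le]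
    intro y
    change ‖(f y - f x * 1) * hh x n y‖ ≤ δ
    by_cases hy : y ∈ cyl (pre x n)
    · rw [hh, ind_mem hy, mul_one, mul_one]
      exact (hn0 y (mem_cyl_pre.2 fun i hi => mem_cyl_pre.1 hy i (hi.trans_le hn))).le
    · rw [hh, ind_not_mem hy, mul_zero, norm_zero]; exact hδ.le
  have nf2 : ‖f2‖ ≤ ‖f‖ := by
    rw [ContinuousMap.norm_le _ (norm_nonneg _)]
    intro y
    change ‖f y * (1 - hh x n y)‖ ≤ _
    by_cases hy : y ∈ cyl (pre x n)
    · rw [hh, ind_mem hy, sub_self, mul_zero, norm_zero]; exact norm_nonneg _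
    · rw [hh, ind_not_mem hy, sub_zero, mul_one]; exact f.norm_coe_le_norm y
  have b2 : |m f2| ≤ η * ‖f‖ := by
    refine (hN f2 (fun y hy => ?_) ⟨n, fun y hy => ?_⟩).trans (by gcongr)
    · change f y * _ = 0
      rw [hf y hy, zero_mul]
    · change f y * (1 - hh x n y) = 0
      rw [hh, ind_mem hy, sub_self, mul_zero]
  have e2 : m f = f x * m (hh x n) + m f1 + m f2 := by
    conv_lhs => rw [e]
    rw [map_add, map_add, map_smul, smul_eq_mul]
  have b3 : ε * |f x| ≤ |f x * m (hh x n)| := by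
    rw [abs_mul, mul_comm]
    gcongr
  have b4 : |f x * m (hh x n)| ≤ |m f| + |m f1| + |m f2| := by
    have : f x * m (hh x n) = m f - m f1 - m f2 := by rw [e2]; ring
    rw [this]
    exact (abs_sub _ _).trans (add_le_add_left (abs_sub _ _) _)
  linarith

theorem split_uncountable {B : Set CantorSet} (hB : ¬ B.Countable) :
    ∃ W : TopologicalSpace.Clopens CantorSet, ¬ (B ∩ W).Countable ∧ ¬ (B \ W).Countable := by
  by_contra hcon
  push Not at hcon
  let C1 : Set CantorSet := ⋃ s : {s : List Bool // (B ∩ cyl s).Countable}, B ∩ cyl s.1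
  let C2 : Set CantorSet := ⋃ s : {s : List Bool // (B \ cyl s).Countable}, B \ cyl s.1
  have c1 : C1.Countable := Set.countable_iUnion fun s => s.2
  have c2 : C2.Countable := Set.countable_iUnion fun s => s.2
  have hB' : ¬ (B \ (C1 ∪ C2)).Countable := fun h => hB (by
    refine (h.union (c1.union c2)).mono ?_
    intro x hx
    by_cases h : x ∈ C1 ∪ C2
    · exact Or.inr h
    · exact Or.inl ⟨hx, h⟩)
  have : ¬ (B \ (C1 ∪ C2)).Subsingleton := fun h => hB' h.countable
  rw [Set.not_subsingleton_iff] at this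
  obtain ⟨x, hx, y, hy, hxy⟩ := this
  obtain ⟨i, hi⟩ := Function.ne_iff.1 hxy
  have hxs : x ∈ cyl (pre x (i+1)) := mem_cyl_self _ _
  have hys : y ∉ cyl (pre x (i+1)) := fun h => hi (mem_cyl_pre.1 h i (Nat.lt_succ_self i)).symm
  have h1 : ¬ (B ∩ cyl (pre x (i+1))).Countable := fun h =>
    hx.2 (Or.inl (Set.mem_iUnion.2 ⟨⟨_, h⟩, hx.1, hxs⟩))
  have h2 := hcon _ h1
  exact hy.2 (Or.inr (Set.mem_iUnion.2 ⟨⟨_, h2⟩, hy.1, hys⟩))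

theorem exists_rho_dense {A : Set CantorSet} (hA : ¬ A.Countable) :
    ∃ ρ : C(CantorSet, CantorSet), ∀ s, ∃ x ∈ A, ρ x ∈ cyl s := by
  classical
  have hstep : ∀ U : TopologicalSpace.Clopens CantorSet, ∃ W : TopologicalSpace.Clopens CantorSet,
      W ≤ U ∧ (¬ (A ∩ U).Countable → ¬ (A ∩ W).Countable ∧ ¬ (A ∩ (U \ W : TopologicalSpace.Clopens CantorSet)).Countable) := by
    intro U
    by_cases hU : (A ∩ U).Countable
    · exact ⟨U, le_rfl, fun h => absurd hU h⟩
    · obtain ⟨W, h1, h2⟩ := split_uncountable hU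
      refine ⟨U ⊓ W, inf_le_left, fun _ => ⟨?_, ?_⟩⟩
      · refine fun h => h1 (h.mono ?_)
        rintro x ⟨⟨a, b⟩, c⟩; exact ⟨a, b, c⟩
      · refine fun h => h2 (h.mono ?_)
        rintro x ⟨⟨a, b⟩, c⟩; exact ⟨a, b, fun h => c h.2⟩
  choose W hW1 hW2 using hstep
  obtain ⟨U, U0, U1, U2⟩ : ∃ U : List Bool → TopologicalSpace.Clopens CantorSet, U [] = ⊤ ∧
      (∀ t, U (true :: t) = W (U t)) ∧ ∀ t, U (false :: t) = U t \ U (true :: t) := by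
    refine ⟨fun s => List.rec ⊤ (fun b _ V => if b then W V else V \ W V) s, rfl,
      fun t => rfl, fun t => rfl⟩
  have Une : ∀ t, ¬ (A ∩ U t).Countable := by
    intro t
    induction t with
    | nil =>
      rw [U0]
      intro h
      refine hA (h.mono fun x hx => ?_)
      exact ⟨hx, trivial⟩
    | cons b t ih =>
      cases b
      · rw [U2, U1]; exact (hW2 _ ih).2
      · rw [U1]; exact (hW2 _ ih).1
  obtain ⟨ρ, hρ⟩ := exists_rho U U0 U2 (fun t => by rw [U1]; exact hW1 _)
  refine ⟨ρ, fun s => ?_⟩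
  have : (A ∩ U s).Nonempty := by
    by_contra h
    rw [Set.not_nonempty_iff_eq_empty] at h
    exact Une s (by rw [h]; exact Set.countable_empty)
  obtain ⟨x, hx, hxs⟩ := this
  exact ⟨x, hx, (hρ x s).1 hxs⟩

theorem rosenthal_atoms {L : Type*} [NormedAddCommGroup L] [NormedSpace ℝ L] (U : CantorC →L[ℝ] L)
    {ε : ℝ} (hε : 0 < ε) {A : Set CantorSet} (hA : ¬ A.Countable)
    (h : ∀ x ∈ A, ∃ m : CantorC →L[ℝ] ℝ, (∀ f, |m f| ≤ ‖U f‖) ∧ ∃ᶠ n in atTop, ε ≤ |m (hh x n)|) :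
    Embeds CantorC L := by
  have h1 : ∀ x : A, ∃ N, ∀ f : CantorC, (∀ y, y ∉ cyl (pre x.1 N) → f y = 0) →
      ε * |f x| - ε / 4 * ‖f‖ ≤ ‖U f‖ := by
    intro x
    obtain ⟨m, hm1, hm2⟩ := h x x.2
    obtain ⟨N, hN⟩ := atom_lower m x (η := ε / 4) (by positivity) hm2
    exact ⟨N, fun f hf => (hN f hf).trans (hm1 f)⟩
  choose N hN using h1
  obtain ⟨s, hs⟩ : ∃ s : List Bool, ¬ (Subtype.val '' {x : A | pre x.1 (N x) = s}).Countable := by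
    by_contra hcon
    push Not at hcon
    refine hA ((Set.countable_iUnion hcon).mono fun x hx => ?_)
    exact Set.mem_iUnion.2 ⟨_, ⟨⟨x, hx⟩, rfl, rfl⟩⟩
  obtain ⟨ρ, hρ⟩ := exists_rho_dense hs
  let E : CantorC →L[ℝ] CantorC :=
    (ContinuousLinearMap.mul ℝ CantorC (ind (cyl s))).comp (compL ρ)
  have hE : ∀ f x, E f x = ind (cyl s) x * f (ρ x) := fun f x => rfl
  have nE : ∀ f, ‖E f‖ ≤ ‖f‖ := by
    intro f
    rw [ContinuousMap.norm_le _ (norm_nonneg _)]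
    intro y
    rw [hE, norm_mul]
    refine (mul_le_of_le_one_left (norm_nonneg _) (abs_ind_le _ _)).trans (f.norm_coe_le_norm _)
  refine ⟨U.comp E, ε / 2, by positivity, fun f => ?_⟩
  change _ ≤ ‖U (E f)‖
  have key : ∀ y, ε * |f y| ≤ ‖U (E f)‖ + ε / 4 * ‖f‖ := by
    intro y
    by_contra hcon
    push Not at hcon
    have hop : IsOpen {z | ‖U (E f)‖ + ε / 4 * ‖f‖ < ε * |f z|} :=
      isOpen_lt continuous_const (continuous_const.mul f.continuous.abs)
    obtain ⟨n, hn⟩ := exists_cyl hop hcon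
    obtain ⟨_, ⟨x, hx, rfl⟩, hx2⟩ := hρ (pre y n)
    have h2 := hn _ hx2
    have hx' : pre x.1 (N x) = s := hx
    have h3 := hN x (E f) (fun z hz => by rw [hE, ind_not_mem (by rwa [hx'] at hz), zero_mul])
    rw [hE, ind_mem (by rw [← hx']; exact mem_cyl_self _ _), one_mul] at h3
    have h4 := nE f
    rw [Set.mem_ofPred_eq] at h2
    nlinarith
  have : ‖f‖ ≤ (‖U (E f)‖ + ε / 4 * ‖f‖) / ε := by
    rw [ContinuousMap.norm_le _ (by positivity)]
    intro y
    rw [le_div_iff₀ hε, mul_comm]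
    exact key y
  rw [le_div_iff₀ hε] at this
  nlinarith [norm_nonneg f]


/-- pairing -/
noncomputable abbrev pr {Γ : Type} (k : Γ → ℝ) (x : Γ →₀ ℝ) : ℝ := Finsupp.linearCombination ℝ k x

theorem pr_apply {Γ : Type} (k : Γ → ℝ) (x : Γ →₀ ℝ) : pr k x = ∑ γ ∈ x.support, x γ * k γ := by
  rw [pr, Finsupp.linearCombination_apply, Finsupp.sum]; simp only [smul_eq_mul]

theorem continuous_pr {Γ : Type} (x : Γ →₀ ℝ) : Continuous fun k : Γ → ℝ => pr k x := by
  simp only [pr_apply]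
  fun_prop

theorem pr_smul {Γ : Type} (c : ℝ) (k : Γ → ℝ) (x : Γ →₀ ℝ) : pr (fun γ => c * k γ) x = c * pr k x := by
  simp only [pr_apply, Finset.mul_sum]
  exact Finset.sum_congr rfl fun γ _ => by ring

theorem pr_sum {Γ ι : Type} (A : Finset ι) (k : ι → Γ → ℝ) (x : Γ →₀ ℝ) :
    pr (fun γ => ∑ i ∈ A, k i γ) x = ∑ i ∈ A, pr (k i) x := by
  simp only [pr_apply, Finset.mul_sum]
  exact Finset.sum_comm

theorem pr_congr {Γ : Type} {k k' : Γ → ℝ} {x x' : Γ →₀ ℝ} (h : ∀ γ, x γ * k γ = x' γ * k' γ) :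
    pr k x = pr k' x' := by
  classical
  have e : ∀ (k : Γ → ℝ) (x : Γ →₀ ℝ) (A : Finset Γ), x.support ⊆ A → pr k x = ∑ γ ∈ A, x γ * k γ := by
    intro k x A hA
    rw [pr_apply]
    refine Finset.sum_subset hA fun γ _ h => ?_
    rw [Finsupp.notMem_support_iff.1 h, zero_mul]
  rw [e k x (x.support ∪ x'.support) Finset.subset_union_left,
    e k' x' (x.support ∪ x'.support) Finset.subset_union_right]
  exact Finset.sum_congr rfl fun γ _ => h γ

/-- prefixes of members of `G` -/
def Node {Λ : Type} (G : Set (ℕ → Λ)) : Set (List Λ) := {s | ∃ σ ∈ G, ∃ n, s = pre σ n}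

def cmpb {Λ : Type} (a b : List Λ) : Prop := a <:+ b ∨ b <:+ a

theorem cmpb_refl {Λ : Type} (a : List Λ) : cmpb a a := Or.inl List.suffix_rfl

theorem suffix_pre {Λ : Type} {σ : ℕ → Λ} {n} {r : List Λ} (h : r <:+ pre σ n) :
    r.length ≤ n ∧ r = pre σ r.length := by
  have h1 : r.length ≤ n := by simpa [pre_length] using h.length_le
  refine ⟨h1, ?_⟩
  have h2 := List.suffix_of_suffix_length_le h (pre_suffix σ h1) (by rw [pre_length])
  exact h2.eq_of_length (by rw [pre_length])

theorem Node.suffix {Λ : Type} {G : Set (ℕ → Λ)} {r s : List Λ} (h : r <:+ s) (hs : s ∈ Node G) :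
    r ∈ Node G := by
  obtain ⟨σ, hσ, n, rfl⟩ := hs
  exact ⟨σ, hσ, _, (suffix_pre h).2⟩

theorem cmpb_of_suffix {Λ : Type} {a b s : List Λ} (h1 : a <:+ s) (h2 : b <:+ s) : cmpb a b :=
  List.suffix_or_suffix_of_suffix h1 h2

namespace TreeSys
variable {Λ Z : Type} [NormedAddCommGroup Z] [NormedSpace ℝ Z] {lam lam' : ℝ}
    {g : Λ → Z} (T : TreeSys Λ Z lam lam' g) (G : Set (ℕ → Λ))

def SS : Set (List Λ × ℕ → ℝ) :=
  {k | (∀ γ : List Λ × ℕ, ¬ (γ.1 ∈ Node G ∧ γ ∈ (T.st γ.1).S) → k γ = 0) ∧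
    (∀ γ γ' : List Λ × ℕ, ¬ cmpb γ.1 γ'.1 → k γ * k γ' = 0) ∧
    ∀ s ∈ Node G, ∀ x ∈ (T.st s).VS, |pr k x| ≤ (T.st s).N x}

def KK (j : ℕ) : Set (List Λ × ℕ → ℝ) :=
  {q | ∃ k : Fin (4 ^ j) → List Λ × ℕ → ℝ, (∀ i, k i ∈ T.SS G) ∧
    (∀ i l, i ≠ l → ∀ γ γ' : List Λ × ℕ, cmpb γ.1 γ'.1 → k i γ * k l γ' = 0) ∧
    q = fun γ => ((2:ℝ) ^ j)⁻¹ * ∑ i, k i γ}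

def KA : Set (List Λ × ℕ → ℝ) := {0} ∪ ⋃ j, T.KK G j

variable {T G}

theorem SS_zero : (0 : List Λ × ℕ → ℝ) ∈ T.SS G := by
  refine ⟨fun _ _ => rfl, fun _ _ _ => by simp, fun s _ x _ => ?_⟩
  rw [pr_apply]; simp

theorem SS_smul {k} (hk : k ∈ T.SS G) {c : ℝ} (hc : |c| ≤ 1) : (fun γ => c * k γ) ∈ T.SS G := by
  refine ⟨fun γ h => by change c * k γ = 0; rw [hk.1 γ h, mul_zero], fun γ γ' h => ?_, fun s hs x hx => ?_⟩
  · change c * k γ * (c * k γ') = 0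
    rw [mul_mul_mul_comm, hk.2.1 γ γ' h, mul_zero]
  · rw [pr_smul, abs_mul]
    exact (mul_le_of_le_one_left (abs_nonneg _) hc).trans (hk.2.2 s hs x hx)

theorem SS_bound {k} (hk : k ∈ T.SS G) (γ) : |k γ| ≤ (T.st γ.1).N (Finsupp.single γ 1) := by
  by_cases h : γ.1 ∈ Node G ∧ γ ∈ (T.st γ.1).S
  · have h1 := hk.2.2 γ.1 h.1 (Finsupp.single γ 1) (Finsupp.single_mem_supported ℝ 1 h.2)
    simpa [pr] using h1
  · rw [hk.1 γ h, abs_zero]; exact apply_nonneg _ _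

theorem isClosed_SS : IsClosed (T.SS G) := by
  have : T.SS G = (⋂ γ : List Λ × ℕ, {k | ¬ (γ.1 ∈ Node G ∧ γ ∈ (T.st γ.1).S) → k γ = 0}) ∩
      ((⋂ γ : List Λ × ℕ, ⋂ γ' : List Λ × ℕ, {k | ¬ cmpb γ.1 γ'.1 → k γ * k γ' = 0}) ∩
      ⋂ s : List Λ, ⋂ x : List Λ × ℕ →₀ ℝ,
        {k | s ∈ Node G → x ∈ (T.st s).VS → |pr k x| ≤ (T.st s).N x}) := by
    ext k
    simp only [SS, Set.mem_inter_iff, Set.mem_iInter, Set.mem_ofPred_eq]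
    exact ⟨fun h => ⟨h.1, h.2.1, fun s x hs hx => h.2.2 s hs x hx⟩,
      fun h => ⟨h.1, h.2.1, fun s hs x hx => h.2.2 s x hs hx⟩⟩
  rw [this]
  refine IsClosed.inter (isClosed_iInter fun γ => ?_) (IsClosed.inter (isClosed_iInter fun γ =>
    isClosed_iInter fun γ' => ?_) (isClosed_iInter fun s => isClosed_iInter fun x => ?_))
  · refine isClosed_imp isOpen_const ?_
    exact isClosed_eq (continuous_apply γ) continuous_const
  · refine isClosed_imp isOpen_const ?_
    exact isClosed_eq ((continuous_apply γ).mul (continuous_apply γ')) continuous_const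
  · refine isClosed_imp isOpen_const (isClosed_imp isOpen_const ?_)
    exact isClosed_le (continuous_pr x).abs continuous_const

theorem isCompact_SS : IsCompact (T.SS G) := by
  refine (isCompact_univ_pi (fun γ : List Λ × ℕ => isCompact_Icc
    (a := -(T.st γ.1).N (Finsupp.single γ 1)) (b := (T.st γ.1).N (Finsupp.single γ 1)))).of_isClosed_subset
    isClosed_SS ?_
  intro k hk γ _
  exact abs_le.1 (SS_bound hk γ)

theorem isCompact_KK (j : ℕ) : IsCompact (T.KK G j) := by
  let P : Set (Fin (4 ^ j) → List Λ × ℕ → ℝ) := {k | (∀ i, k i ∈ T.SS G) ∧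
    (∀ i l, i ≠ l → ∀ γ γ' : List Λ × ℕ, cmpb γ.1 γ'.1 → k i γ * k l γ' = 0)}
  have hP : IsCompact P := by
    refine (isCompact_univ_pi (fun _ : Fin (4 ^ j) => isCompact_SS (T := T) (G := G))).of_isClosed_subset
      ?_ (fun k hk i _ => hk.1 i)
    have : P = (⋂ i, {k | k i ∈ T.SS G}) ∩ ⋂ i, ⋂ l, ⋂ γ : List Λ × ℕ, ⋂ γ' : List Λ × ℕ,
        {k | i ≠ l → cmpb γ.1 γ'.1 → k i γ * k l γ' = 0} := by
      ext k
      simp only [P, Set.mem_inter_iff, Set.mem_iInter, Set.mem_ofPred_eq]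
      exact ⟨fun h => ⟨h.1, fun i l γ γ' a b => h.2 i l a γ γ' b⟩,
        fun h => ⟨h.1, fun i l a γ γ' b => h.2 i l γ γ' a b⟩⟩
    rw [this]
    refine IsClosed.inter (isClosed_iInter fun i => isClosed_SS.preimage (continuous_apply i))
      (isClosed_iInter fun i => isClosed_iInter fun l => isClosed_iInter fun γ =>
        isClosed_iInter fun γ' => ?_)
    refine isClosed_imp isOpen_const (isClosed_imp isOpen_const ?_)
    exact isClosed_eq (by fun_prop) continuous_const
  have : T.KK G j = (fun k : Fin (4 ^ j) → List Λ × ℕ → ℝ =>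
      fun γ => ((2:ℝ) ^ j)⁻¹ * ∑ i, k i γ) '' P := by
    ext q
    constructor
    · rintro ⟨k, h1, h2, rfl⟩; exact ⟨k, ⟨h1, h2⟩, rfl⟩
    · rintro ⟨k, ⟨h1, h2⟩, rfl⟩; exact ⟨k, h1, h2, rfl⟩
  rw [this]
  exact hP.image (by fun_prop)

theorem sum_one_nonzero {ι : Type*} [Fintype ι] (a : ι → ℝ) (h : ∀ i l, i ≠ l → a i * a l = 0) {B : ℝ}
    (hB : ∀ i, |a i| ≤ B) (hB0 : 0 ≤ B) : |∑ i, a i| ≤ B := by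
  by_cases h0 : ∃ i, a i ≠ 0
  · obtain ⟨i, hi⟩ := h0
    rw [Finset.sum_eq_single i]
    · exact hB i
    · intro l _ hl
      rcases mul_eq_zero.1 (h i l hl.symm) with h | h
      · exact absurd h hi
      · exact h
    · simp
  · push Not at h0
    simp [h0, hB0]

theorem KK_bound {j q} (hq : q ∈ T.KK G j) (γ) :
    |q γ| ≤ ((2:ℝ) ^ j)⁻¹ * (T.st γ.1).N (Finsupp.single γ 1) := by
  obtain ⟨k, h1, h2, rfl⟩ := hq
  rw [abs_mul, abs_of_pos (show (0:ℝ) < ((2:ℝ) ^ j)⁻¹ by positivity)]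
  gcongr
  exact sum_one_nonzero _ (fun i l h => h2 i l h γ γ (cmpb_refl _)) (fun i => SS_bound (h1 i) γ)
    (apply_nonneg _ _)

theorem isCompact_KA : IsCompact (T.KA G) := by
  have hb : ∀ q ∈ T.KA G, ∀ γ, |q γ| ≤ (T.st γ.1).N (Finsupp.single γ 1) := by
    intro q hq γ
    rcases hq with hq | hq
    · rw [Set.mem_singleton_iff.1 hq]; simp
    · obtain ⟨j, hj⟩ := Set.mem_iUnion.1 hq
      refine (KK_bound hj γ).trans (mul_le_of_le_one_left (apply_nonneg _ _) ?_)
      exact inv_le_one_of_one_le₀ (one_le_pow₀ one_le_two)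
  refine (isCompact_univ_pi (fun γ : List Λ × ℕ => isCompact_Icc
    (a := -(T.st γ.1).N (Finsupp.single γ 1)) (b := (T.st γ.1).N (Finsupp.single γ 1)))).of_isClosed_subset
    ?_ (fun k hk γ _ => abs_le.1 (hb k hk γ))
  rw [← isOpen_compl_iff, isOpen_iff_mem_nhds]
  intro q hq
  have hq0 : q ≠ 0 := fun h => hq (Or.inl h)
  obtain ⟨γ, hγ⟩ := Function.ne_iff.1 hq0
  have hγ' : 0 < |q γ| := abs_pos.2 hγ
  obtain ⟨j0, hj0⟩ : ∃ j0 : ℕ, ∀ j, j0 ≤ j → ((2:ℝ) ^ j)⁻¹ * (T.st γ.1).N (Finsupp.single γ 1) < |q γ| / 2 := by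
    have h1 : Tendsto (fun j : ℕ => ((2:ℝ) ^ j)⁻¹ * (T.st γ.1).N (Finsupp.single γ 1)) atTop (𝓝 0) := by
      have := (tendsto_pow_atTop_nhds_zero_of_lt_one (r := (2:ℝ)⁻¹) (by norm_num) (by norm_num)).mul_const
        ((T.st γ.1).N (Finsupp.single γ 1))
      simpa using this
    exact eventually_atTop.1 (h1.eventually (gt_mem_nhds (half_pos hγ')))
  have hcl : IsClosed (⋃ j ∈ Finset.range j0, T.KK G j) :=
    isClosed_biUnion_finset fun j _ => (isCompact_KK j).isClosed
  have n1 : (⋃ j ∈ Finset.range j0, T.KK G j)ᶜ ∈ 𝓝 q := hcl.isOpen_compl.mem_nhds fun h => by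
    simp only [Set.mem_iUnion] at h
    obtain ⟨j, _, hj⟩ := h
    exact hq (Or.inr (Set.mem_iUnion.2 ⟨j, hj⟩))
  have n2 : {p : List Λ × ℕ → ℝ | |q γ| / 2 < |p γ|} ∈ 𝓝 q :=
    (isOpen_lt continuous_const (continuous_apply γ).abs).mem_nhds (by
      change |q γ| / 2 < |q γ|; linarith)
  filter_upwards [n1, n2] with p h1 h2
  rintro (h | h)
  · rw [Set.mem_singleton_iff.1 h] at h2
    simp only [Set.mem_ofPred_eq, Pi.zero_apply, abs_zero] at h2
    linarith
  · obtain ⟨j, hj⟩ := Set.mem_iUnion.1 h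
    by_cases hjj : j < j0
    · exact h1 (Set.mem_biUnion (Finset.mem_coe.2 (Finset.mem_range.2 hjj)) hj)
    · have := (KK_bound hj γ).trans_lt (hj0 j (not_lt.1 hjj))
      exact absurd h2 (not_lt.2 this.le)

theorem SS_sub_KA {k} (hk : k ∈ T.SS G) : k ∈ T.KA G := by
  refine Or.inr (Set.mem_iUnion.2 ⟨0, fun _ => k, fun _ => hk, fun i l h => ?_, ?_⟩)
  · exact absurd (Subsingleton.elim (α := Fin 1) i l) h
  · funext γ
    simp

instance : CompactSpace (T.KA G) := isCompact_iff_compactSpace.1 isCompact_KA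

variable (T G)

noncomputable def Phi : (List Λ × ℕ →₀ ℝ) →ₗ[ℝ] C(T.KA G, ℝ) where
  toFun x := ⟨fun q => pr q.1 x, (continuous_pr x).comp continuous_subtype_val⟩
  map_add' x y := by ext q; exact (Finsupp.linearCombination ℝ q.1).map_add x y
  map_smul' c x := by ext q; exact (Finsupp.linearCombination ℝ q.1).map_smul c x

theorem Phi_apply (x) (q : T.KA G) : T.Phi G x q = pr q.1 x := rfl

/-- the amalgam -/
noncomputable abbrev EA : Submodule ℝ C(T.KA G, ℝ) := (LinearMap.range (T.Phi G)).topologicalClosure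

noncomputable def PhiE : (List Λ × ℕ →₀ ℝ) →ₗ[ℝ] T.EA G :=
  (T.Phi G).codRestrict _ (fun x => Submodule.le_topologicalClosure _ ⟨x, rfl⟩)

theorem dense_PhiE : DenseRange (T.PhiE G) := by
  intro y
  rw [Metric.mem_closure_iff]
  intro ε hε
  obtain ⟨_, ⟨x, rfl⟩, hz⟩ := Metric.mem_closure_iff.1 y.2 ε hε
  exact ⟨_, ⟨x, rfl⟩, hz⟩

instance : CompleteSpace (T.EA G) :=
  (Submodule.isClosed_topologicalClosure _).completeSpace_coe

open Classical in
/-- evaluation -/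
noncomputable def ev (q : List Λ × ℕ → ℝ) : T.EA G →L[ℝ] ℝ :=
  if h : q ∈ T.KA G then (ContinuousMap.evalCLM ℝ (⟨q, h⟩ : T.KA G)).comp (T.EA G).subtypeL else 0

variable {T G}

theorem ev_apply {q} (h : q ∈ T.KA G) (f : T.EA G) : T.ev G q f = f.1 ⟨q, h⟩ := by
  rw [ev, dif_pos h]; rfl

theorem ev_PhiE {q} (h : q ∈ T.KA G) (x) : T.ev G q (T.PhiE G x) = pr q x := by
  rw [ev_apply h]; rfl

theorem ev_le {q} (f : T.EA G) : |T.ev G q f| ≤ ‖f‖ := by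
  by_cases h : q ∈ T.KA G
  · rw [ev_apply h]; exact f.1.norm_coe_le_norm _
  · rw [ev, dif_neg h]; simp

theorem ev_ext {F : Type*} [NormedAddCommGroup F] [NormedSpace ℝ F] {a b : T.EA G →L[ℝ] F}
    (h : ∀ x, a (T.PhiE G x) = b (T.PhiE G x)) (f) : a f = b f :=
  congrFun ((T.dense_PhiE G).equalizer a.continuous b.continuous (funext h)) f

theorem norm_PhiE_le {x} {B : ℝ} (hB : 0 ≤ B) (h : ∀ q ∈ T.KA G, |pr q x| ≤ B) : ‖T.PhiE G x‖ ≤ B := by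
  change ‖T.Phi G x‖ ≤ B
  rw [ContinuousMap.norm_le _ hB]
  exact fun q => h q.1 q.2

end TreeSys


theorem pr_single {Γ : Type} [DecidableEq Γ] (γ : Γ) (c : ℝ) (x : Γ →₀ ℝ) : pr (Pi.single γ c) x = x γ * c := by
  rw [pr_apply]
  by_cases h : γ ∈ x.support
  · rw [Finset.sum_eq_single γ]
    · simp
    · intro b _ hb; simp [Pi.single_eq_of_ne hb]
    · exact fun h' => absurd h h'
  · rw [Finsupp.notMem_support_iff.1 h, zero_mul]
    refine Finset.sum_eq_zero fun b hb => ?_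
    rw [Pi.single_eq_of_ne, mul_zero]
    rintro rfl; exact h hb

theorem pr_finite {Γ : Type} (k : Γ → ℝ) (F : Finset Γ) (h : ∀ γ, γ ∉ F → k γ = 0) (x : Γ →₀ ℝ) :
    pr k x = ∑ γ ∈ F, x γ * k γ := by
  classical
  rw [pr_apply]
  have a : ∑ γ ∈ x.support, x γ * k γ = ∑ γ ∈ x.support ∪ F, x γ * k γ :=
    Finset.sum_subset Finset.subset_union_left fun γ _ h => by
      rw [Finsupp.notMem_support_iff.1 h, zero_mul]
  have b : ∑ γ ∈ F, x γ * k γ = ∑ γ ∈ x.support ∪ F, x γ * k γ :=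
    Finset.sum_subset Finset.subset_union_right fun γ _ h' => by
      rw [h γ h', mul_zero]
  rw [a, b]

theorem pr_ne {Γ : Type} {k : Γ → ℝ} {x : Γ →₀ ℝ} (h : pr k x ≠ 0) : ∃ γ ∈ x.support, k γ ≠ 0 := by
  by_contra hc
  push Not at hc
  refine h ?_
  rw [pr_apply]
  exact Finset.sum_eq_zero fun γ hγ => by rw [hc γ hγ, mul_zero]

theorem exists_ext_dense {D E F : Type*} [AddCommGroup D] [Module ℝ D] [NormedAddCommGroup E]
    [NormedSpace ℝ E] [NormedAddCommGroup F] [NormedSpace ℝ F] [CompleteSpace F] (i : D →ₗ[ℝ] E)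
    (f : D →ₗ[ℝ] F) (C : ℝ) (hi : DenseRange i) (h : ∀ x, ‖f x‖ ≤ C * ‖i x‖) :
    ∃ P : E →L[ℝ] F, ∀ x, P (i x) = f x :=
  ⟨f.extendOfNorm i, fun x => LinearMap.extendOfNorm_eq hi ⟨C, h⟩ x⟩

namespace TreeSys
variable {Λ Z : Type} [NormedAddCommGroup Z] [NormedSpace ℝ Z] {lam lam' : ℝ}
    {g : Λ → Z} {T : TreeSys Λ Z lam lam' g} {G : Set (ℕ → Λ)}

open Classical in
theorem SS_single (hl : 1 ≤ lam) {γ : List Λ × ℕ} (h : γ.1 ∈ Node G ∧ γ ∈ (T.st γ.1).S) :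
    Pi.single γ ((1 + lam) * lam)⁻¹ ∈ T.SS G := by
  have hK : 0 < (1 + lam) * lam := by nlinarith
  refine ⟨fun γ' h' => ?_, fun γ1 γ2 h' => ?_, fun s hs x hx => ?_⟩
  · rw [Pi.single_eq_of_ne]; rintro rfl; exact h' h
  · by_cases e1 : γ1 = γ
    · by_cases e2 : γ2 = γ
      · subst e1; subst e2; exact absurd (cmpb_refl _) h'
      · rw [Pi.single_eq_of_ne e2, mul_zero]
    · rw [Pi.single_eq_of_ne e1, zero_mul]
  · rw [pr_single]
    by_cases h1 : γ ∈ (T.st s).S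
    · have := T.K_bound hl h1 x
      rw [abs_mul, abs_of_pos (inv_pos.2 hK), ← div_eq_mul_inv, div_le_iff₀ hK]
      linarith
    · have : x γ = 0 := by
        by_contra hne
        exact h1 (hx (Finset.mem_coe.2 (Finsupp.mem_support_iff.2 hne)))
      rw [this, zero_mul, abs_zero]; exact apply_nonneg _ _

open Classical in
theorem ev_finite (hl : 1 ≤ lam) {k} (hk : k ∈ T.SS G) (F : Finset (List Λ × ℕ))
    (h : ∀ γ, γ ∉ F → k γ = 0) (f : T.EA G) :
    T.ev G k f = ∑ γ ∈ F, (k γ * ((1 + lam) * lam)) * T.ev G (Pi.single γ ((1 + lam) * lam)⁻¹) f := by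
  have hK : 0 < (1 + lam) * lam := by nlinarith
  have := ev_ext (a := T.ev G k)
    (b := ∑ γ ∈ F, (k γ * ((1 + lam) * lam)) • T.ev G (Pi.single γ ((1 + lam) * lam)⁻¹)) (fun x => by
      rw [ev_PhiE (SS_sub_KA hk), pr_finite k F h, _root_.sum_apply]
      refine Finset.sum_congr rfl fun γ _ => ?_
      rw [_root_.smul_apply, smul_eq_mul]
      by_cases h0 : k γ = 0
      · rw [h0]; simp
      · have hv : γ.1 ∈ Node G ∧ γ ∈ (T.st γ.1).S := by
          by_contra hv; exact h0 (hk.1 γ hv)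
        rw [ev_PhiE (SS_sub_KA (SS_single hl hv)), pr_single]
        field_simp) f
  rw [this, _root_.sum_apply]
  rfl

theorem SS_tail (hl : 1 ≤ lam) {k} (hk : k ∈ T.SS G) (M : ℕ) :
    (fun γ : List Λ × ℕ => if M < γ.1.length then (1 + lam)⁻¹ * k γ else 0) ∈ T.SS G := by
  classical
  refine ⟨fun γ h => ?_, fun γ γ' h => ?_, fun s hs x hx => ?_⟩
  · simp only [hk.1 γ h, mul_zero, ite_self]
  · simp only
    split_ifs
    · rw [mul_mul_mul_comm, hk.2.1 γ γ' h, mul_zero]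
    all_goals simp
  · have e : pr (fun γ : List Λ × ℕ => if M < γ.1.length then (1 + lam)⁻¹ * k γ else 0) x =
        (1 + lam)⁻¹ * (pr k x - pr k (x.filter fun γ => γ.1.length ≤ M)) := by
      have : pr k x - pr k (x.filter fun γ => γ.1.length ≤ M) = pr k (x.filter fun γ => ¬ γ.1.length ≤ M) := by
        rw [← map_sub]
        congr 1
        rw [sub_eq_iff_eq_add, add_comm]
        exact (Finsupp.filter_add_filter_not _ _).symm
      rw [this, ← pr_smul]
      refine pr_congr fun γ => ?_
      rw [Finsupp.filter_apply]
      by_cases h : M < γ.1.length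
      · rw [if_pos h, if_pos (not_le.2 h)]
      · rw [if_neg h, if_neg (not_not.2 (not_lt.1 h))]; simp
    have hrs : s.drop (s.length - M) <:+ s := List.drop_suffix _ _
    set r := s.drop (s.length - M) with hr
    have hrl : r.length = min M s.length := by rw [hr, List.length_drop]; omega
    have hx1 : (x.filter fun γ => γ.1.length ≤ M) ∈ (T.st r).VS := by
      intro γ hγ
      rw [Finset.mem_coe, Finsupp.support_filter, Finset.mem_filter] at hγ
      have h1 := T.lab (hx (Finset.mem_coe.2 hγ.1))
      refine Finset.mem_coe.2 (T.mem_S.2 ⟨?_, h1.2⟩)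
      refine List.suffix_of_suffix_length_le h1.1 hrs ?_
      rw [hrl]; exact le_min hγ.2 h1.1.length_le
    have h2 : |pr k (x.filter fun γ => γ.1.length ≤ M)| ≤ lam * (T.st s).N x := by
      refine (hk.2.2 r (Node.suffix hrs hs) _ hx1).trans ?_
      rw [(T.good r).N_congr (by linarith) _ x]
      · exact T.N_le (by linarith) hrs x
      · intro γ hγ
        rw [Finsupp.filter_apply, if_pos]
        have := (T.lab hγ).1.length_le
        omega
    have h3 := hk.2.2 s hs x hx
    have h4 : 0 < 1 + lam := by linarith
    rw [e, abs_mul, abs_of_pos (inv_pos.2 h4), inv_mul_le_iff₀ h4]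
    have := abs_sub (pr k x) (pr k (x.filter fun γ => γ.1.length ≤ M))
    linarith

theorem NL_single {σ : ℕ → Λ} (hl : 0 ≤ lam) {γ} (h : (T.branch σ).NL (Finsupp.single γ 1) ≠ 0) :
    ∃ n, γ ∈ (T.st (pre σ n)).S := by
  classical
  by_contra hc
  push Not at hc
  apply h
  obtain ⟨n, hn⟩ := (T.branch σ).NL_spec hl (Finsupp.single γ 1)
  rw [← hn n le_rfl, ((T.branch σ).good n).N_congr hl _ 0, map_zero]
  intro γ' hγ'
  rw [Finsupp.single_apply, if_neg]
  · rfl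
  · rintro rfl; exact hc n hγ'

theorem NL_le_N (σ : ℕ → Λ) (hl : 0 ≤ lam) {s : List Λ} {x} (hx : x ∈ (T.st s).VS) :
    (T.branch σ).NL x ≤ lam * (T.st s).N x := by
  classical
  obtain ⟨n, hn⟩ := (T.branch σ).NL_spec hl x
  have hp : pre σ (Nat.findGreatest (fun p => pre σ p <:+ s) s.length) <:+ s :=
    Nat.findGreatest_spec (P := fun p => pre σ p <:+ s) (Nat.zero_le _) (List.nil_suffix)
  have hmax : ∀ p', pre σ p' <:+ s → p' ≤ Nat.findGreatest (fun p => pre σ p <:+ s) s.length :=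
    fun p' h => Nat.le_findGreatest (by have := h.length_le; rwa [pre_length] at this) h
  set p := Nat.findGreatest (fun p => pre σ p <:+ s) s.length
  have hy : x.filter (· ∈ (T.st (pre σ p)).S) ∈ (T.st (pre σ p)).VS := by
    intro γ hγ
    rw [Finset.mem_coe, Finsupp.support_filter, Finset.mem_filter] at hγ
    exact hγ.2
  have e1 : (T.st (pre σ (max n p))).N x = (T.st (pre σ (max n p))).N (x.filter (· ∈ (T.st (pre σ p)).S)) := by
    apply (T.good _).N_congr hl
    intro γ hγ
    rw [Finsupp.filter_apply]
    split_ifs with h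
    · rfl
    · by_contra hne
      have h1 := T.lab (hx (Finset.mem_coe.2 (Finsupp.mem_support_iff.2 hne)))
      have h2 := suffix_pre (T.lab hγ).1
      refine h (T.mem_S.2 ⟨?_, h1.2⟩)
      have h3 := hmax γ.1.length (by rw [← h2.2]; exact h1.1)
      rw [h2.2]; exact pre_suffix σ h3
  have e2 : (T.st (pre σ p)).N (x.filter (· ∈ (T.st (pre σ p)).S)) = (T.st (pre σ p)).N x := by
    apply (T.good _).N_congr hl
    intro γ hγ
    rw [Finsupp.filter_apply, if_pos hγ]
  rw [← hn (max n p) (le_max_left _ _)]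
  change (T.st (pre σ (max n p))).N x ≤ _
  rw [e1, T.N_eq (pre_suffix σ (le_max_right n p)) _ hy, e2]
  exact T.N_le hl hp x

theorem pr_lin {Γ : Type} (φ : (Γ →₀ ℝ) →ₗ[ℝ] ℝ) (x) : pr (fun γ => φ (Finsupp.single γ 1)) x = φ x := by
  conv_rhs => rw [← Finsupp.sum_single x, Finsupp.sum, map_sum]
  rw [pr_apply]
  refine Finset.sum_congr rfl fun γ _ => ?_
  rw [← smul_eq_mul, ← map_smul, Finsupp.smul_single, smul_eq_mul, mul_one]

theorem NL_le_PhiE {σ : ℕ → Λ} (hσ : σ ∈ G) (hl : 1 ≤ lam) (x) :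
    (T.branch σ).NL x ≤ lam * ‖T.PhiE G x‖ := by
  have hl0 : 0 < lam := by linarith
  obtain ⟨φ, h1, h2⟩ := seminorm_dual_vector (T.branch σ).NL x
  have hne : ∀ γ, lam⁻¹ * φ (Finsupp.single γ 1) ≠ 0 → ∃ n, γ ∈ (T.st (pre σ n)).S := by
    intro γ h
    apply NL_single hl0.le
    intro h0
    have := h2 (Finsupp.single γ 1)
    rw [h0] at this
    exact h (by rw [abs_nonpos_iff.1 this, mul_zero])
  have hk : (fun γ => lam⁻¹ * φ (Finsupp.single γ 1)) ∈ T.SS G := by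
    refine ⟨fun γ h => ?_, fun γ γ' h => ?_, fun s hs x hx => ?_⟩
    · by_contra h0
      obtain ⟨n, hn⟩ := hne γ h0
      exact h ⟨Node.suffix (T.lab hn).1 ⟨σ, hσ, n, rfl⟩, (T.lab hn).2⟩
    · by_contra h0
      obtain ⟨n, hn⟩ := hne γ (left_ne_zero_of_mul h0)
      obtain ⟨m, hm⟩ := hne γ' (right_ne_zero_of_mul h0)
      exact h (cmpb_of_suffix ((T.lab hn).1.trans (pre_suffix σ (le_max_left n m)))
        ((T.lab hm).1.trans (pre_suffix σ (le_max_right n m))))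
    · rw [pr_smul, pr_lin, abs_mul, abs_of_pos (inv_pos.2 hl0), inv_mul_le_iff₀ hl0]
      exact (h2 x).trans (NL_le_N σ hl0.le hx)
  have h3 := ev_le (q := fun γ => lam⁻¹ * φ (Finsupp.single γ 1)) (T.PhiE G x)
  rw [ev_PhiE (SS_sub_KA hk), pr_smul, pr_lin, h1, abs_mul, abs_of_pos (inv_pos.2 hl0),
    inv_mul_le_iff₀ hl0] at h3
  exact (le_abs_self _).trans h3

theorem exists_P {σ : ℕ → Λ} (hσ : σ ∈ G) (hl : 1 ≤ lam) :
    ∃ P : T.EA G →L[ℝ] Ban (T.branch σ).NL, ∀ x, P (T.PhiE G x) = iota _ x := by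
  exact exists_ext_dense (E := T.EA G) (T.PhiE G) (iota (T.branch σ).NL) lam (T.dense_PhiE G)
    fun x => by rw [norm_iota]; exact NL_le_PhiE hσ hl x

theorem PhiE_le_N {s : List Λ} (hs : s ∈ Node G) {x} (hx : x ∈ (T.st s).VS) :
    ‖T.PhiE G x‖ ≤ (T.st s).N x := by
  refine norm_PhiE_le (apply_nonneg _ _) fun q hq => ?_
  rcases hq with hq | hq
  · rw [Set.mem_singleton_iff.1 hq, pr_apply]; simp
  · obtain ⟨j, k, h1, h2, rfl⟩ := Set.mem_iUnion.1 hq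
    rw [pr_smul (((2:ℝ) ^ j)⁻¹) (fun γ => ∑ i, k i γ), pr_sum, abs_mul,
      abs_of_pos (show (0:ℝ) < ((2:ℝ) ^ j)⁻¹ by positivity)]
    have h3 := sum_one_nonzero (fun i => pr (k i) x) (fun i l hil => by
      by_contra h0
      obtain ⟨γ, hγ, hγ'⟩ := pr_ne (left_ne_zero_of_mul h0)
      obtain ⟨δ, hδ, hδ'⟩ := pr_ne (right_ne_zero_of_mul h0)
      have a := (T.lab (hx hγ)).1
      have b := (T.lab (hx hδ)).1
      exact mul_ne_zero hγ' hδ' (h2 i l hil γ δ (cmpb_of_suffix a b)))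
      (fun i => (h1 i).2.2 s hs x hx) (apply_nonneg _ _)
    refine (mul_le_of_le_one_left (abs_nonneg _) ?_).trans h3
    exact inv_le_one_of_one_le₀ (one_le_pow₀ one_le_two)

theorem L_embeds {σ : ℕ → Λ} (hσ : σ ∈ G) (hl : 1 ≤ lam) :
    Embeds (Ban (T.branch σ).NL) (T.EA G) := by
  classical
  have hl0 : 0 ≤ lam := by linarith
  let fl : (List Λ × ℕ →₀ ℝ) →ₗ[ℝ] (List Λ × ℕ →₀ ℝ) :=
    { toFun := fun x => x.filter (fun γ => ∃ n, γ ∈ (T.st (pre σ n)).S)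
      map_add' := fun x y => Finsupp.filter_add
      map_smul' := fun c x => Finsupp.filter_smul }
  have key : ∀ x, ∃ n, fl x ∈ (T.st (pre σ n)).VS ∧ (T.branch σ).NL x = (T.st (pre σ n)).N (fl x) := by
    intro x
    obtain ⟨n, y, hy, h⟩ := (T.branch σ).exists_proj x
    have : fl x = y := by
      ext γ
      change (x.filter _) γ = _
      rw [Finsupp.filter_apply]
      split_ifs with h0
      · obtain ⟨m, hm⟩ := h0
        exact h (max m n) (le_max_right _ _) γ ((T.branch σ).S_mono (le_max_left m n) hm)
      · by_contra hne
        exact h0 ⟨n, hy (Finset.mem_coe.2 (Finsupp.mem_support_iff.2 (Ne.symm hne)))⟩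
    refine ⟨n, this ▸ hy, ?_⟩
    rw [this]
    obtain ⟨m, hm⟩ := (T.branch σ).NL_spec hl0 x
    rw [← hm (max m n) (le_max_left _ _), ((T.branch σ).good _).N_congr hl0 x y (h _ (le_max_right _ _)),
      (T.branch σ).N_eq (le_max_right _ _) y hy]
    rfl
  obtain ⟨U, hU, hU'⟩ := Ban_ext (T.branch σ).NL (F := T.EA G) ((T.PhiE G) ∘ₗ fl) 1 (fun x => by
    obtain ⟨n, h1, h2⟩ := key x
    rw [h2, one_mul]
    exact PhiE_le_N ⟨σ, hσ, n, rfl⟩ h1)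
  refine ⟨U, lam⁻¹, by positivity, Ban_le _ U _ fun x => ?_⟩
  rw [hU, inv_mul_le_iff₀ (by positivity)]
  obtain ⟨n, h1, h2⟩ := key x
  have := NL_le_PhiE (T := T) hσ hl (fl x)
  rw [(T.branch σ).NL_eq hl0 (n := n) _ h1] at this
  rw [h2]; exact this

theorem X_embeds_EA {σ : ℕ → Λ} (hσ : σ ∈ G) (hl : 1 ≤ lam) :
    Embeds (Submodule.span ℝ (Set.range fun n => g (σ n))).topologicalClosure (T.EA G) :=
  Embeds.trans' ((T.branch σ).X_embeds_X' (by linarith)) (Embeds.trans' (embeds_sub _) (L_embeds hσ hl))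

theorem ev_le_P {σ : ℕ → Λ} (hσ : σ ∈ G) (hl : 1 ≤ lam) {k} (hk : k ∈ T.SS G)
    (h : ∀ γ, k γ ≠ 0 → γ.1 = pre σ γ.1.length) {P : T.EA G →L[ℝ] Ban (T.branch σ).NL}
    (hP : ∀ x, P (T.PhiE G x) = iota _ x) (f) : |T.ev G k f| ≤ ‖P f‖ := by
  have hl0 : 0 ≤ lam := by linarith
  refine (T.dense_PhiE G).induction_on f (isClosed_le (by fun_prop) (by fun_prop)) fun x => ?_
  rw [ev_PhiE (SS_sub_KA hk), hP, norm_iota]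
  obtain ⟨n, y, hy, hxy⟩ := (T.branch σ).exists_proj x
  have e : pr k x = pr k y := by
    refine pr_congr fun γ => ?_
    by_cases h0 : k γ = 0
    · rw [h0]; simp
    · have hv : γ.1 ∈ Node G ∧ γ ∈ (T.st γ.1).S := by
        by_contra hv; exact h0 (hk.1 γ hv)
      have h1 := hv.2
      rw [h γ h0] at h1
      rw [hxy (max n γ.1.length) (le_max_left _ _) γ ((T.branch σ).S_mono (le_max_right _ _) h1)]
  rw [e]
  refine (hk.2.2 (pre σ n) ⟨σ, hσ, n, rfl⟩ y hy).trans ?_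
  obtain ⟨m, hm⟩ := (T.branch σ).NL_spec hl0 x
  rw [← hm (max m n) (le_max_left _ _), ((T.branch σ).good _).N_congr hl0 x y (hxy _ (le_max_right _ _)),
      (T.branch σ).N_eq (le_max_right _ _) y hy]
  exact le_rfl

theorem cmpb_le {a b : List Λ} (h : cmpb a b) (hl : a.length ≤ b.length) : a <:+ b := by
  rcases h with h | h
  · exact h
  · rw [h.eq_of_length_le hl]

theorem exists_along (hG : ∀ σ, (∀ n, ∃ τ ∈ G, pre τ n = pre σ n) → σ ∈ G) {k} (hk : k ∈ T.SS G)
    (hinf : {γ | k γ ≠ 0}.Infinite) : ∃ σ ∈ G, ∀ γ, k γ ≠ 0 → γ.1 = pre σ γ.1.length := by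
  have hv : ∀ γ, k γ ≠ 0 → γ.1 ∈ Node G ∧ γ ∈ (T.st γ.1).S := fun γ h0 => by
    by_contra hv; exact h0 (hk.1 γ hv)
  have hc : ∀ γ γ', k γ ≠ 0 → k γ' ≠ 0 → cmpb γ.1 γ'.1 := fun γ γ' h h' => by
    by_contra hc; exact mul_ne_zero h h' (hk.2.1 γ γ' hc)
  have hub : ∀ n, ∃ γ, k γ ≠ 0 ∧ n < γ.1.length := by
    by_contra hcon
    push Not at hcon
    obtain ⟨n, hn⟩ := hcon
    obtain ⟨γ0, h0⟩ := hinf.nonempty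
    classical
    have hbd : ∃ m, ∃ γ, k γ ≠ 0 ∧ γ.1.length = m ∧ ∀ γ', k γ' ≠ 0 → γ'.1.length ≤ m := by
      have hs : ((fun γ : List Λ × ℕ => γ.1.length) '' {γ | k γ ≠ 0}).Finite :=
        (Set.finite_Iic n).subset (by rintro _ ⟨γ, hγ, rfl⟩; exact hn γ hγ)
      obtain ⟨m, ⟨γ, hγ, hm⟩, hmax⟩ := hs.exists_maximal ⟨_, γ0, h0, rfl⟩
      refine ⟨m, γ, hγ, hm, fun γ' h' => ?_⟩
      rcases le_total γ'.1.length m with h | h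
      · exact h
      · exact hmax ⟨γ', h', rfl⟩ h
    obtain ⟨m, γ, hγ, rfl, hm⟩ := hbd
    refine hinf (((T.st γ.1).S.finite_toSet).subset fun γ' h' => ?_)
    exact Finset.mem_coe.2 (T.mem_S.2 ⟨cmpb_le (hc γ' γ h' hγ) (hm γ' h'), (hv γ' h').2⟩)
  choose γ hγ hγn using hub
  obtain ⟨s, hs⟩ : ∃ s : ℕ → List Λ, ∀ n, s n = (γ n).1.drop ((γ n).1.length - n) := ⟨_, fun _ => rfl⟩
  have hsl : ∀ n, (s n).length = n := fun n => by rw [hs, List.length_drop]; have := hγn n; omega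
  have hsuf : ∀ n, s n <:+ (γ n).1 := fun n => by rw [hs]; exact List.drop_suffix _ _
  have hstep : ∀ n, ∃ a, s (n+1) = a :: s n := by
    intro n
    obtain ⟨a, t, hat⟩ : ∃ a t, s (n+1) = a :: t := by
      cases h : s (n+1) with
      | nil => have := hsl (n+1); rw [h] at this; simp at this
      | cons a t => exact ⟨a, t, rfl⟩
    refine ⟨a, ?_⟩
    rw [hat]
    have ht : t <:+ (γ (n+1)).1 := ((List.suffix_cons a t).trans (by rw [← hat])).trans (hsuf (n+1))
    have htl : t.length = n := by have := hsl (n+1); rw [hat] at this; simpa using this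
    congr 1
    rcases hc _ _ (hγ n) (hγ (n+1)) with h | h
    · exact (List.suffix_of_suffix_length_le ht ((hsuf n).trans h) (by rw [htl, hsl])).eq_of_length
        (by rw [htl, hsl])
    · exact (List.suffix_of_suffix_length_le (ht.trans h) (hsuf n) (by rw [htl, hsl])).eq_of_length
        (by rw [htl, hsl])
  choose σ hσ using hstep
  have hpre : ∀ n, pre σ n = s n := by
    intro n
    induction n with
    | zero => exact (List.eq_nil_of_length_eq_zero (hsl 0)).symm
    | succ n ih => rw [hσ, ← ih]; rfl
  refine ⟨σ, hG σ fun n => ?_, fun γ' h' => ?_⟩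
  · obtain ⟨τ, hτ, m, hm⟩ := (hv _ (hγ n)).1
    have h1 := hsuf n
    rw [hm] at h1
    have h2 := (suffix_pre h1).2
    rw [hsl] at h2
    exact ⟨τ, hτ, by rw [hpre, h2]⟩
  · rw [hpre]
    have h1 := cmpb_le (hc _ _ h' (hγ γ'.1.length)) (hγn _).le
    exact (List.suffix_of_suffix_length_le h1 (hsuf _) (by rw [hsl])).eq_of_length (by rw [hsl])

instance [Countable Λ] : TopologicalSpace.SeparableSpace (T.EA G) := by
  have : SecondCountableTopology C(T.KA G, ℝ) := inferInstance
  infer_instance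

end TreeSys


theorem norm_hh_le (x : CantorSet) (n) : ‖hh x n‖ ≤ 1 :=
  (ContinuousMap.norm_le _ zero_le_one).2 fun y => abs_ind_le _ y

theorem freq_of_not_tendsto {u : ℕ → ℝ} (h : ¬ Tendsto u atTop (𝓝 0)) :
    ∃ i : ℕ, ∃ᶠ n in atTop, 1 / ((i:ℝ) + 1) ≤ |u n| := by
  rw [Metric.tendsto_atTop] at h
  push Not at h
  obtain ⟨ε, hε, h⟩ := h
  obtain ⟨i, hi⟩ := exists_nat_one_div_lt hε
  refine ⟨i, frequently_atTop.2 fun N => ?_⟩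
  obtain ⟨n, hn, hn'⟩ := h N
  rw [Real.dist_0_eq_abs] at hn'
  exact ⟨n, hn, hi.le.trans hn'⟩

theorem clm_bound {E F : Type*} [NormedAddCommGroup E] [NormedSpace ℝ E] [NormedAddCommGroup F]
    [NormedSpace ℝ F] (J : E →L[ℝ] F) : ∃ b : ℝ, 0 ≤ b ∧ ∀ f, ‖f‖ ≤ 1 → ‖J f‖ ≤ b :=
  ⟨‖J‖, norm_nonneg _, fun f hf => (J.le_opNorm _).trans (mul_le_of_le_one_right (norm_nonneg _) hf)⟩

instance cantor_uncountable : Uncountable CantorSet := by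
  rw [← Cardinal.aleph0_lt_mk_iff]
  have : Cardinal.mk CantorSet = 2 ^ Cardinal.aleph0.{0} := by simp [CantorSet]
  rw [this]
  exact Cardinal.cantor _

namespace TreeSys
variable {Λ Z : Type} [NormedAddCommGroup Z] [NormedSpace ℝ Z] {lam lam' : ℝ}
    {g : Λ → Z} {T : TreeSys Λ Z lam lam' g} {G : Set (ℕ → Λ)}

theorem ev_KK {j : ℕ} (k : Fin (4 ^ j) → List Λ × ℕ → ℝ) (h1 : ∀ i, k i ∈ T.SS G)
    (h2 : ∀ i l, i ≠ l → ∀ γ γ' : List Λ × ℕ, cmpb γ.1 γ'.1 → k i γ * k l γ' = 0) (f : T.EA G) :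
    T.ev G (fun γ => ((2:ℝ) ^ j)⁻¹ * ∑ i, k i γ) f = ((2:ℝ) ^ j)⁻¹ * ∑ i, T.ev G (k i) f := by
  have hq : (fun γ => ((2:ℝ) ^ j)⁻¹ * ∑ i, k i γ) ∈ T.KA G :=
    Or.inr (Set.mem_iUnion.2 ⟨j, k, h1, h2, rfl⟩)
  have := ev_ext (a := T.ev G (fun γ => ((2:ℝ) ^ j)⁻¹ * ∑ i, k i γ))
    (b := ((2:ℝ) ^ j)⁻¹ • ∑ i, T.ev G (k i)) (fun x => by
      rw [ev_PhiE hq, _root_.smul_apply, _root_.sum_apply, smul_eq_mul,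
        pr_smul (((2:ℝ) ^ j)⁻¹) (fun γ => ∑ i, k i γ), pr_sum]
      congr 1
      exact Finset.sum_congr rfl fun i _ => (ev_PhiE (SS_sub_KA (h1 i)) x).symm) f
  rw [this, _root_.smul_apply, _root_.sum_apply, smul_eq_mul]

theorem ev_smul {k} (hk : k ∈ T.SS G) {c : ℝ} (hc : |c| ≤ 1) (f : T.EA G) :
    T.ev G (fun γ => c * k γ) f = c * T.ev G k f := by
  have := ev_ext (a := T.ev G (fun γ => c * k γ)) (b := c • T.ev G k) (fun x => by
      rw [ev_PhiE (SS_sub_KA (SS_smul hk hc)), _root_.smul_apply, smul_eq_mul, pr_smul,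
        ev_PhiE (SS_sub_KA hk)]) f
  rw [this, _root_.smul_apply, smul_eq_mul]

open Classical in
theorem ev_tail (hl : 1 ≤ lam) {k} (hk : k ∈ T.SS G) {σ : ℕ → Λ}
    (h : ∀ γ, k γ ≠ 0 → γ.1 = pre σ γ.1.length) (M : ℕ) (f : T.EA G) :
    T.ev G k f = (1 + lam) * T.ev G (fun γ : List Λ × ℕ => if M < γ.1.length then (1 + lam)⁻¹ * k γ else 0) f
      + ∑ γ ∈ (T.st (pre σ M)).S, (k γ * ((1 + lam) * lam)) * T.ev G (Pi.single γ ((1 + lam) * lam)⁻¹) f := by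
  have hK : 0 < (1 + lam) * lam := by nlinarith
  have hv : ∀ γ, k γ ≠ 0 → γ.1 ∈ Node G ∧ γ ∈ (T.st γ.1).S := fun γ h0 => by
    by_contra hv; exact h0 (hk.1 γ hv)
  have := ev_ext (a := T.ev G k) (b := (1 + lam) • T.ev G (fun γ : List Λ × ℕ =>
      if M < γ.1.length then (1 + lam)⁻¹ * k γ else 0)
      + ∑ γ ∈ (T.st (pre σ M)).S, (k γ * ((1 + lam) * lam)) • T.ev G (Pi.single γ ((1 + lam) * lam)⁻¹))
    (fun x => by
      rw [ev_PhiE (SS_sub_KA hk), _root_.add_apply, _root_.smul_apply, _root_.sum_apply,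
        ev_PhiE (SS_sub_KA (SS_tail hl hk M)), smul_eq_mul]
      have e1 : ∑ γ ∈ (T.st (pre σ M)).S, ((k γ * ((1 + lam) * lam)) •
          T.ev G (Pi.single γ ((1 + lam) * lam)⁻¹)) (T.PhiE G x) =
          ∑ γ ∈ (T.st (pre σ M)).S, x γ * (if M < γ.1.length then 0 else k γ) := by
        refine Finset.sum_congr rfl fun γ hγ => ?_
        have hlen := (suffix_pre (T.lab hγ).1).1
        rw [if_neg (not_lt.2 hlen), _root_.smul_apply, smul_eq_mul]
        by_cases h0 : k γ = 0
        · rw [h0]; simp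
        · rw [ev_PhiE (SS_sub_KA (SS_single hl (hv γ h0))), pr_single]
          field_simp
      rw [e1, ← pr_finite (fun γ => if M < γ.1.length then 0 else k γ) (T.st (pre σ M)).S
        (fun γ hγ => ?_) x, ← pr_smul]
      · simp only [pr_apply, ← Finset.sum_add_distrib]
        refine Finset.sum_congr rfl fun γ _ => ?_
        split_ifs
        · field_simp; ring
        · ring
      · split_ifs with h1
        · rfl
        · by_contra h0
          refine hγ (T.mem_S.2 ⟨?_, (hv γ h0).2⟩)
          rw [h γ h0]; exact pre_suffix σ (not_lt.1 h1)) f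
  rw [this, _root_.add_apply, _root_.smul_apply, _root_.sum_apply, smul_eq_mul]
  rfl

theorem exists_SS_not_null {J : CantorC →L[ℝ] T.EA G} {c : ℝ} (hc : 0 < c) (hJ : ∀ x, c * ‖x‖ ≤ ‖J x‖)
    (x : CantorSet) : ∃ k ∈ T.SS G, ¬ Tendsto (fun n => T.ev G k (J (hh x n))) atTop (𝓝 0) := by
  by_contra hcon
  push Not at hcon
  have h0 : ∀ q : T.KA G, Tendsto (fun n => (J (hh x n)).1 q) atTop (𝓝 0) := by
    rintro ⟨q, hq⟩
    simp only [← ev_apply hq]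
    rcases hq with hq | hq
    · rw [Set.mem_singleton_iff.1 hq]; exact hcon 0 SS_zero
    · obtain ⟨j, k, h1, h2, rfl⟩ := Set.mem_iUnion.1 hq
      simp only [ev_KK k h1 h2]
      have : Tendsto (fun n => ((2:ℝ) ^ j)⁻¹ * ∑ i, T.ev G (k i) (J (hh x n))) atTop
          (𝓝 (((2:ℝ) ^ j)⁻¹ * ∑ i : Fin (4 ^ j), (0:ℝ))) :=
        (tendsto_finsetSum _ fun i _ => hcon (k i) (h1 i)).const_mul _
      simpa using this
  obtain ⟨b, hb0, hb⟩ := clm_bound (F := T.EA G) J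
  obtain ⟨w, w0, w1, w2⟩ := mazur_null (fun n => (J (hh x n)).1) b (fun n q =>
    (ContinuousMap.norm_coe_le_norm _ q).trans (hb _ (norm_hh_le x n))) h0 (c / 2) (by linarith)
  have e : Finsupp.linearCombination ℝ (fun n => (J (hh x n)).1) w =
      (J (Finsupp.linearCombination ℝ (fun n => hh x n) w)).1 := by
    rw [Finsupp.linearCombination_apply, Finsupp.linearCombination_apply, Finsupp.sum, Finsupp.sum, map_sum]
    simp
  rw [e] at w2
  have h3 := hJ (Finsupp.linearCombination ℝ (fun n => hh x n) w)
  have h4 : (1:ℝ) ≤ ‖Finsupp.linearCombination ℝ (fun n => hh x n) w‖ := by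
    have h5 := ContinuousMap.norm_coe_le_norm (Finsupp.linearCombination ℝ (fun n => hh x n) w) x
    have h6 : (Finsupp.linearCombination ℝ (fun n => hh x n) w) x = 1 := by
      rw [← w1, Finsupp.linearCombination_apply, Finsupp.linearCombination_apply, Finsupp.sum, Finsupp.sum,
        ContinuousMap.sum_apply]
      refine Finset.sum_congr rfl fun n _ => ?_
      rw [ContinuousMap.smul_apply, ind_mem (mem_cyl_self x n)]
    rw [h6] at h5; simpa using h5
  have h7 : c * 1 ≤ c / 2 := (mul_le_mul_of_nonneg_left h4 hc.le).trans (h3.trans w2)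
  linarith

theorem few_branches (hl : 1 ≤ lam) (J : CantorC →L[ℝ] T.EA G) {ε : ℝ} (hε : 0 < ε)
    {A : Set CantorSet}
    (hA0 : ∀ x ∈ A, ∀ γ, Tendsto (fun n => T.ev G (by classical exact Pi.single γ ((1 + lam) * lam)⁻¹)
      (J (hh x n))) atTop (𝓝 0))
    (k : CantorSet → List Λ × ℕ → ℝ) (σ : CantorSet → ℕ → Λ) (hk : ∀ x ∈ A, k x ∈ T.SS G)
    (hσ : ∀ x ∈ A, ∀ γ, k x γ ≠ 0 → γ.1 = pre (σ x) γ.1.length)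
    (hf : ∀ x ∈ A, ∃ᶠ n in atTop, ε ≤ |T.ev G (k x) (J (hh x n))|) : (σ '' A).Finite := by
  classical
  by_contra hinf
  have hl1 : 0 < 1 + lam := by linarith
  obtain ⟨b, hb0, hb⟩ := clm_bound (F := T.EA G) J
  obtain ⟨j, hj⟩ : ∃ j : ℕ, b / (ε / (2 * (1 + lam))) < (2:ℝ) ^ j :=
    pow_unbounded_of_one_lt _ one_lt_two
  rw [div_lt_iff₀ (by positivity)] at hj
  obtain ⟨B, hB, hBk⟩ := Set.Infinite.exists_subset_card_eq hinf (4 ^ j)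
  obtain ⟨M, hM⟩ := exists_sep B
  let φ : Fin (4 ^ j) ≃ B := (Finset.equivFinOfCardEq hBk).symm
  have hφ : ∀ i, ∃ x ∈ A, σ x = (φ i).1 := fun i => hB (φ i).2
  choose x hxA hxσ using hφ
  have hinj : ∀ i l, pre (σ (x i)) M = pre (σ (x l)) M → i = l := by
    intro i l h
    rw [hxσ, hxσ] at h
    exact φ.injective (Subtype.ext (hM _ (φ i).2 _ (φ l).2 h))
  have hxinj : Function.Injective x := fun i l h => hinj i l (by rw [h])
  obtain ⟨N, hN⟩ := exists_sep (Finset.univ.image x)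
  have hN' : ∀ i ∈ Finset.univ, ∀ l ∈ Finset.univ, pre (x i) N = pre (x l) N → i = l :=
    fun i _ l _ h => hxinj (hN _ (Finset.mem_image_of_mem _ (Finset.mem_univ i)) _
      (Finset.mem_image_of_mem _ (Finset.mem_univ l)) h)
  obtain ⟨t, ht⟩ : ∃ t : Fin (4 ^ j) → List Λ × ℕ → ℝ, ∀ i, t i = fun γ : List Λ × ℕ =>
    if M < γ.1.length then (1 + lam)⁻¹ * k (x i) γ else 0 := ⟨_, fun _ => rfl⟩
  have htS : ∀ i, t i ∈ T.SS G := fun i => by rw [ht]; exact SS_tail hl (hk _ (hxA i)) M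
  have htd : ∀ i l, i ≠ l → ∀ γ γ' : List Λ × ℕ, cmpb γ.1 γ'.1 → t i γ * t l γ' = 0 := by
    intro i l hil γ γ' hc
    by_contra h0
    have a := left_ne_zero_of_mul h0
    have b := right_ne_zero_of_mul h0
    rw [ht] at a b
    simp only [ne_eq, ite_eq_right_iff, not_forall] at a b
    obtain ⟨a1, a2⟩ := a
    obtain ⟨b1, b2⟩ := b
    have a3 := hσ _ (hxA i) γ (right_ne_zero_of_mul a2)
    have b3 := hσ _ (hxA l) γ' (right_ne_zero_of_mul b2)
    have a4 : pre (σ (x i)) M <:+ γ.1 := by rw [a3]; exact pre_suffix _ a1.le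
    have b4 : pre (σ (x l)) M <:+ γ'.1 := by rw [b3]; exact pre_suffix _ b1.le
    refine hil (hinj i l ?_)
    have : cmpb (pre (σ (x i)) M) (pre (σ (x l)) M) := by
      rcases hc with hc | hc
      · exact cmpb_of_suffix (a4.trans hc) b4
      · exact cmpb_of_suffix a4 (b4.trans hc)
    exact (cmpb_le this (by rw [pre_length, pre_length])).eq_of_length (by rw [pre_length, pre_length])
  have hn : ∀ i, ∃ n, N ≤ n ∧ ε / (2 * (1 + lam)) ≤ |T.ev G (t i) (J (hh (x i) n))| := by
    intro i
    have h1 : Tendsto (fun n => ∑ γ ∈ (T.st (pre (σ (x i)) M)).S, (k (x i) γ * ((1 + lam) * lam)) *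
        T.ev G (Pi.single γ ((1 + lam) * lam)⁻¹) (J (hh (x i) n))) atTop (𝓝 0) := by
      have := tendsto_finsetSum (T.st (pre (σ (x i)) M)).S fun γ _ =>
        (hA0 (x i) (hxA i) γ).const_mul (k (x i) γ * ((1 + lam) * lam))
      simpa using this
    have h2 := (Metric.tendsto_nhds.1 h1 (ε / 2) (by linarith)).and (eventually_ge_atTop N)
    obtain ⟨n, h3, h4, h5⟩ := ((hf (x i) (hxA i)).and_eventually h2).exists
    refine ⟨n, h5, ?_⟩
    rw [ev_tail hl (hk _ (hxA i)) (hσ _ (hxA i)) M, ← ht] at h3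
    rw [Real.dist_0_eq_abs] at h4
    have h6 := h3.trans (abs_add_le _ _)
    rw [abs_mul, abs_of_pos hl1] at h6
    rw [div_le_iff₀ (by positivity)]
    linarith
  choose n hnN hnε using hn
  have hs : ∀ i, ∃ s : ℝ, |s| ≤ 1 ∧ s * T.ev G (t i) (J (hh (x i) (n i))) = |T.ev G (t i) (J (hh (x i) (n i)))| := by
    intro i
    rcases le_total 0 (T.ev G (t i) (J (hh (x i) (n i)))) with h | h
    · exact ⟨1, by simp, by rw [abs_of_nonneg h, one_mul]⟩
    · exact ⟨-1, by simp, by rw [abs_of_nonpos h]; ring⟩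
  choose s hs1 hs2 using hs
  obtain ⟨θ, hθ, hθs⟩ := sign_choice Finset.univ
    (fun i l => s i * T.ev G (t i) (J (hh (x l) (n l))))
  have hθ1 : ∀ i, |θ i| ≤ 1 := fun i => by rcases hθ i with h | h <;> simp [h]
  have hsθ : ∀ i, |θ i * s i| ≤ 1 := fun i => by
    rw [abs_mul]; exact mul_le_one₀ (hθ1 i) (abs_nonneg _) (hs1 i)
  have f1 := norm_hh_sum Finset.univ x hN' n hnN θ hθ1
  have e1 := ev_KK (T := T) (G := G) (fun i γ => (θ i * s i) * t i γ) (fun i => SS_smul (htS i) (hsθ i))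
    (fun i l hil γ γ' hc => by rw [mul_mul_mul_comm, htd i l hil γ γ' hc, mul_zero])
    (J (∑ i, θ i • hh (x i) (n i)))
  have e2 : ∑ i, T.ev G (fun γ => (θ i * s i) * t i γ) (J (∑ l, θ l • hh (x l) (n l))) =
      ∑ i, ∑ l, θ i * θ l * (s i * T.ev G (t i) (J (hh (x l) (n l)))) := by
    refine Finset.sum_congr rfl fun i _ => ?_
    rw [ev_smul (htS i) (hsθ i), map_sum, map_sum, Finset.mul_sum]
    refine Finset.sum_congr rfl fun l _ => ?_
    rw [map_smul, map_smul, smul_eq_mul]; ring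
  have e3 : (4:ℝ) ^ j * (ε / (2 * (1 + lam))) ≤ ∑ i, s i * T.ev G (t i) (J (hh (x i) (n i))) := by
    have := Finset.card_nsmul_le_sum Finset.univ (fun i => s i * T.ev G (t i) (J (hh (x i) (n i))))
      (ε / (2 * (1 + lam))) fun i _ => by rw [hs2]; exact hnε i
    rw [Finset.card_univ, Fintype.card_fin, nsmul_eq_mul] at this
    exact_mod_cast this
  have f2 := ev_le (q := fun γ => ((2:ℝ) ^ j)⁻¹ * ∑ i, (θ i * s i) * t i γ) (J (∑ i, θ i • hh (x i) (n i)))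
  rw [e1, e2] at f2
  have f3 := (le_abs_self _).trans (f2.trans (hb _ f1))
  have f4 := e3.trans hθs
  rw [inv_mul_le_iff₀ (by positivity)] at f3
  have f5 : (4:ℝ) ^ j = 2 ^ j * 2 ^ j := by rw [← mul_pow]; norm_num
  have f6 := f4.trans f3
  rw [f5, mul_assoc] at f6
  have f7 := le_of_mul_le_mul_left f6 (by positivity)
  linarith

theorem EA_nonuniv [Countable Λ] [CompleteSpace Z] (hl' : 1 < lam') (hll : lam' < lam)
    (hG : ∀ σ, (∀ n, ∃ τ ∈ G, pre τ n = pre σ n) → σ ∈ G)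
    (hNU : ∀ σ ∈ G, ¬ Embeds CantorC (Submodule.span ℝ (Set.range fun n => g (σ n))).topologicalClosure) :
    ¬ Embeds CantorC (T.EA G) := by
  classical
  rintro ⟨J, c, hc, hJ⟩
  have hl : 1 ≤ lam := by linarith
  let A0 : Set CantorSet := ⋃ γ : List Λ × ℕ, {x | ¬ Tendsto (fun n =>
    ((T.ev G (Pi.single γ ((1 + lam) * lam)⁻¹)).comp J) (hh x n)) atTop (𝓝 0)}
  have hA0 : A0.Countable := Set.countable_iUnion fun γ => atoms_countable _
  have hA0' : ∀ x, x ∉ A0 → ∀ γ, Tendsto (fun n => T.ev G (Pi.single γ ((1 + lam) * lam)⁻¹)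
      (J (hh x n))) atTop (𝓝 0) := by
    intro x hx γ
    by_contra h
    exact hx (Set.mem_iUnion.2 ⟨γ, h⟩)
  let A : ℕ → Set CantorSet := fun i => {x | x ∉ A0 ∧ ∃ k ∈ T.SS G, ∃ σ ∈ G,
    (∀ γ, k γ ≠ 0 → γ.1 = pre σ γ.1.length) ∧ ∃ᶠ n in atTop, 1 / ((i:ℝ) + 1) ≤ |T.ev G k (J (hh x n))|}
  have hcov : ∀ x, x ∉ A0 → ∃ i, x ∈ A i := by
    intro x hx
    obtain ⟨k, hk, hnt⟩ := exists_SS_not_null hc hJ x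
    have hinf : {γ | k γ ≠ 0}.Infinite := by
      intro hfin
      apply hnt
      simp only [ev_finite hl hk hfin.toFinset (fun γ h => by simpa using h)]
      have := tendsto_finsetSum hfin.toFinset fun γ _ =>
        (hA0' x hx γ).const_mul (k γ * ((1 + lam) * lam))
      simpa using this
    obtain ⟨σ, hσ, h⟩ := exists_along hG hk hinf
    obtain ⟨i, hi⟩ := freq_of_not_tendsto hnt
    exact ⟨i, hx, k, hk, σ, hσ, h, hi⟩
  obtain ⟨i, hi⟩ : ∃ i, ¬ (A i).Countable := by
    by_contra hcon
    push Not at hcon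
    have h1 : (A0 ∪ ⋃ i, A i).Countable := hA0.union (Set.countable_iUnion hcon)
    have h2 : A0 ∪ ⋃ i, A i = Set.univ := by
      refine Set.eq_univ_of_forall fun x => ?_
      by_cases hx : x ∈ A0
      · exact Or.inl hx
      · exact Or.inr (Set.mem_iUnion.2 (hcov x hx))
    rw [h2] at h1
    exact Set.not_countable_univ h1
  have hch : ∀ x, ∃ (k : List Λ × ℕ → ℝ) (σ : ℕ → Λ), x ∈ A i → k ∈ T.SS G ∧ σ ∈ G ∧
      (∀ γ, k γ ≠ 0 → γ.1 = pre σ γ.1.length) ∧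
      ∃ᶠ n in atTop, 1 / ((i:ℝ) + 1) ≤ |T.ev G k (J (hh x n))| := by
    intro x
    by_cases hx : x ∈ A i
    · obtain ⟨_, k, hk, σ, hσ, h⟩ := hx
      exact ⟨k, σ, fun _ => ⟨hk, hσ, h⟩⟩
    · obtain ⟨k, hk, _⟩ := exists_SS_not_null hc hJ x
      by_cases hΛ : Nonempty Λ
      · exact ⟨k, fun _ => hΛ.some, fun h => absurd h hx⟩
      · exfalso
        have : (A i).Countable := by
          convert Set.countable_empty
          refine Set.eq_empty_of_forall_notMem ?_
          rintro y ⟨_, _, _, σ, _⟩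
          exact hΛ ⟨σ 0⟩
        exact hi this
  choose k σ hkσ using hch
  have hfin := few_branches hl J (ε := 1 / ((i:ℝ) + 1)) (by positivity) (A := A i)
    (fun x hx => hA0' x hx.1) k σ (fun x hx => (hkσ x hx).1) (fun x hx => (hkσ x hx).2.2.1)
    (fun x hx => (hkσ x hx).2.2.2)
  obtain ⟨τ, hτ, hun⟩ : ∃ τ ∈ σ '' A i, ¬ (A i ∩ σ ⁻¹' {τ}).Countable := by
    by_contra hcon
    push Not at hcon
    refine hi ((hfin.countable.biUnion hcon).mono fun x hx => ?_)
    exact Set.mem_biUnion (Set.mem_image_of_mem σ hx) ⟨hx, rfl⟩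
  obtain ⟨y, hy, rfl⟩ := hτ
  have hτG := (hkσ y hy).2.1
  obtain ⟨P, hP⟩ := exists_P (T := T) hτG hl
  refine (T.branch (σ y)).nonuniv hl' hll (hNU _ hτG) ?_
  refine rosenthal_atoms (P.comp J) (ε := 1 / ((i:ℝ) + 1)) (by positivity) hun ?_
  rintro x ⟨hx, hxy⟩
  refine ⟨(T.ev G (k x)).comp J, fun f => ?_, (hkσ x hx).2.2.2⟩
  refine ev_le_P hτG hl (hkσ x hx).1 ?_ hP (J f)
  have := (hkσ x hx).2.2.1
  rw [Set.mem_preimage, Set.mem_singleton_iff] at hxy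
  rwa [hxy] at this

end TreeSys


theorem banach_mazur (L : Type) [NormedAddCommGroup L] [NormedSpace ℝ L]
    [TopologicalSpace.SeparableSpace L] : ∃ j : L →ₗᵢ[ℝ] CantorC, True := by
  obtain ⟨K, hKd⟩ : ∃ K : Set (WeakDual ℝ L),
      K = WeakDual.toStrongDual ⁻¹' Metric.closedBall (0 : StrongDual ℝ L) 1 := ⟨_, rfl⟩
  have hK : IsCompact K := by rw [hKd]; exact WeakDual.isCompact_closedBall (𝕜 := ℝ) (E := L) 0 1
  have hmem : ∀ φ : WeakDual ℝ L, φ ∈ K ↔ ‖WeakDual.toStrongDual φ‖ ≤ 1 := fun φ => by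
    rw [hKd]; simp
  haveI : TopologicalSpace.MetrizableSpace K := WeakDual.metrizable_of_isCompact ℝ L K hK
  letI : MetricSpace K := TopologicalSpace.metrizableSpaceMetric K
  haveI : CompactSpace K := isCompact_iff_compactSpace.mp hK
  haveI : Nonempty K := ⟨⟨0, by rw [hmem]; simp⟩⟩
  obtain ⟨f, hf, hs⟩ := exists_nat_bool_continuous_surjective_of_compact K
  have hb : ∀ (φ : K) (x : L), |φ.1 x| ≤ ‖x‖ := fun φ x => by
    have h1 := (WeakDual.toStrongDual φ.1).le_opNorm x
    have h2 := (hmem _).1 φ.2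
    have h3 : ‖(WeakDual.toStrongDual φ.1) x‖ = |φ.1 x| := rfl
    rw [← h3]
    nlinarith [norm_nonneg x]
  have hc : ∀ x : L, Continuous fun t => (f t).1 x := fun x =>
    (WeakDual.eval_continuous x).comp (continuous_subtype_val.comp hf)
  let j : L →ₗ[ℝ] CantorC :=
    { toFun := fun x => ⟨fun t => (f t).1 x, hc x⟩
      map_add' := fun x y => by ext t; simp
      map_smul' := fun a x => by ext t; simp }
  refine ⟨⟨j, fun x => le_antisymm ?_ ?_⟩, trivial⟩
  · rw [ContinuousMap.norm_le _ (norm_nonneg _)]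
    intro t; exact hb _ _
  · obtain ⟨φ, h1, h2⟩ := exists_dual_vector'' ℝ x
    obtain ⟨t, ht⟩ := hs ⟨StrongDual.toWeakDual φ, by rw [hmem]; exact h1⟩
    have h3 : j x t = ‖x‖ := by
      change (f t).1 x = ‖x‖
      rw [ht]; exact h2
    calc ‖x‖ = ‖j x t‖ := by rw [h3, norm_norm]
      _ ≤ _ := ContinuousMap.norm_coe_le_norm (j x) t

theorem BM_transfer {G H : Type} [NormedAddCommGroup G] [NormedSpace ℝ G] [NormedAddCommGroup H]
    [NormedSpace ℝ H] (u : G ≃ₗᵢ[ℝ] H) {n : ℕ} {θ : ℝ} (h : BMdistToLinftyLE G n θ) :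
    BMdistToLinftyLE H n θ := by
  intro θ' hθ
  obtain ⟨e, he⟩ := h θ' hθ
  refine ⟨u.symm.toContinuousLinearEquiv.trans e, le_trans ?_ he⟩
  refine mul_le_mul ?_ ?_ (norm_nonneg _) (norm_nonneg _)
  · refine ContinuousLinearMap.opNorm_le_bound _ (norm_nonneg _) fun x => ?_
    have := (e : G →L[ℝ] (Fin n → ℝ)).le_opNorm (u.symm x)
    simpa using this
  · refine ContinuousLinearMap.opNorm_le_bound _ (norm_nonneg _) fun x => ?_
    have := (e.symm : (Fin n → ℝ) →L[ℝ] G).le_opNorm x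
    simpa using this

theorem linfty_transfer {X Y : Type} [NormedAddCommGroup X] [NormedSpace ℝ X] [NormedAddCommGroup Y]
    [NormedSpace ℝ Y] (u : X ≃ₗᵢ[ℝ] Y) {lam : ℝ} (h : IsLinftyPlus lam X) :
    IsLinftyPlus lam Y := by
  intro θ hθ
  obtain ⟨h1, h2⟩ := h θ hθ
  refine ⟨fun hf => h1 (LinearEquiv.finiteDimensional u.toLinearEquiv.symm), fun F hF => ?_⟩
  obtain ⟨G, hG, hGf, hB⟩ := h2 (F.map (u.symm.toLinearEquiv : Y →ₗ[ℝ] X)) inferInstance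
  refine ⟨G.map (u.toLinearEquiv : X →ₗ[ℝ] Y), fun y hy => ⟨u.symm y, hG ⟨y, hy, rfl⟩, ?_⟩, ?_, ?_⟩
  · simp
  · infer_instance
  · have := BM_transfer (LinearIsometryEquiv.submoduleMap G u) hB
    have h3 : Module.finrank ℝ (G.map (u.toLinearEquiv : X →ₗ[ℝ] Y)) = Module.finrank ℝ G :=
      LinearEquiv.finrank_map_eq u.toLinearEquiv G
    rw [h3]
    exact this

theorem exists_final {E : Type} [NormedAddCommGroup E] [NormedSpace ℝ E] [CompleteSpace E]
    [TopologicalSpace.SeparableSpace E] (hE : ¬ Embeds CantorC E) {lam : ℝ} (hlam : 1 < lam) :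
    ∃ Y : SB, Y ∈ NU ∧ IsLinftyPlus lam ↥Y.1 ∧ Embeds E ↥Y.1 := by
  obtain ⟨T⟩ := exists_treeSys ℕ E lam ((1+lam)/2) (by linarith) (by linarith)
    (TopologicalSpace.denseSeq E)
  have S := T.branch id
  have hd : (Submodule.span ℝ (Set.range fun n => TopologicalSpace.denseSeq E (id n))).topologicalClosure
      = ⊤ := by
    rw [Submodule.eq_top_iff']
    intro x
    refine closure_mono Submodule.subset_span ?_
    exact TopologicalSpace.denseRange_denseSeq E x
  have hn : ¬ Embeds CantorC (Ban S.NL) := by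
    refine S.nonuniv (by linarith) (by linarith) fun h => hE ?_
    exact h.trans' (embeds_sub _)
  have hi : IsLinftyPlus lam (Ban S.NL) := S.isLinfty hlam.le
  have hem : Embeds E (Ban S.NL) := by
    refine Embeds.trans' ?_ ((S.X_embeds_X' (by linarith)).trans' (embeds_sub _))
    rw [hd]
    exact ⟨(LinearIsometryEquiv.ofTop E (⊤ : Submodule ℝ E) rfl).symm.toContinuousLinearEquiv, 1,
      one_pos, fun x => by simp⟩
  haveI : TopologicalSpace.SeparableSpace (Ban S.NL) := by
    apply Ban_separable
    refine ⟨Set.range fun γ : List ℕ × ℕ => Finsupp.single γ (1:ℝ), Set.countable_range _, ?_⟩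
    have := (Finsupp.basisSingleOne (R := ℝ) (ι := List ℕ × ℕ)).span_eq
    simpa using this
  obtain ⟨j, -⟩ := banach_mazur (Ban S.NL)
  let Y : Submodule ℝ CantorC := LinearMap.range j.toLinearMap
  have hY : IsClosed (Y : Set CantorC) := by
    have := j.isometry.isClosedEmbedding.isClosed_range
    have h2 : (Y : Set CantorC) = Set.range j := by ext; simp [Y]
    rw [h2]; exact this
  let u : Ban S.NL ≃ₗᵢ[ℝ] Y := j.equivRange
  refine ⟨⟨Y, hY⟩, fun h => hn ?_, linfty_transfer u hi, hem.trans' ?_⟩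
  · refine Embeds.trans' h (⟨u.symm.toContinuousLinearEquiv, 1, one_pos, fun x => ?_⟩)
    have : ‖u.symm x‖ = ‖x‖ := u.symm.norm_map x
    rw [one_mul]; exact this.ge
  · refine ⟨u.toContinuousLinearEquiv, 1, one_pos, fun x => ?_⟩
    have : ‖u x‖ = ‖x‖ := u.norm_map x
    rw [one_mul]; exact this.ge


section TreeRank
variable {Λ : Type} {T : Set (List Λ)}

theorem tdi_zero : treeDerivIter T 0 = T := by
  simp [treeDerivIter]

theorem tdi_succ (α : Ordinal.{0}) : treeDerivIter T (Order.succ α) = treeDeriv (treeDerivIter T α) := by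
  simp [treeDerivIter]

theorem tdi_limit {o : Ordinal.{0}} (h : Order.IsSuccLimit o) :
    treeDerivIter T o = ⋂ (o' : Ordinal.{0}) (_ : o' < o), treeDerivIter T o' := by
  rw [treeDerivIter, Ordinal.limitRecOn_limit _ _ _ _ h]
  rfl

theorem tdi_anti {α β : Ordinal.{0}} (h : α ≤ β) : treeDerivIter T β ⊆ treeDerivIter T α := by
  induction β using Ordinal.limitRecOn with
  | zero => rw [nonpos_iff_eq_zero.1 h]
  | add_one β ih =>
    rcases h.eq_or_lt with rfl | h
    · exact subset_rfl
    · have h1 := ih (Order.lt_succ_iff.1 h)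
      refine subset_trans ?_ h1
      change treeDerivIter T (Order.succ β) ⊆ _
      rw [tdi_succ]
      exact fun l hl => hl.1
  | limit β hβ ih =>
    rcases h.eq_or_lt with rfl | h
    · exact subset_rfl
    · rw [tdi_limit hβ]
      exact Set.iInter₂_subset α h

/-- closed under initial segments, in one step -/
theorem tdi_step (hT : ∀ u a, u ++ [a] ∈ T → u ∈ T) {u : List Λ} {a : Λ} {β : Ordinal.{0}}
    (h : ∀ γ < β, u ++ [a] ∈ treeDerivIter T γ) (h0 : u ++ [a] ∈ T) : u ∈ treeDerivIter T β := by
  induction β using Ordinal.limitRecOn with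
  | zero => rw [tdi_zero]; exact hT u a h0
  | add_one β ih =>
    change _ ∈ treeDerivIter T (Order.succ β)
    rw [tdi_succ]
    exact ⟨ih fun γ hγ => h γ (hγ.trans (Order.lt_succ β)), a, h β (Order.lt_succ β)⟩
  | limit β hβ ih =>
    rw [tdi_limit hβ]
    exact Set.mem_iInter₂.2 fun γ hγ => ih γ hγ fun γ' h' => h γ' (h'.trans hγ)

noncomputable def rk (T : Set (List Λ)) (u : List Λ) : Ordinal.{0} :=
  sInf {α | u ∉ treeDerivIter T α}

theorem rk_le {u : List Λ} {ξ : Ordinal.{0}} (h : treeDerivIter T ξ = ∅) : rk T u ≤ ξ :=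
  csInf_le' (by simp [h])

theorem rk_lt (hT : ∀ u a, u ++ [a] ∈ T → u ∈ T) {ξ : Ordinal.{0}} (h : treeDerivIter T ξ = ∅)
    {u : List Λ} {a : Λ} (hu : u ++ [a] ∈ T) : rk T (u ++ [a]) < rk T u := by
  by_contra! hle
  have h1 : u ∉ treeDerivIter T (rk T u) :=
    csInf_mem (s := {α | u ∉ treeDerivIter T α}) ⟨ξ, by simp [h]⟩
  refine h1 (tdi_step hT (a := a) (fun γ hγ => ?_) hu)
  by_contra hc
  exact absurd (csInf_le' (s := {α | u ++ [a] ∉ treeDerivIter T α}) hc) (not_le.2 (hγ.trans_le hle))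

theorem exists_empty (hT : ∀ u a, u ++ [a] ∈ T → u ∈ T) (hw : ¬ TreeIllFounded T) :
    ∃ ξ : Ordinal.{0}, treeDerivIter T ξ = ∅ := by
  obtain ⟨P, hP⟩ : ∃ P : Set (List Λ), ∀ l, l ∈ P ↔ ∀ α, l ∈ treeDerivIter T α :=
    ⟨{l | ∀ α, l ∈ treeDerivIter T α}, fun l => Iff.rfl⟩
  have hrk : ∀ l, l ∉ P → l ∉ treeDerivIter T (rk T l) := fun l hl => by
    rw [hP] at hl; push Not at hl
    obtain ⟨α, hα⟩ := hl
    exact csInf_mem (s := {α | l ∉ treeDerivIter T α}) ⟨α, hα⟩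
  by_cases hne : P = ∅
  · refine ⟨⨆ l, rk T l, Set.eq_empty_of_forall_notMem fun l hl => ?_⟩
    exact hrk l (by simp [hne]) (tdi_anti (Ordinal.le_iSup (rk T) l) hl)
  · exfalso
    have hpre : ∀ u a, u ++ [a] ∈ P → u ∈ P := fun u a h => by
      rw [hP] at h ⊢
      intro α
      refine tdi_step hT (a := a) (fun γ _ => h γ) ?_
      have := h 0
      rwa [tdi_zero] at this
    have hnil : [] ∈ P := by
      obtain ⟨l, hl⟩ := Set.nonempty_iff_ne_empty.2 hne
      induction l using List.reverseRecOn with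
      | nil => exact hl
      | append_singleton l a ih => exact ih (hpre _ _ hl)
    have hext : ∀ l, l ∈ P → ∃ a, l ++ [a] ∈ P := fun l hl => by
      by_contra! hc
      have h1 := (hP l).1 hl (Order.succ (⨆ a, rk T (l ++ [a])))
      rw [tdi_succ] at h1
      obtain ⟨-, a, ha⟩ := h1
      exact hrk _ (hc a) (tdi_anti (Ordinal.le_iSup (fun a => rk T (l ++ [a])) a) ha)
    choose nx hnx using fun l : P => hext l.1 l.2
    let seq : ℕ → P := fun n => Nat.rec ⟨[], hnil⟩ (fun _ l => ⟨l.1 ++ [nx l], hnx l⟩) n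
    have hseq : ∀ n, (seq (n+1)).1 = (seq n).1 ++ [nx (seq n)] := fun n => rfl
    refine hw ⟨fun n => nx (seq n), fun n => ?_⟩
    have : (List.ofFn fun i : Fin n => nx (seq i)) = (seq n).1 := by
      induction n with
      | zero => simp [seq]
      | succ n ih => rw [hseq, ← ih, List.ofFn_succ_last]; simp
    rw [this]
    have h2 := (hP _).1 (seq n).2 0
    rwa [tdi_zero] at h2

end TreeRank

theorem bt_tree {W : Type} [SeminormedAddCommGroup W] [NormedSpace ℝ W] (e : ℕ → W)
    (δ : ℝ) (Y : Type) [SeminormedAddCommGroup Y] [NormedSpace ℝ Y] :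
    ∀ u a, u ++ [a] ∈ bourgainTree e δ Y → u ∈ bourgainTree e δ Y := by
  intro u a h b
  have h1 := h (fun i => if i < u.length then b i else 0)
  have h2 : ∑ i ∈ Finset.range (u ++ [a]).length, (if i < u.length then b i else 0) • e i
      = ∑ i ∈ Finset.range u.length, b i • e i := by
    rw [List.length_append, List.length_singleton, Finset.sum_range_succ]
    simp only [lt_irrefl, if_false, zero_smul, add_zero]
    refine Finset.sum_congr rfl fun i hi => ?_
    rw [if_pos (Finset.mem_range.1 hi)]
  have h3 : ∑ i ∈ Finset.range (u ++ [a]).length, (if i < u.length then b i else 0) • (u ++ [a]).getD i 0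
      = ∑ i ∈ Finset.range u.length, b i • u.getD i 0 := by
    rw [List.length_append, List.length_singleton, Finset.sum_range_succ]
    simp only [lt_irrefl, if_false, zero_smul, add_zero]
    refine Finset.sum_congr rfl fun i hi => ?_
    have hi := Finset.mem_range.1 hi
    rw [if_pos hi, List.getD_append _ _ _ _ hi]
  rw [h2, h3] at h1
  exact h1

theorem index_empty {e : ℕ → CantorC} {X : Type} [NormedAddCommGroup X] [NormedSpace ℝ X]
    {ξ : Ordinal.{0}} (hξ : ξ < omega1) (h : bourgainIndex e X ≤ ξ) {δ : ℝ} (hδ : 0 < δ)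
    (hδ1 : δ ≤ 1) : treeDerivIter (bourgainTree e δ X) ξ = ∅ := by
  unfold bourgainIndex at h
  split_ifs at h with hc
  · exact absurd h (not_le.2 hξ)
  · have hw : ¬ TreeIllFounded (bourgainTree e δ X) := fun h' => hc ⟨δ, ⟨hδ, hδ1⟩, h'⟩
    have h1 : treeRank (bourgainTree e δ X) ≤ ξ :=
      le_trans (Ordinal.le_iSup (fun δ : Set.Ioc (0:ℝ) 1 => treeRank (bourgainTree e δ.1 X))
        ⟨δ, hδ, hδ1⟩) h
    have h2 : treeDerivIter (bourgainTree e δ X) (treeRank (bourgainTree e δ X)) = ∅ :=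
      csInf_mem (s := {α | treeDerivIter (bourgainTree e δ X) α = ∅})
        (exists_empty (bt_tree e δ X) hw)
    exact Set.subset_empty_iff.1 ((tdi_anti h1).trans h2.le)

theorem bt_range {W : Type} [SeminormedAddCommGroup W] [NormedSpace ℝ W] {e : ℕ → W}
    {δ : ℝ} {Y : Type} [SeminormedAddCommGroup Y] [NormedSpace ℝ Y] {y : ℕ → Y} {n : ℕ}
    (h : ∀ a : ℕ → ℝ, δ * ‖∑ i ∈ Finset.range n, a i • e i‖ ≤ ‖∑ i ∈ Finset.range n, a i • y i‖ ∧
      ‖∑ i ∈ Finset.range n, a i • y i‖ ≤ δ⁻¹ * ‖∑ i ∈ Finset.range n, a i • e i‖) :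
    (List.range n).map y ∈ bourgainTree e δ Y := by
  intro a
  have h1 : ∑ i ∈ Finset.range ((List.range n).map y).length, a i • ((List.range n).map y).getD i 0
      = ∑ i ∈ Finset.range n, a i • y i := by
    rw [List.length_map, List.length_range]
    refine Finset.sum_congr rfl fun i hi => ?_
    have hi := Finset.mem_range.1 hi
    simp [List.getD, hi]
  rw [h1, List.length_map, List.length_range]
  exact h a

/-- Transfer of Bourgain tree membership through an isomorphic embedding. -/
theorem bt_transfer {W : Type} [SeminormedAddCommGroup W] [NormedSpace ℝ W] {e : ℕ → W}
    {δ : ℝ} (hδ : 0 < δ) {X Y : Type} [NormedAddCommGroup X] [NormedSpace ℝ X]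
    [NormedAddCommGroup Y] [NormedSpace ℝ Y] (R : X →ₗ[ℝ] Y)
    (h1 : ∀ x, ‖x‖ ≤ 2 * ‖R x‖) (h2 : ∀ x, ‖R x‖ ≤ 2 * ‖x‖) {l : List X}
    (hl : l.map R ∈ bourgainTree e δ Y) : l ∈ bourgainTree e (δ / 2) X := by
  intro a
  have h := hl a
  have h3 : ∑ i ∈ Finset.range (l.map R).length, a i • (l.map R).getD i 0
      = R (∑ i ∈ Finset.range l.length, a i • l.getD i 0) := by
    rw [map_sum, List.length_map]
    refine Finset.sum_congr rfl fun i hi => ?_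
    have hi := Finset.mem_range.1 hi
    simp [List.getD, hi]
  rw [h3, List.length_map] at h
  obtain ⟨ha, hb⟩ := h
  have h4 := h1 (∑ i ∈ Finset.range l.length, a i • l.getD i 0)
  have h5 := h2 (∑ i ∈ Finset.range l.length, a i • l.getD i 0)
  refine ⟨by linarith, ?_⟩
  have : (δ / 2)⁻¹ = 2 * δ⁻¹ := by field_simp
  rw [this]
  linarith


section RV
variable {E : Type} [NormedAddCommGroup E] [NormedSpace ℝ E]

/-- rational combinations of a sequence -/
noncomputable def rv (x : ℕ → E) (c : ℕ →₀ ℚ) : E := c.sum fun i q => (q : ℝ) • x i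

theorem rv_add (x : ℕ → E) (c d) : rv x (c + d) = rv x c + rv x d :=
  Finsupp.sum_add_index' (by simp) (by intro i a b; push_cast; rw [add_smul])

theorem rv_smul (x : ℕ → E) (q : ℚ) (c) : rv x (q • c) = (q : ℝ) • rv x c := by
  unfold rv
  rw [Finsupp.sum_smul_index (by simp), Finsupp.smul_sum]
  simp [mul_smul]

theorem rv_single (x : ℕ → E) (n) : rv x (Finsupp.single n 1) = x n := by
  simp [rv]

theorem rv_map {F : Type} [NormedAddCommGroup F] [NormedSpace ℝ F] (R : E →ₗ[ℝ] F) (x : ℕ → E) (c) :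
    rv (fun n => R (x n)) c = R (rv x c) := by
  simp [rv, Finsupp.sum, map_sum]

theorem rv_congr {x y : ℕ → E} {c : ℕ →₀ ℚ} (h : ∀ i ∈ c.support, x i = y i) : rv x c = rv y c :=
  Finset.sum_congr rfl fun i hi => by
    dsimp only; rw [h i hi]

theorem rv_mem (x : ℕ → E) (c) : rv x c ∈ Submodule.span ℝ (Set.range x) :=
  Submodule.sum_mem _ fun i _ => Submodule.smul_mem _ _ (Submodule.subset_span ⟨i, rfl⟩)

theorem span_le_closure_rv (x : ℕ → E) :
    (Submodule.span ℝ (Set.range x) : Set E) ⊆ closure (Set.range (rv x)) := by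
  intro y hy
  refine Submodule.span_induction ?_ ?_ ?_ ?_ hy
  · rintro _ ⟨n, rfl⟩
    exact subset_closure ⟨_, rv_single x n⟩
  · exact subset_closure ⟨0, by simp [rv]⟩
  · intro a b _ _ ha hb
    refine map_mem_closure₂ continuous_add ha hb ?_
    rintro _ ⟨c, rfl⟩ _ ⟨d, rfl⟩
    exact ⟨c + d, rv_add x c d⟩
  · intro r a _ ha
    have hr : r ∈ closure (Set.range ((↑) : ℚ → ℝ)) := Rat.denseRange_cast r
    refine map_mem_closure₂ continuous_smul hr ha ?_
    rintro _ ⟨q, rfl⟩ _ ⟨c, rfl⟩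
    exact ⟨q • c, rv_smul x q c⟩

end RV

theorem basis_li {e : ℕ → CantorC} (h : IsSchauderBasis e) : LinearIndependent ℝ e := by
  rw [linearIndependent_iff]
  intro l hl
  obtain ⟨a, ha, hu⟩ := h 0
  have h0 := hu (fun _ => 0) (by simp)
  have h1 := hu (fun n => l n) (by
    obtain ⟨N, hN⟩ : ∃ N, ∀ i ∈ l.support, i < N :=
      ⟨l.support.sup id + 1, fun i hi => Nat.lt_succ_of_le (Finset.le_sup (f := id) hi)⟩
    refine tendsto_const_nhds.congr' ?_
    filter_upwards [eventually_ge_atTop N] with m hm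
    rw [← hl, Finsupp.linearCombination_apply, Finsupp.sum]
    refine Finset.sum_subset (fun i hi => Finset.mem_range.2 ((hN i hi).trans_le hm)) ?_
    intro i _ hi
    rw [Finsupp.notMem_support_iff.1 hi, zero_smul])
  ext n
  have := congrFun (h1.trans h0.symm) n
  simpa using this

/-- goodness of a coded sequence -/
def GoodSeq (e : ℕ → CantorC) (x : ℕ → CantorC) (w : ℕ × List (ℕ →₀ ℚ) → Ordinal.{0}) : Prop :=
  ∀ (k : ℕ) u c, (u ++ [c]).map (rv x) ∈ bourgainTree e (1 / ((k:ℝ) + 1)) CantorC →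
    w (k, u ++ [c]) < w (k, u)

theorem perturb_core' {W E : Type} [NormedAddCommGroup W] [NormedSpace ℝ W]
    [NormedAddCommGroup E] [NormedSpace ℝ E] [CompleteSpace E] {e : ℕ → W}
    (he : LinearIndependent ℝ e) (T : W →L[ℝ] E) (c : ℝ) (hc : 0 < c) (hT : ∀ x, c * ‖x‖ ≤ ‖T x‖)
    {Q : Set E} (hQd : Dense Q) : ∃ (y : ℕ → E) (k : ℕ), (∀ n, y n ∈ Q) ∧ ∀ n (a : ℕ → ℝ),
      1 / ((k:ℝ)+1) * ‖∑ i ∈ Finset.range n, a i • e i‖ ≤ ‖∑ i ∈ Finset.range n, a i • y i‖ ∧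
      ‖∑ i ∈ Finset.range n, a i • y i‖ ≤ (1 / ((k:ℝ)+1))⁻¹ * ‖∑ i ∈ Finset.range n, a i • e i‖ := by
  have hTi : LinearMap.ker (T : W →ₗ[ℝ] E) = ⊥ := by
    rw [LinearMap.ker_eq_bot']
    intro m hm
    have h1 := hT m
    have h2 : T m = 0 := hm
    rw [h2, norm_zero] at h1
    have : ‖m‖ ≤ 0 := by nlinarith [norm_nonneg m]
    simpa using this
  obtain ⟨S, hS, hSQ⟩ := perturb (fun n => T (e n)) (he.map' _ hTi) Q hQd (1/2) (by norm_num)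
    (by norm_num)
  obtain ⟨k, hk⟩ := exists_nat_gt (max (2/c) (2 * ‖T‖))
  have hk1 : 2/c < k := (le_max_left _ _).trans_lt hk
  have hk2 : 2 * ‖T‖ < k := (le_max_right _ _).trans_lt hk
  refine ⟨_, k, hSQ, fun n a => ?_⟩
  have h1 : ∑ i ∈ Finset.range n, a i • S (T (e i)) =
      S (T (∑ i ∈ Finset.range n, a i • e i)) := by
    rw [map_sum, map_sum]
    refine Finset.sum_congr rfl fun i _ => ?_
    rw [map_smul, map_smul]
  rw [h1]
  generalize (∑ i ∈ Finset.range n, a i • e i) = v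
  have a1 := hT v
  have a2 := T.le_opNorm v
  have a3 := hS (T v)
  have a4 := norm_sub_norm_le (T v) (S (T v))
  have a5 := norm_sub_norm_le (S (T v)) (T v)
  rw [norm_sub_rev] at a4
  have hv := norm_nonneg v
  have hk1' : 2 < k * c := by rwa [div_lt_iff₀ hc] at hk1
  have hkp : (0:ℝ) < (k:ℝ) + 1 := by positivity
  constructor
  · have : 1 / ((k:ℝ)+1) ≤ c / 2 := by
      rw [div_le_div_iff₀ hkp (by norm_num)]; nlinarith
    nlinarith
  · rw [one_div, inv_inv]
    nlinarith

theorem good_nonuniv {e : ℕ → CantorC} (he : LinearIndependent ℝ e) {x : ℕ → CantorC}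
    {w : ℕ × List (ℕ →₀ ℚ) → Ordinal.{0}} (hg : GoodSeq e x w) :
    ¬ Embeds CantorC (Submodule.span ℝ (Set.range x)).topologicalClosure := by
  obtain ⟨X, hX⟩ : ∃ X, X = (Submodule.span ℝ (Set.range x)).topologicalClosure := ⟨_, rfl⟩
  have hXc : IsClosed (X : Set CantorC) := hX ▸ Submodule.isClosed_topologicalClosure _
  rw [← hX]
  rintro ⟨T, c, hc, hT⟩
  have : CompleteSpace X := hXc.completeSpace_coe
  obtain ⟨Q, hQ⟩ : ∃ Q : Set X, ∀ y, y ∈ Q ↔ ∃ c, rv x c = y.1 :=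
    ⟨{y | ∃ c, rv x c = y.1}, fun _ => Iff.rfl⟩
  have hsub : ∀ c, rv x c ∈ X := fun c => by
    rw [hX]; exact Submodule.le_topologicalClosure _ (rv_mem x c)
  have hQd : Dense Q := by
    intro y
    rw [closure_subtype]
    have h1 : y.1 ∈ closure (Set.range (rv x)) := by
      have h2 : y.1 ∈ closure (Submodule.span ℝ (Set.range x) : Set CantorC) := by
        have : ∀ y ∈ X, y ∈ (Submodule.span ℝ (Set.range x)).topologicalClosure := by
          rw [hX]; exact fun _ h => h
        exact this _ y.2
      have := closure_mono (span_le_closure_rv x) h2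
      rwa [closure_closure] at this
    refine closure_mono ?_ h1
    rintro _ ⟨c, rfl⟩
    exact ⟨⟨rv x c, hsub c⟩, (hQ _).2 ⟨c, rfl⟩, rfl⟩
  obtain ⟨y, k, hyQ, hyk⟩ := perturb_core' (E := X) he T c hc hT hQd
  choose cc hcc using fun n => (hQ _).1 (hyQ n)
  have hkey : ∀ n, ((List.range n).map cc).map (rv x) ∈ bourgainTree e (1 / ((k:ℝ)+1)) CantorC := by
    intro n
    rw [List.map_map]
    refine bt_range fun a => ?_
    have h1 : ∑ i ∈ Finset.range n, a i • (rv x ∘ cc) i =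
        ((∑ i ∈ Finset.range n, a i • y i : X) : CantorC) := by
      rw [Submodule.coe_sum]
      refine Finset.sum_congr rfl fun i _ => ?_
      rw [Submodule.coe_smul, Function.comp_apply, hcc]
    rw [h1]
    exact hyk n a
  have hdec : ∀ n, w (k, (List.range (n+1)).map cc) < w (k, (List.range n).map cc) := by
    intro n
    have h1 : (List.range (n+1)).map cc = (List.range n).map cc ++ [cc n] := by
      rw [List.range_succ, List.map_append]; rfl
    rw [h1]
    apply hg
    rw [← h1]
    exact hkey (n+1)
  exact (RelEmbedding.natGT (r := (· < ·)) (fun n => w (k, (List.range n).map cc)) hdec).not_wellFounded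
    wellFounded_lt

theorem exists_li_seq (X : Type) [NormedAddCommGroup X] [NormedSpace ℝ X]
    [TopologicalSpace.SeparableSpace X] (h : ¬ FiniteDimensional ℝ X) :
    ∃ x : ℕ → X, LinearIndependent ℝ x ∧ (Submodule.span ℝ (Set.range x)).topologicalClosure = ⊤ := by
  obtain ⟨b, hb, hsp, hli⟩ := exists_linearIndependent ℝ (Set.range (TopologicalSpace.denseSeq X))
  have hd : (Submodule.span ℝ b).topologicalClosure = ⊤ := by
    rw [hsp, Submodule.eq_top_iff']
    intro x
    exact closure_mono Submodule.subset_span (TopologicalSpace.denseRange_denseSeq X x)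
  have hcount : b.Countable := (Set.countable_range _).mono hb
  have hinf : b.Infinite := by
    intro hf
    apply h
    have h1 : FiniteDimensional ℝ (Submodule.span ℝ b) := FiniteDimensional.span_of_finite ℝ hf
    have h2 : (Submodule.span ℝ b).topologicalClosure = Submodule.span ℝ b :=
      (Submodule.closed_of_finiteDimensional _).submodule_topologicalClosure_eq
    rw [h2] at hd
    rw [hd] at h1
    exact LinearEquiv.finiteDimensional (Submodule.topEquiv (R := ℝ) (M := X))
  have : Countable b := hcount
  have : Infinite b := hinf.to_subtype
  obtain ⟨hden⟩ := nonempty_denumerable b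
  let f : ℕ ≃ b := (Denumerable.eqv b).symm
  refine ⟨fun n => (f n).1, hli.comp f f.injective, ?_⟩
  have : Set.range (fun n => (f n).1) = b := by
    have := f.surjective.range_comp (fun y : b => y.1)
    rw [Subtype.range_coe] at this
    exact this
  rw [this, hd]

theorem exists_code {e : ℕ → CantorC} {X : Type} [NormedAddCommGroup X] [NormedSpace ℝ X]
    [TopologicalSpace.SeparableSpace X] (hX : ¬ FiniteDimensional ℝ X)
    {ξ : Ordinal.{0}} (hξ : ξ < omega1) (h : bourgainIndex e X ≤ ξ) {Q : Set CantorC}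
    (hQ : Dense Q) :
    ∃ (x : ℕ → CantorC) (w : ℕ × List (ℕ →₀ ℚ) → Ordinal.{0}), (∀ n, x n ∈ Q) ∧ (∀ i, w i ≤ ξ) ∧
      GoodSeq e x w ∧ Embeds X (Submodule.span ℝ (Set.range x)).topologicalClosure := by
  obtain ⟨j, -⟩ := banach_mazur X
  obtain ⟨x, hx, hd⟩ := exists_li_seq X hX
  have hy : LinearIndependent ℝ (fun n => j (x n)) :=
    hx.map' j.toLinearMap (LinearMap.ker_eq_bot.2 j.injective)
  obtain ⟨S, hS, hSQ⟩ := perturb _ hy Q hQ (1/2) (by norm_num) (by norm_num)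
  obtain ⟨R, hR⟩ : ∃ R : X →L[ℝ] CantorC, ∀ z, R z = S (j z) :=
    ⟨(S : CantorC →L[ℝ] CantorC).comp j.toContinuousLinearMap, fun _ => rfl⟩
  have hb : ∀ z, ‖z‖ ≤ 2 * ‖R z‖ ∧ ‖R z‖ ≤ 2 * ‖z‖ := by
    intro z
    rw [hR]
    have a3 := hS (j z)
    have a4 := norm_sub_norm_le (j z) (S (j z))
    have a5 := norm_sub_norm_le (S (j z)) (j z)
    rw [norm_sub_rev] at a4
    rw [j.norm_map] at *
    have := norm_nonneg z
    constructor <;> linarith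
  have hδ : ∀ k : ℕ, 0 < 1 / ((k:ℝ) + 1) / 2 ∧ 1 / ((k:ℝ) + 1) / 2 ≤ 1 := fun k => by
    have : 1 / ((k:ℝ) + 1) ≤ 1 := by
      rw [div_le_one (by positivity)]; have := Nat.cast_nonneg (α := ℝ) k; linarith
    constructor
    · positivity
    · linarith
  have hem := fun k => index_empty hξ h (hδ k).1 (hδ k).2
  have hrv : ∀ c, rv (fun n => R (x n)) c = R (rv x c) := fun c => rv_map (R : X →ₗ[ℝ] CantorC) x c
  refine ⟨fun n => R (x n), fun i => rk (bourgainTree e (1 / ((i.1:ℝ) + 1) / 2) X) (i.2.map (rv x)),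
    fun n => by dsimp only; rw [hR]; exact hSQ n, fun i => rk_le (hem i.1), ?_, ?_⟩
  · intro k u c huc
    dsimp only
    rw [List.map_append]
    refine rk_lt (bt_tree e _ X) (hem k) ?_
    refine bt_transfer (by positivity) (R : X →ₗ[ℝ] CantorC) (fun z => (hb z).1) (fun z => (hb z).2) ?_
    convert huc using 1
    have : (List.map (rv x) u ++ [rv x c]) = (u ++ [c]).map (rv x) := by simp
    change List.map _ (List.map (rv x) u ++ [rv x c]) = _
    rw [this, List.map_map]
    refine List.map_congr_left fun c _ => ?_
    exact (hrv c).symm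
  · have hm : ∀ z, R z ∈ (Submodule.span ℝ (Set.range fun n => R (x n))).topologicalClosure := by
      intro z
      have hz : z ∈ closure (Submodule.span ℝ (Set.range x) : Set X) := by
        have : z ∈ (Submodule.span ℝ (Set.range x)).topologicalClosure := by rw [hd]; trivial
        exact this
      refine map_mem_closure R.continuous hz fun y hy => ?_
      have : R y ∈ (Submodule.span ℝ (Set.range x)).map (R : X →ₗ[ℝ] CantorC) := ⟨y, hy, rfl⟩
      rw [Submodule.map_span, ← Set.range_comp] at this
      exact this
    refine ⟨R.codRestrict _ hm, 1/2, by norm_num, fun z => ?_⟩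
    have h1 : ‖R.codRestrict _ hm z‖ = ‖R z‖ := rfl
    rw [h1]
    have := (hb z).1
    linarith

theorem fd_embeds {X Y : Type} [NormedAddCommGroup X] [NormedSpace ℝ X] [NormedAddCommGroup Y]
    [NormedSpace ℝ Y] (hX : FiniteDimensional ℝ X) (hY : ¬ FiniteDimensional ℝ Y) : Embeds X Y := by
  have h1 : ∃ f : X →ₗ[ℝ] Y, Function.Injective f := by
    rw [← rank_le_iff_exists_linearMap]
    exact (Module.rank_lt_aleph0 ℝ X).le.trans (by
      by_contra! h
      exact hY (Module.rank_lt_aleph0_iff.1 h))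
  obtain ⟨f, hf⟩ := h1
  obtain ⟨K, hK, hK2⟩ := f.exists_antilipschitzWith (LinearMap.ker_eq_bot.2 hf)
  refine ⟨LinearMap.toContinuousLinearMap f, (K:ℝ)⁻¹, by positivity, fun x => ?_⟩
  have := hK2.le_mul_dist x 0
  rw [map_zero, dist_zero_right, dist_zero_right] at this
  rw [inv_mul_le_iff₀ (by exact_mod_cast hK)]
  exact this


theorem countable_Iic {ξ : Ordinal.{0}} (h : ξ < omega1) :
    ∃ ρ : ℕ → Ordinal.{0}, ∀ α ≤ ξ, ∃ n, ρ n = α := by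
  have h1 : (Set.Iio ξ).Countable := by
    rw [← Cardinal.le_aleph0_iff_set_countable, Cardinal.mk_Iio_ordinal]
    have : ξ.card < Cardinal.aleph 1 := Cardinal.lt_ord.1 h
    rw [← Order.lt_succ_iff] at *
    have h3 : ξ.card ≤ Cardinal.aleph0 := by
      rw [← Cardinal.succ_aleph0] at this
      exact Order.lt_succ_iff.1 this
    rw [Order.lt_succ_iff]
    exact Cardinal.lift_le_aleph0.2 h3
  have h2 : (Set.Iic ξ).Countable := by
    rw [← Set.Iio_insert]
    exact h1.insert _
  obtain ⟨f, hf⟩ := h2.exists_eq_range ⟨ξ, Set.mem_Iic.2 le_rfl⟩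
  refine ⟨f, fun α hα => ?_⟩
  have : α ∈ Set.range f := by rw [← hf]; exact hα
  exact this

theorem finite_dep (l : List (ℕ →₀ ℚ)) : ∃ N, ∀ c ∈ l, ∀ i ∈ c.support, i < N := by
  induction l with
  | nil => exact ⟨0, by simp⟩
  | cons c l ih =>
    obtain ⟨N, hN⟩ := ih
    refine ⟨max N (c.support.sup id + 1), ?_⟩
    intro d hd i hi
    rcases List.mem_cons.1 hd with rfl | hd
    · exact lt_max_of_lt_right (Nat.lt_succ_of_le (Finset.le_sup (f := id) hi))
    · exact lt_max_of_lt_left (hN d hd i hi)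

theorem nu_congr {x y : ℕ → CantorC} (h : ∀ n, x n = y n)
    (hn : ¬ Embeds CantorC (Submodule.span ℝ (Set.range x)).topologicalClosure) :
    ¬ Embeds CantorC (Submodule.span ℝ (Set.range y)).topologicalClosure := by
  have : x = y := funext h
  subst this
  exact hn

theorem emb_congr {x y : ℕ → CantorC} (h : ∀ n, x n = y n) {L : Type} [SeminormedAddCommGroup L]
    [NormedSpace ℝ L]
    (hn : Embeds (Submodule.span ℝ (Set.range x)).topologicalClosure L) :
    Embeds (Submodule.span ℝ (Set.range y)).topologicalClosure L := by
  have : x = y := funext h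
  subst this
  exact hn

theorem main_step (e : ℕ → CantorC) (he : LinearIndependent ℝ e) {lam : ℝ} (hlam : 1 < lam)
    {ξ : Ordinal.{0}} (hξ : ξ < omega1) (F : ℕ → SB) (hF : ∀ n, F n ∈ NU) :
    ∃ Y : SB, Y ∈ NU ∧ IsLinftyPlus lam ↥Y.1 ∧ (∀ n, Embeds ↥(F n).1 ↥Y.1) ∧
      ∀ (X : Type) [NormedAddCommGroup X] [NormedSpace ℝ X] [CompleteSpace X]
        [TopologicalSpace.SeparableSpace X], bourgainIndex e X ≤ ξ → Embeds X ↥Y.1 := by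
  obtain ⟨ρ, hρ⟩ := countable_Iic hξ
  obtain ⟨code, hcode⟩ := exists_injective_nat (ℕ × List (ℕ →₀ ℚ))
  have : ∀ n, TopologicalSpace.SeparableSpace (F n).1 := fun n => inferInstance
  obtain ⟨d, hd⟩ : ∃ d : ℕ → CantorC, DenseRange d :=
    ⟨_, TopologicalSpace.denseRange_denseSeq CantorC⟩
  obtain ⟨f, hf⟩ : ∃ f : ∀ n, ℕ → (F n).1, ∀ n, DenseRange (f n) :=
    ⟨_, fun n => TopologicalSpace.denseRange_denseSeq (F n).1⟩
  obtain ⟨g, hg1, hg2⟩ : ∃ g : (ℕ × ℕ) ⊕ (ℕ × ℕ) → CantorC, (∀ p, g (Sum.inl p) = d p.1) ∧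
      ∀ p, g (Sum.inr p) = (f p.1 p.2 : CantorC) :=
    ⟨fun s => Sum.elim (fun p => d p.1) (fun p => (f p.1 p.2 : CantorC)) s, fun _ => rfl, fun _ => rfl⟩
  obtain ⟨Gd, hGd⟩ : ∃ Gd : (ℕ → ℕ × ℕ) → Prop, ∀ τ, Gd τ ↔
      GoodSeq e (fun n => d (τ n).1) (fun i => ρ (τ (code i)).2) := ⟨_, fun _ => Iff.rfl⟩
  obtain ⟨G, hG⟩ : ∃ G : Set (ℕ → (ℕ × ℕ) ⊕ (ℕ × ℕ)), ∀ σ, σ ∈ G ↔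
      (∃ τ, σ = (fun n => Sum.inl (τ n)) ∧ Gd τ) ∨ ∃ i, σ = fun n => Sum.inr (i, n) :=
    ⟨{σ | _}, fun _ => Iff.rfl⟩
  obtain ⟨T⟩ := exists_treeSys ((ℕ × ℕ) ⊕ (ℕ × ℕ)) CantorC lam ((1+lam)/2) (by linarith)
    (by linarith) g
  have hclosed : ∀ σ, (∀ n, ∃ τ ∈ G, pre τ n = pre σ n) → σ ∈ G := by
    intro σ hσ
    have hσ' : ∀ n, ∃ τ ∈ G, ∀ i < n, τ i = σ i := fun n => by
      obtain ⟨τ, h1, h2⟩ := hσ n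
      exact ⟨τ, h1, pre_eq_iff.1 h2⟩
    rw [hG]
    rcases hs : σ 0 with p | p
    · left
      have hinl : ∀ n, ∃ τ, (∀ i < n + 1, σ i = Sum.inl (τ i)) ∧ Gd τ := by
        intro n
        obtain ⟨τ, h1, h2⟩ := hσ' (n+1)
        rcases (hG _).1 h1 with ⟨τ', rfl, h3⟩ | ⟨i, rfl⟩
        · exact ⟨τ', fun i hi => (h2 i hi).symm, h3⟩
        · have := h2 0 (by omega)
          rw [hs] at this
          cases this
      choose t ht1 ht2 using hinl
      have ht : ∀ n i, i < n + 1 → t n i = t i i := fun n i hi => by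
        have h1 := ht1 n i hi
        have h2 := ht1 i i (by omega)
        exact Sum.inl_injective (h1.symm.trans h2)
      refine ⟨fun n => t n n, funext fun n => ht1 n n (by omega), ?_⟩
      rw [hGd]
      intro k u c huc
      obtain ⟨N, hN⟩ := finite_dep (u ++ [c])
      obtain ⟨M, hM⟩ : ∃ M, M = max N (max (code (k, u)) (code (k, u ++ [c]))) := ⟨_, rfl⟩
      have hNM : N ≤ M := by omega
      have h1 := (hGd _).1 (ht2 M) k u c
      have h2 : ∀ i < M + 1, t M i = t i i := fun i hi => ht M i hi
      dsimp only at h1 ⊢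
      rw [h2 _ (by omega), h2 _ (by omega)] at h1
      refine h1 ?_
      have : (u ++ [c]).map (rv fun n => d (t M n).1) = (u ++ [c]).map (rv fun n => d (t n n).1) := by
        refine List.map_congr_left fun c' hc' => rv_congr fun i hi => ?_
        rw [h2 i (by have := hN c' hc' i hi; omega)]
      rw [this]
      exact huc
    · right
      refine ⟨p.1, funext fun n => ?_⟩
      obtain ⟨τ, h1, h2⟩ := hσ' (n+1)
      rcases (hG _).1 h1 with ⟨τ', rfl, h3⟩ | ⟨i, rfl⟩
      · have := h2 0 (by omega)
        rw [hs] at this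
        cases this
      · have h4 := h2 0 (by omega)
        rw [hs] at h4
        have h5 : (i, 0) = p := Sum.inr_injective h4
        rw [← h2 n (by omega), ← h5]
  have hle : ∀ i, (Submodule.span ℝ (Set.range fun n => (f i n : CantorC))).topologicalClosure
      = (F i).1 := by
    intro i
    refine le_antisymm ?_ ?_
    · refine Submodule.topologicalClosure_minimal _ ?_ (F i).2
      rw [Submodule.span_le]
      rintro _ ⟨n, rfl⟩
      exact (f i n).2
    · intro y hy
      have h1 : (⟨y, hy⟩ : (F i).1) ∈ closure (Set.range (f i)) := hf i _
      rw [closure_subtype] at h1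
      refine closure_mono ?_ h1
      rintro _ ⟨_, ⟨n, rfl⟩, rfl⟩
      exact Submodule.subset_span ⟨n, rfl⟩
  have hnu : ∀ σ ∈ G, ¬ Embeds CantorC
      (Submodule.span ℝ (Set.range fun n => g (σ n))).topologicalClosure := by
    intro σ hσ
    rcases (hG _).1 hσ with ⟨τ, rfl, h⟩ | ⟨i, rfl⟩
    · exact nu_congr (fun n => (hg1 (τ n)).symm) (good_nonuniv he ((hGd _).1 h))
    · refine nu_congr (fun n => (hg2 (i, n)).symm) fun h => ?_
      refine hF i (Embeds.trans' h (embeds_of_le (hle i).le))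
  have hE : ¬ Embeds CantorC (T.EA G) := T.EA_nonuniv (by linarith) (by linarith) hclosed hnu
  obtain ⟨Y, hY1, hY2, hY3⟩ := exists_final hE hlam
  refine ⟨Y, hY1, hY2, fun i => ?_, ?_⟩
  · have h1 : (fun n => Sum.inr (i, n)) ∈ G := (hG _).2 (Or.inr ⟨i, rfl⟩)
    have h2 := emb_congr (fun n => hg2 (i, n)) (T.X_embeds_EA h1 hlam.le)
    exact ((embeds_of_le (hle i).ge).trans' h2).trans' hY3
  · intro X _ _ _ _ hX
    by_cases hfd : FiniteDimensional ℝ X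
    · exact fd_embeds hfd (hY2 (lam+1) (by linarith)).1
    · obtain ⟨x, w, hx, hw, hgood, hemb⟩ := exists_code hfd hξ hX hd
      choose ν hν using hx
      choose μ hμ using fun i => hρ (w i) (hw i)
      have h1 : (fun n => Sum.inl (ν n, Function.extend code μ 0 n)) ∈ G := by
        refine (hG _).2 (Or.inl ⟨fun n => (ν n, Function.extend code μ 0 n), rfl, ?_⟩)
        rw [hGd]
        have h2 : (fun n => d (ν n)) = x := funext hν
        have h3 : (fun i => ρ (Function.extend code μ 0 (code i))) = w := funext fun i => by
          rw [hcode.extend_apply, hμ]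
        dsimp only
        rw [h2, h3]
        exact hgood
      have h2 := emb_congr (fun n => (hg1 (ν n, Function.extend code μ 0 n)).trans (hν n))
        (T.X_embeds_EA h1 hlam.le)
      exact (hemb.trans' h2).trans' hY3

def botSB : SB := ⟨⊥, by simp⟩

theorem botSB_NU : botSB ∈ NU := by
  rintro ⟨T, c, hc, hT⟩
  have h1 := hT 1
  have h2 : T 1 = 0 := Subtype.ext ((Submodule.mem_bot ℝ).1 (T 1).2)
  have h3 : ‖T 1‖ = 0 := by rw [h2]; exact norm_zero
  rw [h3, norm_one] at h1
  linarith

theorem main_rec (e : ℕ → CantorC) (he : LinearIndependent ℝ e) {lam : ℝ} (hlam : 1 < lam) :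
    ∃ Y : Ordinal.{0} → SB, ∀ ζ < omega1, Y ζ ∈ NU ∧ IsLinftyPlus lam ↥(Y ζ).1 ∧
      (∀ η < ζ, Embeds ↥(Y η).1 ↥(Y ζ).1) ∧
      ∀ (X : Type) [NormedAddCommGroup X] [NormedSpace ℝ X] [CompleteSpace X]
        [TopologicalSpace.SeparableSpace X], bourgainIndex e X ≤ ζ → Embeds X ↥(Y ζ).1 := by
  classical
  obtain ⟨spec, hspec⟩ : ∃ spec : ∀ ζ : Ordinal.{0}, (∀ η, η < ζ → SB) → SB → Prop,
      ∀ ζ prev Y, spec ζ prev Y ↔ (Y ∈ NU ∧ IsLinftyPlus lam ↥Y.1 ∧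
      (∀ η h, Embeds ↥(prev η h).1 ↥Y.1) ∧
      ∀ (X : Type) [NormedAddCommGroup X] [NormedSpace ℝ X] [CompleteSpace X]
        [TopologicalSpace.SeparableSpace X], bourgainIndex e X ≤ ζ → Embeds X ↥Y.1) :=
    ⟨_, fun _ _ _ => Iff.rfl⟩
  let step : ∀ ζ : Ordinal.{0}, (∀ η, η < ζ → SB) → SB := fun ζ prev =>
    if h : ∃ Y, spec ζ prev Y then h.choose else botSB
  let Y : Ordinal.{0} → SB := (wellFounded_lt (α := Ordinal.{0})).fix step
  have hY : ∀ ζ, Y ζ = step ζ (fun η _ => Y η) := fun ζ =>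
    WellFounded.fix_eq _ step ζ
  have key : ∀ ζ : Ordinal.{0}, ζ < omega1 → spec ζ (fun η _ => Y η) (Y ζ) := by
    intro ζ
    induction ζ using WellFoundedLT.induction with
    | ind ζ ih =>
    intro hζ
    have hex : ∃ Z, spec ζ (fun η _ => Y η) Z := by
      obtain ⟨ρ, hρ⟩ := countable_Iic hζ
      obtain ⟨Z, h1, h2, h3, h4⟩ := main_step e he hlam hζ
        (fun n => if ρ n < ζ then Y (ρ n) else botSB) (fun n => by
          split_ifs with h
          · exact ((hspec _ _ _).1 (ih _ h (h.trans hζ))).1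
          · exact botSB_NU)
      refine ⟨Z, (hspec _ _ _).2 ⟨h1, h2, fun η hη => ?_, h4⟩⟩
      obtain ⟨n, hn⟩ := hρ η hη.le
      have h5 := h3 n
      rw [hn, if_pos hη] at h5
      exact h5
    rw [hY ζ]
    have : step ζ (fun η _ => Y η) = hex.choose := dif_pos hex
    rw [this]
    exact hex.choose_spec
  exact ⟨Y, fun ζ hζ => (hspec _ _ _).1 (key ζ hζ)⟩



end


/-- **Corollary.** For every `λ > 1` there is a family `{Y_ξ : ξ < ω₁}` of separable
Banach spaces such that: (i) every `Y_ξ` is non-universal and `𝓛_{∞,λ+}`;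
(ii) `Y_ξ` embeds into `Y_ζ` for `ξ < ζ < ω₁`; (iii) every separable Banach space `X`
with `φ_NU(X) ≤ ξ` embeds into `Y_ξ`. -/
theorem linfty_family_exhausting_nonuniversal
    (e : ℕ → CantorC) (hbasis : IsSchauderBasis e) (hnorm : ∀ n, ‖e n‖ = 1)
    (lam : ℝ) (hlam : 1 < lam) :
    ∃ Y : Ordinal.{0} → SB,
      (∀ ξ : Ordinal.{0}, ξ < omega1 → Y ξ ∈ NU ∧ IsLinftyPlus lam ↥(Y ξ).1) ∧
      (∀ ξ ζ : Ordinal.{0}, ξ < ζ → ζ < omega1 → Embeds ↥(Y ξ).1 ↥(Y ζ).1) ∧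
      (∀ ξ : Ordinal.{0}, ξ < omega1 →
        ∀ (X : Type) [NormedAddCommGroup X] [NormedSpace ℝ X] [CompleteSpace X]
          [TopologicalSpace.SeparableSpace X],
          bourgainIndex e X ≤ ξ → Embeds X ↥(Y ξ).1) := by
  obtain ⟨Y, hY⟩ := main_rec e (basis_li hbasis) hlam
  exact ⟨Y, fun ξ hξ => ⟨(hY ξ hξ).1, (hY ξ hξ).2.1⟩,
    fun ξ ζ h hζ => (hY ζ hζ).2.2.1 ξ h, fun ξ hξ X _ _ _ _ hX => (hY ξ hξ).2.2.2 X hX⟩
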